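/- Let K be a field of characteristic two and let A = Q(3A)_2^2 be the algebra of quaternion type given by the stated quiver and relations. Then the module M = A ⊕ M_1 ⊕ M_2 ⊕ M_3 ⊕ M_4 is a 3-cluster tilting A-module. -/

import Mathlib

open CategoryTheory

universe u

section HomologicalDefs

variable (R : Type u) [Ring R]

/-- The `i`-th Ext group of the `R`-modules `M` and `N`, computed in `ModuleCat R`. -/
noncomputable def extGrp (i : ℕ) (M N : ModuleCat.{u} R) : Type u :=
  ((Ext ℤ (ModuleCat.{u} R) i).obj (Opposite.op M)).obj N

/-- `Ext^i_R(M, N) = 0`. -/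
def ExtVanish (i : ℕ) (M N : ModuleCat.{u} R) : Prop :=
  Subsingleton (extGrp R i M N)

/-- `X` lies in `add M`: it is a direct summand of a finite direct sum of copies of `M`. -/
def MemAdd (M X : ModuleCat.{u} R) : Prop :=
  ∃ (k : ℕ) (f : X →ₗ[R] (Fin k → M)) (g : (Fin k → M) →ₗ[R] X),
    g.comp f = LinearMap.id

/-- `M` is an `n`-cluster tilting module for the ring `R`: `M` is a finite module and,
among the finite (= finite-dimensional) `R`-modules `X`, the members of `add M` are exactly
those with `Ext^i(M, X) = 0` for `1 ≤ i ≤ n - 1`, and also exactly those with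
`Ext^i(X, M) = 0` for `1 ≤ i ≤ n - 1`. -/
def IsNClusterTilting (n : ℕ) (M : ModuleCat.{u} R) : Prop :=
  Module.Finite R M ∧
  (∀ X : ModuleCat.{u} R, Module.Finite R X →
    (MemAdd R M X ↔ ∀ i, 1 ≤ i → i ≤ n - 1 → ExtVanish R i M X)) ∧
  (∀ X : ModuleCat.{u} R, Module.Finite R X →
    (MemAdd R M X ↔ ∀ i, 1 ≤ i → i ≤ n - 1 → ExtVanish R i X M))

/-- `X` admits a projective resolution `0 → P_m → ⋯ → P_0 → X → 0` of length at most `m`. -/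
def ProjDimLE (X : ModuleCat.{u} R) (m : ℕ) : Prop :=
  ∃ (P : ℕ → ModuleCat.{u} R) (d : ∀ i, P (i + 1) ⟶ P i) (ε : P 0 ⟶ X),
    (∀ i, i ≤ m → Module.Projective R (P i)) ∧
    (∀ i, m < i → Subsingleton (P i)) ∧
    Function.Surjective ε ∧ Function.Exact (d 0) ε ∧
    (∀ i, Function.Exact (d (i + 1)) (d i))

/-- The projective dimension of the `R`-module `X`, as an extended natural number. -/
noncomputable def projDim (X : ModuleCat.{u} R) : ℕ∞ :=
  sInf {n : ℕ∞ | ∃ m : ℕ, n = (m : ℕ∞) ∧ ProjDimLE R X m}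

/-- The global dimension of the ring `R`: the supremum of the projective dimensions of all
finite (= finite-dimensional) `R`-modules. -/
noncomputable def globalDim : ℕ∞ :=
  ⨆ (X : ModuleCat.{u} R) (_ : Module.Finite R X), projDim R X

/-- There is an exact sequence `0 → R → I_0 → ⋯ → I_{m-1}` of `R`-modules in which every
`I_j` is both projective and injective. -/
def DomDimGE (m : ℕ) : Prop :=
  ∃ (I : ℕ → ModuleCat.{u} R) (f : ModuleCat.of R R ⟶ I 0) (d : ∀ i, I i ⟶ I (i + 1)),
    (∀ i, i < m → Module.Projective R (I i) ∧ Module.Injective R (I i)) ∧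
    (1 ≤ m → Function.Injective f) ∧
    (2 ≤ m → Function.Exact f (d 0)) ∧
    (∀ i, i + 3 ≤ m → Function.Exact (d i) (d (i + 1)))

/-- The dominant dimension of the ring `R`: the supremum of the lengths `m` of exact sequences
`0 → R → I_0 → ⋯ → I_{m-1}` with all `I_j` projective and injective. -/
noncomputable def domDim : ℕ∞ :=
  sSup {n : ℕ∞ | ∃ m : ℕ, n = (m : ℕ∞) ∧ DomDimGE R m}

end HomologicalDefs

/-- The generators of the quiver of the algebra `Q(3A)₂²`: three vertex idempotents
`v1, v2, v3` and four arrows `ab : 1 → 2`, `ay : 2 → 1`, `ad : 2 → 3`, `an : 3 → 2`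
(named `b`, `y`, `d`, `n` in the informal description). -/
inductive QGen : Type
  | v1 | v2 | v3 | ab | ay | ad | an

open QGen FreeAlgebra in
/-- The defining relations presenting the algebra of quaternion type `Q(3A)₂²` as a quotient
of the free algebra on the vertices and arrows of the quiver: the vertex idempotents are
pairwise orthogonal idempotents summing to `1`, the arrows have the prescribed sources and
targets, and the relations `byb = bdnybdn`, `yby = dnybdny`, `ndn = nybdnyb`,
`dnd = ybdnybd`, `bybd = 0`, `ndny = 0` hold (paths are composed from left to right). -/
inductive QuatRel (K : Type u) [CommRing K] : FreeAlgebra K QGen → FreeAlgebra K QGen → Prop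
  | idem1 : QuatRel K (ι K v1 * ι K v1) (ι K v1)
  | idem2 : QuatRel K (ι K v2 * ι K v2) (ι K v2)
  | idem3 : QuatRel K (ι K v3 * ι K v3) (ι K v3)
  | orth12 : QuatRel K (ι K v1 * ι K v2) 0
  | orth21 : QuatRel K (ι K v2 * ι K v1) 0
  | orth13 : QuatRel K (ι K v1 * ι K v3) 0
  | orth31 : QuatRel K (ι K v3 * ι K v1) 0
  | orth23 : QuatRel K (ι K v2 * ι K v3) 0
  | orth32 : QuatRel K (ι K v3 * ι K v2) 0
  | unit : QuatRel K (ι K v1 + ι K v2 + ι K v3) 1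
  | src_b : QuatRel K (ι K v1 * ι K ab) (ι K ab)
  | tgt_b : QuatRel K (ι K ab * ι K v2) (ι K ab)
  | src_y : QuatRel K (ι K v2 * ι K ay) (ι K ay)
  | tgt_y : QuatRel K (ι K ay * ι K v1) (ι K ay)
  | src_d : QuatRel K (ι K v2 * ι K ad) (ι K ad)
  | tgt_d : QuatRel K (ι K ad * ι K v3) (ι K ad)
  | src_n : QuatRel K (ι K v3 * ι K an) (ι K an)
  | tgt_n : QuatRel K (ι K an * ι K v2) (ι K an)
  | rel1 : QuatRel K (ι K ab * ι K ay * ι K ab)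
      (ι K ab * ι K ad * ι K an * ι K ay * ι K ab * ι K ad * ι K an)
  | rel2 : QuatRel K (ι K ay * ι K ab * ι K ay)
      (ι K ad * ι K an * ι K ay * ι K ab * ι K ad * ι K an * ι K ay)
  | rel3 : QuatRel K (ι K an * ι K ad * ι K an)
      (ι K an * ι K ay * ι K ab * ι K ad * ι K an * ι K ay * ι K ab)
  | rel4 : QuatRel K (ι K ad * ι K an * ι K ad)
      (ι K ay * ι K ab * ι K ad * ι K an * ι K ay * ι K ab * ι K ad)
  | rel5 : QuatRel K (ι K ab * ι K ay * ι K ab * ι K ad) 0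
  | rel6 : QuatRel K (ι K an * ι K ad * ι K an * ι K ay) 0

/-- The algebra of quaternion type `Q(3A)₂²` over `K`: the path algebra of the quiver
modulo the admissible ideal, presented by generators and relations. -/
abbrev QuatAlg (K : Type u) [CommRing K] : Type u := RingQuot (QuatRel K)

/-- The images of the vertex idempotents and arrows in the algebra `Q(3A)₂²`. -/
noncomputable def qgen (K : Type u) [CommRing K] (x : QGen) : QuatAlg K :=
  RingQuot.mkAlgHom K (QuatRel K) (FreeAlgebra.ι K x)

/-- For elements `g r` of the algebra `A = Q(3A)₂²`, the right `A`-module `gA/rA`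
(realized as the image of the right ideal `gA` in the quotient of `A` by the
right ideal `rA`); right `A`-modules are left modules over `Aᵐᵒᵖ`. -/
noncomputable def cyclicQuot (K : Type u) [Field K] (g r : QuatAlg K) :
    Submodule (QuatAlg K)ᵐᵒᵖ
      ((QuatAlg K) ⧸ Submodule.span (QuatAlg K)ᵐᵒᵖ ({r} : Set (QuatAlg K))) :=
  (Submodule.span (QuatAlg K)ᵐᵒᵖ ({g} : Set (QuatAlg K))).map
    (Submodule.span (QuatAlg K)ᵐᵒᵖ ({r} : Set (QuatAlg K))).mkQ

section PartialResolutions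

variable {R : Type u} [Ring R]

theorem extVanish_succ_iff {X : ModuleCat.{u} R} (P : ProjectiveResolution X) (i : ℕ)
    (Z : ModuleCat.{u} R) :
    ExtVanish R (i + 1) X Z ↔
      ∀ f : P.complex.X (i + 1) ⟶ Z, P.complex.d (i + 2) (i + 1) ≫ f = 0 →
        ∃ g : P.complex.X i ⟶ Z, P.complex.d (i + 1) i ≫ g = f := by
  have e := P.isoExt (R := ℤ) (i + 1) Z
  have h1 : ExtVanish R (i + 1) X Z ↔
      Limits.IsZero ((P.complex.linearYonedaObj ℤ Z).homology (i + 1)) := by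
    rw [← e.isZero_iff, ModuleCat.isZero_iff_subsingleton]; rfl
  rw [h1, ← HomologicalComplex.exactAt_iff_isZero_homology,
    HomologicalComplex.exactAt_iff' _ i (i + 1) (i + 2) (by simp) (by simp),
    ShortComplex.moduleCat_exact_iff]
  rfl

variable (R) in
/-- The beginning `P₃ → P₂ → P₁ → P₀ → X → 0` of a projective resolution of `X`. -/
structure PartialRes (X : Type u) [AddCommGroup X] [Module R X] where
  {P₀ P₁ P₂ P₃ : ModuleCat.{u} R}
  ε : P₀ →ₗ[R] X
  d₀ : P₁ →ₗ[R] P₀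
  d₁ : P₂ →ₗ[R] P₁
  d₂ : P₃ →ₗ[R] P₂
  proj₀ : Module.Projective R P₀
  proj₁ : Module.Projective R P₁
  proj₂ : Module.Projective R P₂
  surj : Function.Surjective ε
  ex₀ : Function.Exact d₀ ε
  ex₁ : Function.Exact d₁ d₀
  ex₂ : Function.Exact d₂ d₁

/-- Exactness of `Hom(P, Z) → Hom(Q, Z) → Hom(S, Z)` for `S → Q → P`. -/
def HomExact {P Q S : Type*} [AddCommGroup P] [Module R P] [AddCommGroup Q] [Module R Q]
    [AddCommGroup S] [Module R S] (d' : S →ₗ[R] Q) (d : Q →ₗ[R] P)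
    (Z : Type*) [AddCommGroup Z] [Module R Z] : Prop :=
  ∀ f : Q →ₗ[R] Z, f ∘ₗ d' = 0 → ∃ g : P →ₗ[R] Z, g ∘ₗ d = f

theorem exists_lift_of_exact {P A B C : Type*} [AddCommGroup P] [Module R P] [AddCommGroup A]
    [Module R A] [AddCommGroup B] [Module R B] [AddCommGroup C] [Module R C]
    [Module.Projective R P] {d' : A →ₗ[R] B} {d : B →ₗ[R] C} (h : Function.Exact d' d)
    (f : P →ₗ[R] B) (hf : d ∘ₗ f = 0) : ∃ g : P →ₗ[R] A, d' ∘ₗ g = f := by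
  have hr : ∀ p, f p ∈ LinearMap.range d' := fun p => (h (f p)).1 (LinearMap.congr_fun hf p)
  obtain ⟨g, hg⟩ := Module.projective_lifting_property d'.rangeRestrict
    (f.codRestrict (LinearMap.range d') hr) d'.surjective_rangeRestrict
  refine ⟨g, LinearMap.ext fun p => ?_⟩
  exact congrArg Subtype.val (LinearMap.congr_fun hg p)

namespace PartialRes

variable {X Y : Type u} [AddCommGroup X] [Module R X] [AddCommGroup Y] [Module R Y]

theorem exists_lift (P : PartialRes R X) (Q : PartialRes R Y) (f : X →ₗ[R] Y) :
    ∃ (φ₀ : P.P₀ →ₗ[R] Q.P₀) (φ₁ : P.P₁ →ₗ[R] Q.P₁) (φ₂ : P.P₂ →ₗ[R] Q.P₂),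
      Q.ε ∘ₗ φ₀ = f ∘ₗ P.ε ∧ Q.d₀ ∘ₗ φ₁ = φ₀ ∘ₗ P.d₀ ∧ Q.d₁ ∘ₗ φ₂ = φ₁ ∘ₗ P.d₁ := by
  have := P.proj₀; have := P.proj₁; have := P.proj₂
  obtain ⟨φ₀, h₀⟩ := Module.projective_lifting_property Q.ε (f ∘ₗ P.ε) Q.surj
  obtain ⟨φ₁, h₁⟩ := exists_lift_of_exact Q.ex₀ (φ₀ ∘ₗ P.d₀) (by
    rw [← LinearMap.comp_assoc, h₀, LinearMap.comp_assoc, P.ex₀.linearMap_comp_eq_zero,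
      LinearMap.comp_zero])
  obtain ⟨φ₂, h₂⟩ := exists_lift_of_exact Q.ex₁ (φ₁ ∘ₗ P.d₁) (by
    rw [← LinearMap.comp_assoc, h₁, LinearMap.comp_assoc, P.ex₁.linearMap_comp_eq_zero,
      LinearMap.comp_zero])
  exact ⟨φ₀, φ₁, φ₂, h₀, h₁, h₂⟩

theorem exists_homotopy (P : PartialRes R X) (α₀ : P.P₀ →ₗ[R] P.P₀) (α₁ : P.P₁ →ₗ[R] P.P₁)
    (α₂ : P.P₂ →ₗ[R] P.P₂) (h₀ : P.ε ∘ₗ α₀ = 0) (h₁ : P.d₀ ∘ₗ α₁ = α₀ ∘ₗ P.d₀)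
    (h₂ : P.d₁ ∘ₗ α₂ = α₁ ∘ₗ P.d₁) :
    ∃ (s₀ : P.P₀ →ₗ[R] P.P₁) (s₁ : P.P₁ →ₗ[R] P.P₂) (s₂ : P.P₂ →ₗ[R] P.P₃),
      P.d₁ ∘ₗ s₁ = α₁ - s₀ ∘ₗ P.d₀ ∧ P.d₂ ∘ₗ s₂ = α₂ - s₁ ∘ₗ P.d₁ := by
  have := P.proj₀; have := P.proj₁; have := P.proj₂
  obtain ⟨s₀, k₀⟩ := exists_lift_of_exact P.ex₀ α₀ h₀
  obtain ⟨s₁, k₁⟩ := exists_lift_of_exact P.ex₁ (α₁ - s₀ ∘ₗ P.d₀) (by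
    rw [LinearMap.comp_sub, h₁, ← LinearMap.comp_assoc, k₀, sub_self])
  obtain ⟨s₂, k₂⟩ := exists_lift_of_exact P.ex₂ (α₂ - s₁ ∘ₗ P.d₁) (by
    rw [LinearMap.comp_sub, h₂, ← LinearMap.comp_assoc, k₁, LinearMap.sub_comp,
      LinearMap.comp_assoc, P.ex₁.linearMap_comp_eq_zero, LinearMap.comp_zero, sub_zero,
      sub_self])
  exact ⟨s₀, s₁, s₂, k₁, k₂⟩

theorem homExact_of_sum_comp_eq_id {κ : Type*} [Fintype κ] (P : PartialRes R X)
    {Y : κ → ModuleCat.{u} R} (Q : ∀ k, PartialRes R (Y k)) (f : ∀ k, X →ₗ[R] Y k)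
    (g : ∀ k, Y k →ₗ[R] X) (hfg : ∑ k, g k ∘ₗ f k = LinearMap.id)
    (Z : Type*) [AddCommGroup Z] [Module R Z] :
    ((∀ k, HomExact (Q k).d₁ (Q k).d₀ Z) → HomExact P.d₁ P.d₀ Z) ∧
    ((∀ k, HomExact (Q k).d₂ (Q k).d₁ Z) → HomExact P.d₂ P.d₁ Z) := by
  choose φ₀ φ₁ φ₂ hφ₀ hφ₁ hφ₂ using fun k => P.exists_lift (Q k) (f k)
  choose ψ₀ ψ₁ ψ₂ hψ₀ hψ₁ hψ₂ using fun k => (Q k).exists_lift P (g k)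
  obtain ⟨s₀, s₁, s₂, hs₁, hs₂⟩ := P.exists_homotopy
    (LinearMap.id - ∑ k, ψ₀ k ∘ₗ φ₀ k) (LinearMap.id - ∑ k, ψ₁ k ∘ₗ φ₁ k)
    (LinearMap.id - ∑ k, ψ₂ k ∘ₗ φ₂ k)
    (by
      ext x
      have h (k) : P.ε (ψ₀ k (φ₀ k x)) = g k (f k (P.ε x)) := by
        rw [← LinearMap.comp_apply, hψ₀, LinearMap.comp_apply, ← LinearMap.comp_apply (Q k).ε,
          hφ₀]; rfl
      have h' := LinearMap.congr_fun hfg (P.ε x)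
      simp only [LinearMap.sum_apply, LinearMap.comp_apply, LinearMap.id_apply] at h'
      simp [h, h'])
    (by
      ext x
      have h (k) : P.d₀ (ψ₁ k (φ₁ k x)) = ψ₀ k (φ₀ k (P.d₀ x)) := by
        rw [← LinearMap.comp_apply, hψ₁, LinearMap.comp_apply, ← LinearMap.comp_apply (Q k).d₀,
          hφ₁]; rfl
      simp [h])
    (by
      ext x
      have h (k) : P.d₁ (ψ₂ k (φ₂ k x)) = ψ₁ k (φ₁ k (P.d₁ x)) := by
        rw [← LinearMap.comp_apply, hψ₂, LinearMap.comp_apply, ← LinearMap.comp_apply (Q k).d₁,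
          hφ₂]; rfl
      simp [h])
  constructor
  · intro H c hc
    have hcc (k) : (c ∘ₗ ψ₁ k) ∘ₗ (Q k).d₁ = 0 := by
      rw [LinearMap.comp_assoc, ← hψ₂, ← LinearMap.comp_assoc, hc, LinearMap.zero_comp]
    choose t ht using fun k => H k _ (hcc k)
    refine ⟨c ∘ₗ s₀ + ∑ k, t k ∘ₗ φ₀ k, ?_⟩
    ext x
    have h (k) : t k (φ₀ k (P.d₀ x)) = c (ψ₁ k (φ₁ k x)) := by
      rw [← LinearMap.comp_apply c, ← ht, LinearMap.comp_apply, ← LinearMap.comp_apply (Q k).d₀,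
        hφ₁]; rfl
    have h' := congrArg c (LinearMap.congr_fun hs₁ x)
    rw [← LinearMap.comp_apply c, ← LinearMap.comp_assoc, hc] at h'
    simp [sub_sub] at h'
    simp [h, sub_eq_zero.1 h'.symm, add_comm]
  · intro H c hc
    have hcc (k) : (c ∘ₗ ψ₂ k) ∘ₗ (Q k).d₂ = 0 := by
      ext x
      obtain ⟨w, hw⟩ := (P.ex₂ (ψ₂ k ((Q k).d₂ x))).1 (by
        rw [← LinearMap.comp_apply P.d₁, hψ₂, LinearMap.comp_apply,
          (Q k).ex₂.apply_apply_eq_zero, map_zero])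
      simp [← hw, ← LinearMap.comp_apply c, hc]
    choose t ht using fun k => H k _ (hcc k)
    refine ⟨c ∘ₗ s₁ + ∑ k, t k ∘ₗ φ₁ k, ?_⟩
    ext x
    have h (k) : t k (φ₁ k (P.d₁ x)) = c (ψ₂ k (φ₂ k x)) := by
      rw [← LinearMap.comp_apply c, ← ht, LinearMap.comp_apply, ← LinearMap.comp_apply (Q k).d₁,
        hφ₂]; rfl
    have h' := congrArg c (LinearMap.congr_fun hs₂ x)
    rw [← LinearMap.comp_apply c, ← LinearMap.comp_assoc, hc] at h'
    simp [sub_sub] at h'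
    simp [h, sub_eq_zero.1 h'.symm, add_comm]

end PartialRes

theorem exists_partialRes (X : ModuleCat.{u} R) :
    ∃ P : PartialRes R X, ∀ Z : ModuleCat.{u} R,
      (ExtVanish R 1 X Z ↔ HomExact P.d₁ P.d₀ Z) ∧ (ExtVanish R 2 X Z ↔ HomExact P.d₂ P.d₁ Z) := by
  let Q := ProjectiveResolution.of X
  have pr (n : ℕ) : Module.Projective R (Q.complex.X n) :=
    (IsProjective.iff_projective _).2 (Q.projective n)
  have ex (n : ℕ) : Function.Exact (Q.complex.d (n + 2) (n + 1)).hom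
      (Q.complex.d (n + 1) n).hom :=
    (ShortComplex.ShortExact.moduleCat_exact_iff_function_exact _).1 (Q.exact_succ n)
  refine ⟨⟨(Q.π.f 0).hom, (Q.complex.d 1 0).hom, (Q.complex.d 2 1).hom, (Q.complex.d 3 2).hom,
    pr 0, pr 1, pr 2, (ModuleCat.epi_iff_surjective _).1 inferInstance, ?_, ex 0, ex 1⟩, ?_⟩
  · exact (ShortComplex.ShortExact.moduleCat_exact_iff_function_exact _).1 Q.exact₀
  · intro Z
    have key (i : ℕ) : ExtVanish R (i + 1) X Z ↔
        HomExact (Q.complex.d (i + 2) (i + 1)).hom (Q.complex.d (i + 1) i).hom Z := by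
      rw [extVanish_succ_iff Q]
      constructor
      · intro h f hf
        obtain ⟨g, hg⟩ := h (ModuleCat.ofHom f) (ModuleCat.hom_ext hf)
        exact ⟨g.hom, congrArg ModuleCat.Hom.hom hg⟩
      · intro h f hf
        obtain ⟨g, hg⟩ := h f.hom (congrArg ModuleCat.Hom.hom hf)
        exact ⟨ModuleCat.ofHom g, ModuleCat.hom_ext hg⟩
    exact ⟨key 0, key 1⟩

theorem PartialRes.extVanish_iff {X : ModuleCat.{u} R} (P : PartialRes R X) (Z : ModuleCat.{u} R) :
    (ExtVanish R 1 X Z ↔ HomExact P.d₁ P.d₀ Z) ∧ (ExtVanish R 2 X Z ↔ HomExact P.d₂ P.d₁ Z) := by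
  obtain ⟨Q, hQ⟩ := exists_partialRes X
  have h (P Q : PartialRes R X) := P.homExact_of_sum_comp_eq_id (κ := Unit) (Y := fun _ => X)
    (fun _ => Q) (fun _ => LinearMap.id) (fun _ => LinearMap.id) (by simp) Z
  rw [(hQ Z).1, (hQ Z).2]
  exact ⟨⟨fun k => (h P Q).1 fun _ => k, fun k => (h Q P).1 fun _ => k⟩,
    ⟨fun k => (h P Q).2 fun _ => k, fun k => (h Q P).2 fun _ => k⟩⟩

/-- `Ext¹(X, Z) = 0` and `Ext²(X, Z) = 0`. -/
def ExtVanish₂ (X Z : ModuleCat.{u} R) : Prop := ExtVanish R 1 X Z ∧ ExtVanish R 2 X Z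

theorem PartialRes.extVanish₂_iff {X : ModuleCat.{u} R} (P : PartialRes R X)
    (Z : ModuleCat.{u} R) :
    ExtVanish₂ X Z ↔ HomExact P.d₁ P.d₀ Z ∧ HomExact P.d₂ P.d₁ Z :=
  and_congr (P.extVanish_iff Z).1 (P.extVanish_iff Z).2

theorem forall_extVanish_iff (X Z : ModuleCat.{u} R) :
    (∀ i, 1 ≤ i → i ≤ 3 - 1 → ExtVanish R i X Z) ↔ ExtVanish₂ X Z := by
  refine ⟨fun h => ⟨h 1 le_rfl (by norm_num), h 2 (by norm_num) le_rfl⟩, fun h i h1 h2 => ?_⟩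
  obtain rfl | rfl : i = 1 ∨ i = 2 := by omega
  exacts [h.1, h.2]

theorem ExtVanish₂.of_sum_comp_eq_id {κ : Type*} [Fintype κ] {X Z : ModuleCat.{u} R}
    {Y : κ → ModuleCat.{u} R} (f : ∀ k, X →ₗ[R] Y k)
    (g : ∀ k, Y k →ₗ[R] X) (hfg : ∑ k, g k ∘ₗ f k = LinearMap.id)
    (h : ∀ k, ExtVanish₂ (Y k) Z) : ExtVanish₂ X Z := by
  obtain ⟨P, -⟩ := exists_partialRes X
  choose Q hQ using fun k => exists_partialRes (Y k)
  have := P.homExact_of_sum_comp_eq_id Q f g hfg Z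
  rw [P.extVanish₂_iff]
  exact ⟨this.1 fun k => ((Q k).extVanish₂_iff Z).1 (h k) |>.1,
    this.2 fun k => ((Q k).extVanish₂_iff Z).1 (h k) |>.2⟩

theorem HomExact.of_sum_comp_eq_id {κ : Type*} [Fintype κ]
    {P Q S : Type*} [AddCommGroup P] [Module R P] [AddCommGroup Q] [Module R Q]
    [AddCommGroup S] [Module R S] {d' : S →ₗ[R] Q} {d : Q →ₗ[R] P}
    {Z : Type*} [AddCommGroup Z] [Module R Z] {Y : κ → Type*} [∀ k, AddCommGroup (Y k)]
    [∀ k, Module R (Y k)] (f : ∀ k, Z →ₗ[R] Y k)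
    (g : ∀ k, Y k →ₗ[R] Z) (hfg : ∑ k, g k ∘ₗ f k = LinearMap.id)
    (h : ∀ k, HomExact d' d (Y k)) : HomExact d' d Z := by
  intro c hc
  choose t ht using fun k => h k (f k ∘ₗ c) (by rw [LinearMap.comp_assoc, hc, LinearMap.comp_zero])
  refine ⟨∑ k, g k ∘ₗ t k, ?_⟩
  ext x
  have := LinearMap.congr_fun hfg (c x)
  have h' (k) : t k (d x) = f k (c x) := LinearMap.congr_fun (ht k) x
  simpa [h'] using this

theorem ExtVanish₂.of_sum_comp_eq_id_right {κ : Type*} [Fintype κ] {X Z : ModuleCat.{u} R}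
    {Y : κ → ModuleCat.{u} R} (f : ∀ k, Z →ₗ[R] Y k)
    (g : ∀ k, Y k →ₗ[R] Z) (hfg : ∑ k, g k ∘ₗ f k = LinearMap.id)
    (h : ∀ k, ExtVanish₂ X (Y k)) : ExtVanish₂ X Z := by
  obtain ⟨P, -⟩ := exists_partialRes X
  simp only [P.extVanish₂_iff] at h ⊢
  exact ⟨HomExact.of_sum_comp_eq_id f g hfg fun k => (h k).1,
    HomExact.of_sum_comp_eq_id f g hfg fun k => (h k).2⟩

end PartialResolutions

section IdempotentModules

open MulOpposite

variable {A : Type u} [Ring A] {I J L : Type} [Fintype I] [Fintype J] [Fintype L]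

/-- The right module `⨁ eᵢA`, as a submodule of `Aᴵ`. -/
def idemModule (e : I → A) : Submodule Aᵐᵒᵖ (I → A) where
  carrier := {v | ∀ i, e i * v i = v i}
  add_mem' ha hb i := by simp [mul_add, ha i, hb i]
  zero_mem' i := by simp
  smul_mem' c v hv i := by simp [← mul_assoc, hv i]

/-- The matrix `r` has entries `rᵢⱼ ∈ eᵢAe'ⱼ`. -/
def IsPeirce (e : I → A) (e' : J → A) (r : I → J → A) : Prop :=
  ∀ i j, e i * r i j = r i j ∧ r i j * e' j = r i j

/-- Left multiplication by a matrix, as a map of right modules `⨁ e'ⱼA → ⨁ eᵢA`. -/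
def idemMap {e : I → A} {e' : J → A} {r : I → J → A} (hr : IsPeirce e e' r) :
    idemModule e' →ₗ[Aᵐᵒᵖ] idemModule e where
  toFun v := ⟨fun i => ∑ j, r i j * v.1 j, fun i => by
    simp [Finset.mul_sum, ← mul_assoc, (hr i _).1]⟩
  map_add' v w := by ext i; simp [mul_add, Finset.sum_add_distrib]
  map_smul' c v := by ext i; simp [Finset.sum_mul, mul_assoc]

@[simp] theorem idemMap_apply {e : I → A} {e' : J → A} {r : I → J → A} (hr : IsPeirce e e' r)
    (v : idemModule e') (i : I) : (idemMap hr v).1 i = ∑ j, r i j * v.1 j := rfl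

/-- Exactness of the sequence of matrices `r'`, `r` acting by left multiplication. -/
structure MatExact (e : J → A) (r : I → J → A) (r' : J → L → A) : Prop where
  mul_eq_zero : ∀ i l, ∑ j, r i j * r' j l = 0
  exists_eq : ∀ v : J → A, (∀ j, e j * v j = v j) → (∀ i, ∑ j, r i j * v j = 0) →
    ∃ w : L → A, ∀ j, v j = ∑ l, r' j l * w l

theorem MatExact.exact {e₁ : I → A} {e : J → A} {e₂ : L → A} {r : I → J → A} {r' : J → L → A}
    (h : MatExact e r r') (he₂ : ∀ l, e₂ l * e₂ l = e₂ l) (hr : IsPeirce e₁ e r)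
    (hr' : IsPeirce e e₂ r') :
    Function.Exact (idemMap hr') (idemMap hr) := by
  intro v
  constructor
  · intro hv
    obtain ⟨w, hw⟩ := h.exists_eq v.1 v.2 fun i => congrArg (fun z => z.1 i) hv
    refine ⟨⟨fun l => e₂ l * w l, fun l => by simp [← mul_assoc, he₂]⟩, ?_⟩
    ext j
    simp [hw j, ← mul_assoc, (hr' j _).2]
  · rintro ⟨w, rfl⟩
    ext i
    simp only [idemMap_apply, Finset.mul_sum, ← mul_assoc, ZeroMemClass.coe_zero, Pi.zero_apply]
    rw [Finset.sum_comm]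
    simp [← Finset.sum_mul, h.mul_eq_zero]

/-- Right multiplication by a row of matrices `X^I → X^J → X^L` is exact at the summand
`⨁ Xeⱼ`. -/
def RowExact (e : J → A) (r : I → J → A) (r' : J → L → A) (X : Type*) [AddCommGroup X]
    [Module Aᵐᵒᵖ X] : Prop :=
  ∀ x : J → X, (∀ j, op (e j) • x j = x j) → (∀ l, ∑ j, op (r' j l) • x j = 0) →
    ∃ z : I → X, ∀ j, x j = ∑ i, op (r i j) • z i

variable {X : Type*} [AddCommGroup X] [Module Aᵐᵒᵖ X]

theorem RowExact.of_retract {e : J → A} {r : I → J → A} {r' : J → L → A} {Y : Type*}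
    [AddCommGroup Y] [Module Aᵐᵒᵖ Y] (h : RowExact e r r' X) (f : Y →ₗ[Aᵐᵒᵖ] X)
    (g : X →ₗ[Aᵐᵒᵖ] Y) (hgf : g ∘ₗ f = LinearMap.id) : RowExact e r r' Y := by
  intro y hy hy'
  have hg (y) : g (f y) = y := LinearMap.congr_fun hgf y
  obtain ⟨z, hz⟩ := h (fun j => f (y j)) (fun j => by rw [← map_smul, hy])
    (fun l => by simp only [← map_smul, ← map_sum, hy', map_zero])
  refine ⟨fun i => g (z i), fun j => ?_⟩
  simp only [← map_smul, ← map_sum, ← hz, hg]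

/-- The map `⨁ eⱼA → X` given by elements `xⱼ`. -/
def idemLift (e : J → A) (x : J → X) : idemModule e →ₗ[Aᵐᵒᵖ] X where
  toFun v := ∑ j, op (v.1 j) • x j
  map_add' v w := by simp [add_smul, Finset.sum_add_distrib]
  map_smul' c v := by simp [Finset.smul_sum, mul_smul]

theorem idemLift_apply (e : J → A) (x : J → X) (v : idemModule e) :
    idemLift e x v = ∑ j, op (v.1 j) • x j := rfl

/-- The generator `eⱼ` of the summand `eⱼA`. -/
def idemGen [DecidableEq J] {e : J → A} (he : ∀ j, e j * e j = e j) (j : J) : idemModule e :=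
  ⟨Pi.single j (e j), fun i => by
    by_cases h : i = j
    · subst h; simp [he]
    · simp [h]⟩

theorem op_smul_idemGen [DecidableEq J] {e : J → A} (he : ∀ j, e j * e j = e j) (j : J) :
    op (e j) • idemGen he j = idemGen he j := by
  ext i
  by_cases h : i = j
  · subst h; simp [idemGen, he]
  · simp [idemGen, h]

theorem sum_op_smul_idemGen [DecidableEq J] {e : J → A} (he : ∀ j, e j * e j = e j)
    (v : idemModule e) : ∑ j, op (v.1 j) • idemGen he j = v := by
  ext i
  simp [idemGen, Pi.single_apply, v.2 i]

theorem idemModule_hom_ext [DecidableEq J] {e : J → A} (he : ∀ j, e j * e j = e j)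
    {f g : idemModule e →ₗ[Aᵐᵒᵖ] X} (h : ∀ j, f (idemGen he j) = g (idemGen he j)) : f = g := by
  ext1 v
  rw [← sum_op_smul_idemGen he v]
  simp [h]

theorem idemLift_idemGen [DecidableEq J] {e : J → A} (he : ∀ j, e j * e j = e j) (x : J → X)
    (j : J) : idemLift e x (idemGen he j) = op (e j) • x j := by
  rw [idemLift_apply, Finset.sum_eq_single j]
  · simp [idemGen]
  · intro i _ h; simp [idemGen, h]
  · simp

theorem idemMap_idemGen [DecidableEq J] [DecidableEq I] {e : I → A} {e' : J → A} {r : I → J → A}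
    (hr : IsPeirce e e' r) (he : ∀ j, e j * e j = e j) (he' : ∀ j, e' j * e' j = e' j) (j : J) :
    idemMap hr (idemGen he' j) = ∑ i, op (r i j) • idemGen he i := by
  ext i
  simp [idemGen, Pi.single_apply, (hr i j).1, (hr i j).2]

theorem homExact_iff_rowExact {e₁ : I → A} {e : J → A} {e₂ : L → A} {r : I → J → A}
    {r' : J → L → A} (he₁ : ∀ i, e₁ i * e₁ i = e₁ i) (he : ∀ j, e j * e j = e j)
    (he₂ : ∀ l, e₂ l * e₂ l = e₂ l)
    (hr : IsPeirce e₁ e r) (hr' : IsPeirce e e₂ r') :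
    HomExact (idemMap hr') (idemMap hr) X ↔ RowExact e r r' X := by
  classical
  constructor
  · intro h x hx hx'
    obtain ⟨g, hg⟩ := h (idemLift e x) (idemModule_hom_ext he₂ fun l => by
      rw [LinearMap.comp_apply, idemMap_idemGen hr' he, map_sum]
      simp [idemLift_idemGen, hx, hx'])
    refine ⟨fun i => g (idemGen he₁ i), fun j => ?_⟩
    have := LinearMap.congr_fun hg (idemGen he j)
    rw [LinearMap.comp_apply, idemMap_idemGen hr he₁, idemLift_idemGen, hx, map_sum] at this
    simp [← this]
  · intro h f hf
    obtain ⟨z, hz⟩ := h (fun j => f (idemGen he j))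
      (fun j => by rw [← map_smul, op_smul_idemGen])
      (fun l => by
        have := LinearMap.congr_fun hf (idemGen he₂ l)
        rw [LinearMap.comp_apply, idemMap_idemGen hr' he, map_sum] at this
        simpa using this)
    refine ⟨idemLift e₁ z, idemModule_hom_ext he fun j => ?_⟩
    rw [LinearMap.comp_apply, idemMap_idemGen hr he₁, map_sum, hz]
    simp [idemLift_idemGen, smul_smul, ← op_mul, (hr _ j).1]

instance projective_op_self : Module.Projective Aᵐᵒᵖ A :=
  let f : Aᵐᵒᵖ ≃ₗ[Aᵐᵒᵖ] A :=
    { (opAddEquiv (α := A)).symm with map_smul' := fun _ _ => rfl }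
  .of_equiv' f

/-- The projection of `Aᴵ` onto its direct summand `⨁ eᵢA`. -/
def idemProj {e : I → A} (he : ∀ i, e i * e i = e i) : (I → A) →ₗ[Aᵐᵒᵖ] idemModule e where
  toFun v := ⟨fun i => e i * v i, fun i => by rw [← mul_assoc, he]⟩
  map_add' v w := by ext i; simp [mul_add]
  map_smul' c v := by ext i; simp [mul_assoc]

theorem idemProj_comp_subtype {e : I → A} (he : ∀ i, e i * e i = e i) :
    idemProj he ∘ₗ (idemModule e).subtype = LinearMap.id := by
  ext v i
  exact v.2 i

theorem projective_idemModule {e : I → A} (he : ∀ i, e i * e i = e i) :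
    Module.Projective Aᵐᵒᵖ (idemModule e) := by
  classical
  have : Module.Projective Aᵐᵒᵖ (I → A) :=
    Module.Projective.of_equiv' (DFinsupp.linearEquivFunOnFintype (R := Aᵐᵒᵖ) (M := fun _ : I => A))
  exact .of_split _ _ (idemProj_comp_subtype he)

end IdempotentModules

section LiftOfExtVanish

variable {R : Type u} [Ring R]

theorem exists_factor_of_exact {P Q X Z : Type*} [AddCommGroup P] [Module R P] [AddCommGroup Q]
    [Module R Q] [AddCommGroup X] [Module R X] [AddCommGroup Z] [Module R Z]
    {d : P →ₗ[R] Q} {ε : Q →ₗ[R] X} (h : Function.Exact d ε) (hε : Function.Surjective ε)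
    (f : Q →ₗ[R] Z) (hf : f ∘ₗ d = 0) : ∃ k : X →ₗ[R] Z, k ∘ₗ ε = f := by
  have hk : LinearMap.ker ε ≤ LinearMap.ker f := by
    intro q hq
    obtain ⟨p, rfl⟩ := (h q).1 hq
    exact LinearMap.congr_fun hf p
  refine ⟨(LinearMap.ker ε).liftQ f hk ∘ₗ (ε.quotKerEquivOfSurjective hε).symm, ?_⟩
  ext q
  have : (ε.quotKerEquivOfSurjective hε).symm (ε q) = (LinearMap.ker ε).mkQ q := by
    rw [LinearEquiv.symm_apply_eq]; rfl
  simp [this]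

variable {X N : Type u} [AddCommGroup X] [Module R X] [AddCommGroup N] [Module R N]

theorem PartialRes.exists_lift_of_homExact (Q : PartialRes R X) (P : PartialRes R N)
    (ι : N →ₗ[R] P.P₃) (hι : Function.Injective ι) (hex : Function.Exact ι P.d₂)
    (hinj : HomExact Q.d₁ Q.d₀ P.P₃) (h₁ : HomExact Q.d₁ Q.d₀ N) (h₂ : HomExact Q.d₂ Q.d₁ N) :
    (∀ h : X →ₗ[R] P.P₂, P.d₁ ∘ₗ h = 0 → ∃ k : X →ₗ[R] P.P₃, P.d₂ ∘ₗ k = h) ∧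
    (∀ h : X →ₗ[R] P.P₁, P.d₀ ∘ₗ h = 0 → ∃ k : X →ₗ[R] P.P₂, P.d₁ ∘ₗ k = h) := by
  have := Q.proj₀; have := Q.proj₁; have := Q.proj₂
  have hεd : Q.ε ∘ₗ Q.d₀ = 0 := Q.ex₀.linearMap_comp_eq_zero
  have hι0 : P.d₂ ∘ₗ ι = 0 := hex.linearMap_comp_eq_zero
  have cancel {Z : Type u} [AddCommGroup Z] [Module R Z] {a b : X →ₗ[R] Z}
      (h : a ∘ₗ Q.ε = b ∘ₗ Q.ε) : a = b := (LinearMap.cancel_right Q.surj).1 h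
  constructor
  · intro h hh
    obtain ⟨u, hu⟩ := exists_lift_of_exact P.ex₂ (h ∘ₗ Q.ε) (by
      rw [← LinearMap.comp_assoc, hh, LinearMap.zero_comp])
    obtain ⟨c, hc⟩ := exists_lift_of_exact hex (u ∘ₗ Q.d₀) (by
      rw [← LinearMap.comp_assoc, hu, LinearMap.comp_assoc, hεd, LinearMap.comp_zero])
    obtain ⟨c', hc'⟩ := h₁ c (by
      rw [← LinearMap.cancel_left hι, ← LinearMap.comp_assoc, hc, LinearMap.comp_assoc,
        Q.ex₁.linearMap_comp_eq_zero, LinearMap.comp_zero, LinearMap.comp_zero])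
    obtain ⟨k, hk⟩ := exists_factor_of_exact Q.ex₀ Q.surj (u - ι ∘ₗ c') (by
      rw [LinearMap.sub_comp, LinearMap.comp_assoc, hc', hc, sub_self])
    refine ⟨k, cancel ?_⟩
    rw [LinearMap.comp_assoc, hk, LinearMap.comp_sub, hu, ← LinearMap.comp_assoc, hι0,
      LinearMap.zero_comp, sub_zero]
  · intro h hh
    obtain ⟨u, hu⟩ := exists_lift_of_exact P.ex₁ (h ∘ₗ Q.ε) (by
      rw [← LinearMap.comp_assoc, hh, LinearMap.zero_comp])
    obtain ⟨u', hu'⟩ := exists_lift_of_exact P.ex₂ (u ∘ₗ Q.d₀) (by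
      rw [← LinearMap.comp_assoc, hu, LinearMap.comp_assoc, hεd, LinearMap.comp_zero])
    obtain ⟨c, hc⟩ := exists_lift_of_exact hex (u' ∘ₗ Q.d₁) (by
      rw [← LinearMap.comp_assoc, hu', LinearMap.comp_assoc, Q.ex₁.linearMap_comp_eq_zero,
        LinearMap.comp_zero])
    obtain ⟨c', hc'⟩ := h₂ c (by
      rw [← LinearMap.cancel_left hι, ← LinearMap.comp_assoc, hc, LinearMap.comp_assoc,
        Q.ex₂.linearMap_comp_eq_zero, LinearMap.comp_zero, LinearMap.comp_zero])
    obtain ⟨v, hv⟩ := hinj (u' - ι ∘ₗ c') (by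
      rw [LinearMap.sub_comp, LinearMap.comp_assoc, hc', hc, sub_self])
    obtain ⟨k, hk⟩ := exists_factor_of_exact Q.ex₀ Q.surj (u - P.d₂ ∘ₗ v) (by
      rw [LinearMap.sub_comp, LinearMap.comp_assoc, hv, LinearMap.comp_sub, hu',
        ← LinearMap.comp_assoc, hι0, LinearMap.zero_comp, sub_zero, sub_self])
    refine ⟨k, cancel ?_⟩
    rw [LinearMap.comp_assoc, hk, LinearMap.comp_sub, hu, ← LinearMap.comp_assoc,
      P.ex₂.linearMap_comp_eq_zero, LinearMap.zero_comp, sub_zero]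

end LiftOfExtVanish

section SymmetrizingForm

open MulOpposite

variable {K : Type u} [Field K] {A : Type u} [Ring A] [Algebra K A]

/-- `lam` is a symmetrizing form on the algebra `A`. -/
structure IsSymmetrizing (lam : A →ₗ[K] K) : Prop where
  symm : ∀ a b, lam (a * b) = lam (b * a)
  nondeg : ∀ a, (∀ b, lam (a * b) = 0) → a = 0

namespace IsSymmetrizing

variable {lam : A →ₗ[K] K} (hl : IsSymmetrizing lam)
include hl

theorem eq_of_forall {a b : A} (h : ∀ c, lam (a * c) = lam (b * c)) : a = b :=
  sub_eq_zero.1 (hl.nondeg _ fun c => by rw [sub_mul, map_sub, h, sub_self])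

variable [Module.Finite K A]

theorem exists_hom {X : Type*} [AddCommGroup X] [Module Aᵐᵒᵖ X] [Module K X]
    [IsScalarTower K Aᵐᵒᵖ X] (φ : X →ₗ[K] K) :
    ∃ h : X →ₗ[Aᵐᵒᵖ] A, ∀ x a, lam (h x * a) = φ (op a • x) := by
  let B : A →ₗ[K] Module.Dual K A := (LinearMap.mul K A).compr₂ lam
  have hB (a b : A) : B a b = lam (a * b) := rfl
  have hinj : Function.Injective B := fun a b hab =>
    hl.eq_of_forall fun c => LinearMap.congr_fun hab c
  have hsurj : Function.Surjective B :=
    (LinearMap.injective_iff_surjective_of_finrank_eq_finrank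
      (Subspace.dual_finrank_eq (K := K) (V := A)).symm).1 hinj
  have hex (x : X) : ∃ c, ∀ a, lam (c * a) = φ (op a • x) := by
    obtain ⟨c, hc⟩ := hsurj
      { toFun := fun a => φ (op a • x)
        map_add' := fun a b => by simp [add_smul]
        map_smul' := fun k a => by simp }
    exact ⟨c, fun a => LinearMap.congr_fun hc a⟩
  choose h hh using hex
  refine ⟨⟨⟨h, fun x y => hl.eq_of_forall fun c => ?_⟩, fun a x => hl.eq_of_forall fun c => ?_⟩, hh⟩
  · simp [add_mul, hh]
  · change lam (h (a • x) * c) = lam (h x * a.unop * c)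
    rw [mul_assoc, hh, hh, op_mul, mul_smul, op_unop]

theorem homExact_self {P Q S : Type*} [AddCommGroup P] [Module Aᵐᵒᵖ P] [AddCommGroup Q]
    [Module Aᵐᵒᵖ Q] [AddCommGroup S] [Module Aᵐᵒᵖ S] {d' : S →ₗ[Aᵐᵒᵖ] Q} {d : Q →ₗ[Aᵐᵒᵖ] P}
    (hd : Function.Exact d' d) : HomExact d' d A := by
  intro f hf
  let _ := Module.compHom P (algebraMap K Aᵐᵒᵖ)
  let _ := Module.compHom Q (algebraMap K Aᵐᵒᵖ)
  have tP : IsScalarTower K Aᵐᵒᵖ P := ⟨fun k a x => by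
    rw [Algebra.smul_def, mul_smul]; rfl⟩
  have tQ : IsScalarTower K Aᵐᵒᵖ Q := ⟨fun k a x => by
    rw [Algebra.smul_def, mul_smul]; rfl⟩
  have : lam ∘ₗ f.restrictScalars K ∈ LinearMap.range (d.restrictScalars K).dualMap := by
    rw [LinearMap.range_dualMap_eq_dualAnnihilator_ker, Submodule.mem_dualAnnihilator]
    intro q hq
    obtain ⟨s, rfl⟩ := (hd q).1 hq
    have : f (d' s) = 0 := LinearMap.congr_fun hf s
    simp [this]
  obtain ⟨ψ, hψ⟩ := this
  obtain ⟨h, hh⟩ := hl.exists_hom ψ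
  refine ⟨h, LinearMap.ext fun q => hl.eq_of_forall fun c => ?_⟩
  have := LinearMap.congr_fun hψ (op c • q)
  simp only [LinearMap.dualMap_apply, LinearMap.coe_restrictScalars, LinearMap.comp_apply,
    map_smul] at this
  rw [LinearMap.comp_apply, hh, this]
  rfl

variable {I J L : Type} [Fintype I] [Fintype J] [Fintype L]

theorem homExact_idemModule {e : I → A} (he : ∀ i, e i * e i = e i)
    {P Q S : Type*} [AddCommGroup P] [Module Aᵐᵒᵖ P] [AddCommGroup Q]
    [Module Aᵐᵒᵖ Q] [AddCommGroup S] [Module Aᵐᵒᵖ S] {d' : S →ₗ[Aᵐᵒᵖ] Q} {d : Q →ₗ[Aᵐᵒᵖ] P}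
    (hd : Function.Exact d' d) : HomExact d' d (idemModule e) := by
  classical
  refine HomExact.of_sum_comp_eq_id (Y := fun _ : I => A)
    (fun i => LinearMap.proj i ∘ₗ (idemModule e).subtype)
    (fun i => idemProj he ∘ₗ LinearMap.single Aᵐᵒᵖ (fun _ : I => A) i) ?_
    fun i => hl.homExact_self hd
  ext v i
  have : ∑ j, Pi.single (M := fun _ : I => A) j (v.1 j) = v.1 := Finset.univ_sum_single v.1
  have h2 := congrArg Subtype.val (congrArg (idemProj he) this)
  simp only [map_sum] at h2
  simpa [idemProj, v.2 i] using congrFun h2 i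

variable {e : J → A} {X : Type*} [AddCommGroup X] [Module Aᵐᵒᵖ X] [Module K X]
    [IsScalarTower K Aᵐᵒᵖ X]

theorem exists_functional {r : I → J → A}
    (x : J → X) (hx : ¬ ∃ z : I → X, ∀ j, x j = ∑ i, op (r i j) • z i) :
    ∃ φ : J → X →ₗ[K] K, (∀ i z, ∑ j, φ j (op (r i j) • z) = 0) ∧ ∑ j, φ j (x j) ≠ 0 := by
  classical
  have tow (k : K) (a : Aᵐᵒᵖ) (y : X) : a • k • y = k • a • y := by
    rw [← algebraMap_smul Aᵐᵒᵖ k y, ← algebraMap_smul Aᵐᵒᵖ k (a • y), smul_smul, smul_smul,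
      Algebra.commutes]
  let T : (I → X) →ₗ[K] (J → X) :=
    { toFun := fun z j => ∑ i, op (r i j) • z i
      map_add' := fun z w => by ext j; simp [Finset.sum_add_distrib]
      map_smul' := fun k z => by ext j; simp [Finset.smul_sum, tow] }
  have hxT : x ∉ LinearMap.range T := fun ⟨z, hz⟩ => hx ⟨z, fun j => (congrFun hz j).symm⟩
  obtain ⟨Φ, hΦx, hΦ⟩ := Submodule.exists_le_ker_of_notMem hxT
  refine ⟨fun j => Φ ∘ₗ LinearMap.single K (fun _ : J => X) j, fun i z => ?_, ?_⟩
  · have h1 := hΦ (LinearMap.mem_range_self T (Pi.single i z))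
    have h2 : T (Pi.single i z) = ∑ j, Pi.single j (op (r i j) • z) := by
      rw [Finset.univ_sum_single]
      ext j
      change ∑ i', op (r i' j) • (Pi.single i z : I → X) i' = _
      rw [Finset.sum_eq_single i] <;> simp +contextual
    rw [h2, LinearMap.mem_ker, map_sum] at h1
    simpa using h1
  · have h2 : ∑ j, Pi.single j (x j) = x := Finset.univ_sum_single x
    rw [← h2, map_sum] at hΦx
    simpa using hΦx

/-- The map `X → ⨁ eⱼA` attached to functionals on `X` that annihilate the image of `r`. -/
theorem exists_hom_idemModule {e₁ : I → A} {r : I → J → A} (he : ∀ j, e j * e j = e j)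
    (hr : IsPeirce e₁ e r) (φ : J → X →ₗ[K] K) (hφ : ∀ i z, ∑ j, φ j (op (r i j) • z) = 0) :
    ∃ h : X →ₗ[Aᵐᵒᵖ] idemModule e, idemMap hr ∘ₗ h = 0 ∧
      ∀ j x a, lam ((h x).1 j * a) = φ j (op (a * e j) • x) := by
  choose h hh using fun j => hl.exists_hom (φ j)
  have key (j x a) : lam ((e j * h j x) * a) = φ j (op (a * e j) • x) := by
    rw [mul_assoc, hl.symm, mul_assoc, hh]
  refine ⟨idemProj he ∘ₗ LinearMap.pi h, LinearMap.ext fun x => ?_, key⟩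
  ext i
  refine hl.nondeg _ fun a => ?_
  have this (j) : lam ((r i j * (e j * h j x)) * a) = φ j (op (r i j) • op a • x) := by
    rw [mul_assoc, hl.symm, mul_assoc, key, mul_assoc, (hr i j).2, op_mul, mul_smul]
  change lam ((∑ j, r i j * (e j * h j x)) * a) = 0
  rw [Finset.sum_mul, map_sum, Finset.sum_congr rfl fun j _ => this j, hφ]

theorem rowExact_of_forall_exists_lift {e₁ : I → A} {e₂ : L → A} {r : I → J → A} {r' : J → L → A}
    (he : ∀ j, e j * e j = e j) (hr : IsPeirce e₁ e r) (hr' : IsPeirce e e₂ r')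
    (H : ∀ h : X →ₗ[Aᵐᵒᵖ] idemModule e, idemMap hr ∘ₗ h = 0 →
      ∃ k : X →ₗ[Aᵐᵒᵖ] idemModule e₂, idemMap hr' ∘ₗ k = h) : RowExact e r r' X := by
  intro x hx hx'
  by_contra hcon
  obtain ⟨φ, hφ, hφx⟩ := hl.exists_functional x hcon
  obtain ⟨h, hh, hφh⟩ := hl.exists_hom_idemModule he hr φ hφ
  obtain ⟨k, rfl⟩ := H h hh
  apply hφx
  have this (j) : φ j (x j) = ∑ l, lam ((k (op (r' j l) • x j)).1 l) := by
    have := hφh j (x j) 1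
    rw [mul_one, one_mul, hx, LinearMap.comp_apply, idemMap_apply, map_sum] at this
    rw [← this]
    refine Finset.sum_congr rfl fun l _ => ?_
    rw [hl.symm, map_smul]
    rfl
  rw [Finset.sum_congr rfl fun j _ => this j, Finset.sum_comm]
  refine Finset.sum_eq_zero fun l _ => ?_
  have h0 := congrArg (fun v => lam (v.1 l)) (congrArg k (hx' l))
  simp only [map_sum, map_zero] at h0
  simpa using h0

end IsSymmetrizing

end SymmetrizingForm

section CyclicResolutions

open MulOpposite

/-- An exact sequence `P₃ → P₂ → P₁ → P₀ → P₃` of right modules of the form `⨁ eᵢA`, with `P₀`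
and `P₁` of rank one; it presents the cokernel of `P₁ → P₀`, which is also the image of
`P₀ → P₃`. -/
structure CyclicRes (A : Type u) [Ring A] where
  {m p : ℕ}
  e₀ : Fin 1 → A
  e₁ : Fin 1 → A
  e₂ : Fin m → A
  e₃ : Fin p → A
  D₀ : Fin 1 → Fin 1 → A
  D₁ : Fin 1 → Fin m → A
  D₂ : Fin m → Fin p → A
  G : Fin p → Fin 1 → A
  idem₀ : ∀ i, e₀ i * e₀ i = e₀ i
  idem₁ : ∀ i, e₁ i * e₁ i = e₁ i
  idem₂ : ∀ i, e₂ i * e₂ i = e₂ i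
  idem₃ : ∀ i, e₃ i * e₃ i = e₃ i
  peirce₀ : IsPeirce e₀ e₁ D₀
  peirce₁ : IsPeirce e₁ e₂ D₁
  peirce₂ : IsPeirce e₂ e₃ D₂
  peirceG : IsPeirce e₃ e₀ G
  ex₀ : MatExact e₀ G D₀
  ex₁ : MatExact e₁ D₀ D₁
  ex₂ : MatExact e₂ D₁ D₂
  ex₃ : MatExact e₃ D₂ G

namespace CyclicRes

variable {A : Type u} [Ring A] (S : CyclicRes A)

/-- The module presented by a `CyclicRes`. -/
abbrev Coker : Type u := idemModule S.e₀ ⧸ LinearMap.range (idemMap S.peirce₀)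

/-- The projective resolution of the module presented by a `CyclicRes`. -/
def partialRes : PartialRes Aᵐᵒᵖ S.Coker where
  P₀ := ModuleCat.of _ (idemModule S.e₀)
  P₁ := ModuleCat.of _ (idemModule S.e₁)
  P₂ := ModuleCat.of _ (idemModule S.e₂)
  P₃ := ModuleCat.of _ (idemModule S.e₃)
  ε := Submodule.mkQ _
  d₀ := idemMap S.peirce₀
  d₁ := idemMap S.peirce₁
  d₂ := idemMap S.peirce₂
  proj₀ := projective_idemModule S.idem₀
  proj₁ := projective_idemModule S.idem₁
  proj₂ := projective_idemModule S.idem₂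
  surj := Submodule.mkQ_surjective _
  ex₀ := LinearMap.exact_map_mkQ_range _
  ex₁ := S.ex₁.exact S.idem₂ S.peirce₀ S.peirce₁
  ex₂ := S.ex₂.exact S.idem₃ S.peirce₁ S.peirce₂

/-- The embedding of the presented module in `P₃`. -/
def cokerEmb : S.Coker →ₗ[Aᵐᵒᵖ] idemModule S.e₃ :=
  Submodule.liftQ _ (idemMap S.peirceG) (by
    rw [← (S.ex₀.exact S.idem₁ S.peirceG S.peirce₀).linearMap_ker_eq])

theorem cokerEmb_injective : Function.Injective S.cokerEmb := by
  rw [← LinearMap.ker_eq_bot, cokerEmb, Submodule.ker_liftQ_eq_bot]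
  rw [← (S.ex₀.exact S.idem₁ S.peirceG S.peirce₀).linearMap_ker_eq]

theorem cokerEmb_mk (v : idemModule S.e₀) :
    S.cokerEmb (Submodule.Quotient.mk v) = idemMap S.peirceG v := rfl

theorem exact_cokerEmb : Function.Exact S.cokerEmb (idemMap S.peirce₂) := by
  intro v
  rw [S.ex₃.exact S.idem₀ S.peirce₂ S.peirceG v]
  constructor
  · rintro ⟨w, rfl⟩; exact ⟨Submodule.Quotient.mk w, rfl⟩
  · rintro ⟨w, rfl⟩
    obtain ⟨w, rfl⟩ := Submodule.Quotient.mk_surjective _ w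
    exact ⟨w, rfl⟩

/-- The conditions on `X` that express the vanishing of `Ext¹` and `Ext²` from the module
presented by `S`, and (for symmetric algebras) of those into this module. -/
def Acyclic (X : Type*) [AddCommGroup X] [Module Aᵐᵒᵖ X] : Prop :=
  RowExact S.e₁ S.D₀ S.D₁ X ∧ RowExact S.e₂ S.D₁ S.D₂ X

theorem extVanish₂_iff (X : ModuleCat.{u} Aᵐᵒᵖ) :
    ExtVanish₂ (ModuleCat.of Aᵐᵒᵖ S.Coker) X ↔ S.Acyclic X := by
  rw [PartialRes.extVanish₂_iff (X := ModuleCat.of Aᵐᵒᵖ S.Coker) S.partialRes]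
  exact and_congr
    (homExact_iff_rowExact S.idem₀ S.idem₁ S.idem₂ S.peirce₀ S.peirce₁)
    (homExact_iff_rowExact S.idem₁ S.idem₂ S.idem₃ S.peirce₁ S.peirce₂)

/-- Exactness at `P₀, P₁` read off in the submodule `G · e₀A` of `P₃`. -/
theorem rowExact_coker {I J L : Type} [Fintype I] [Fintype J] [Fintype L] {e : J → A}
    {e' : L → A} {r : I → J → A} {r' : J → L → A} (he : ∀ j, e j * e j = e j)
    (hr' : IsPeirce e e' r')
    (H : ∀ a : J → A, (∀ j, S.e₀ 0 * a j = a j) → (∀ j, a j * e j = a j) →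
      (∀ t l, S.G t 0 * ∑ j, a j * r' j l = 0) →
      ∃ c : I → A, ∀ t j, S.G t 0 * a j = S.G t 0 * ∑ i, c i * r i j) :
    RowExact e r r' S.Coker := by
  intro x hx hx'
  choose v hv using fun j => Submodule.Quotient.mk_surjective _ (x j)
  have hGe (t) : S.G t 0 * S.e₀ 0 = S.G t 0 := (S.peirceG t 0).2
  have hval (j) (t) (b : A) :
      (S.cokerEmb (op b • x j)).1 t = S.G t 0 * ((v j).1 0 * b) := by
    rw [← hv, map_smul, cokerEmb_mk]
    simp [mul_assoc]
  have hval' (j) (t) : (S.cokerEmb (x j)).1 t = S.G t 0 * (v j).1 0 := by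
    rw [← hv, cokerEmb_mk]
    simp
  have hve (j t) : S.G t 0 * ((v j).1 0 * e j) = S.G t 0 * (v j).1 0 := by
    rw [← hval, ← hval', hx]
  obtain ⟨c, hc⟩ := H (fun j => (v j).1 0 * e j) (fun j => by rw [← mul_assoc, (v j).2 0])
    (fun j => by rw [mul_assoc, he]) fun t l => by
      have := congrArg (fun w => (S.cokerEmb w).1 t) (hx' l)
      simp only [map_sum, Submodule.coe_sum, Finset.sum_apply, hval, map_zero,
        ZeroMemClass.coe_zero, Pi.zero_apply] at this
      rw [← this, Finset.mul_sum]
      exact Finset.sum_congr rfl fun j _ => by rw [mul_assoc, (hr' j l).1]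
  refine ⟨fun i => Submodule.Quotient.mk ⟨fun k => S.e₀ k * c i, fun k => by
    rw [← mul_assoc, S.idem₀]⟩, fun j => S.cokerEmb_injective (Subtype.ext (funext fun t => ?_))⟩
  rw [hval', ← hve, hc, map_sum, Submodule.coe_sum, Finset.sum_apply, Finset.mul_sum]
  refine Finset.sum_congr rfl fun i _ => ?_
  rw [map_smul, cokerEmb_mk]
  simp [← mul_assoc, hGe]

variable {K : Type u} [Field K] [Algebra K A] [Module.Finite K A] {lam : A →ₗ[K] K}

theorem acyclic_self (hl : IsSymmetrizing lam) : S.Acyclic A :=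
  ⟨(homExact_iff_rowExact S.idem₀ S.idem₁ S.idem₂ S.peirce₀ S.peirce₁).1
      (hl.homExact_self S.partialRes.ex₁),
    (homExact_iff_rowExact S.idem₁ S.idem₂ S.idem₃ S.peirce₁ S.peirce₂).1
      (hl.homExact_self S.partialRes.ex₂)⟩

theorem acyclic_of_extVanish₂ (hl : IsSymmetrizing lam) (X : ModuleCat.{u} Aᵐᵒᵖ)
    (h : ExtVanish₂ X (ModuleCat.of Aᵐᵒᵖ S.Coker)) : S.Acyclic X := by
  let _ := Module.compHom X (algebraMap K Aᵐᵒᵖ)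
  have tX : IsScalarTower K Aᵐᵒᵖ X := ⟨fun k a x => by
    rw [Algebra.smul_def, mul_smul]; rfl⟩
  obtain ⟨Q, -⟩ := exists_partialRes X
  rw [Q.extVanish₂_iff] at h
  have := Q.exists_lift_of_homExact S.partialRes S.cokerEmb S.cokerEmb_injective S.exact_cokerEmb
    (hl.homExact_idemModule S.idem₃ Q.ex₁) h.1 h.2
  exact ⟨hl.rowExact_of_forall_exists_lift S.idem₁ S.peirce₀ S.peirce₁ this.2,
    hl.rowExact_of_forall_exists_lift S.idem₂ S.peirce₁ S.peirce₂ this.1⟩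

/-- The residue class of the generator `e₀`. -/
def gen : S.Coker := Submodule.Quotient.mk (idemGen S.idem₀ 0)

theorem op_smul_gen_eq_mk (v : idemModule S.e₀) :
    op (v.1 0) • S.gen = Submodule.Quotient.mk v := by
  have := sum_op_smul_idemGen S.idem₀ v
  rw [Fin.sum_univ_one] at this
  conv_rhs => rw [← this]
  rfl

theorem exists_op_smul_gen (y : S.Coker) : ∃ a, S.e₀ 0 * a = a ∧ op a • S.gen = y := by
  obtain ⟨v, rfl⟩ := Submodule.Quotient.mk_surjective _ y
  exact ⟨v.1 0, v.2 0, S.op_smul_gen_eq_mk v⟩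

theorem exists_hom_gen {X : Type*} [AddCommGroup X] [Module Aᵐᵒᵖ X] (x : X)
    (hx : op (S.e₀ 0) • x = x) (hx' : op (S.D₀ 0 0) • x = 0) :
    ∃ f : S.Coker →ₗ[Aᵐᵒᵖ] X, f S.gen = x := by
  refine ⟨Submodule.liftQ _ (idemLift S.e₀ fun _ => x) ?_, ?_⟩
  · rintro _ ⟨w, rfl⟩
    rw [LinearMap.mem_ker, idemLift_apply]
    simp [mul_smul, hx']
  · exact (idemLift_idemGen S.idem₀ (fun _ => x) 0).trans hx

theorem cokerEmb_op_smul_gen (a : A) (t) : (S.cokerEmb (op a • S.gen)).1 t = S.G t 0 * a := by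
  rw [map_smul, gen, cokerEmb_mk]
  simp [idemGen, (S.peirceG t 0).2]

theorem finite_coker : Module.Finite Aᵐᵒᵖ S.Coker :=
  .of_surjective (LinearMap.toSpanSingleton Aᵐᵒᵖ S.Coker S.gen) fun y => by
    obtain ⟨a, -, ha⟩ := S.exists_op_smul_gen y
    exact ⟨op a, ha⟩

/-- A criterion for the module presented by `S` to be a direct summand of `X`. -/
theorem exists_split (hl : IsSymmetrizing lam) {X : Type u} [AddCommGroup X] [Module Aᵐᵒᵖ X]
    [Module K X] [IsScalarTower K Aᵐᵒᵖ X] (q : Fin S.p → A) (hq : ∀ s, q s * S.e₃ s = q s)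
    (hunit : ∀ a, S.e₀ 0 * a = a → a * S.e₀ 0 = a → a * ∑ s, q s * S.G s 0 ≠ 0 →
      ∃ b, a * b = S.e₀ 0)
    (x : X) (hx : op (S.e₀ 0) • x = x) (hx' : op (S.D₀ 0 0) • x = 0)
    (hxq : ¬ ∃ z : Fin S.m → X, ∀ s, op (q s) • x = ∑ t, op (S.D₂ t s) • z t) :
    ∃ (f : S.Coker →ₗ[Aᵐᵒᵖ] X) (k : X →ₗ[Aᵐᵒᵖ] S.Coker), k ∘ₗ f = LinearMap.id ∧ k ≠ 0 := by
  obtain ⟨f, hf⟩ := S.exists_hom_gen x hx hx'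
  obtain ⟨φ, hφ, hφx⟩ := hl.exists_functional (fun s => op (q s) • x) hxq
  obtain ⟨h, hh, hφh⟩ := hl.exists_hom_idemModule S.idem₃ S.peirce₂ φ hφ
  have hr (y) : h y ∈ LinearMap.range S.cokerEmb :=
    (S.exact_cokerEmb (h y)).1 (LinearMap.congr_fun hh y)
  let ι := LinearEquiv.ofInjective S.cokerEmb S.cokerEmb_injective
  let k : X →ₗ[Aᵐᵒᵖ] S.Coker := ι.symm ∘ₗ h.codRestrict _ hr
  have hk (y) : S.cokerEmb (k y) = h y :=
    congrArg Subtype.val (ι.apply_symm_apply (h.codRestrict _ hr y))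
  obtain ⟨a, ha, hak⟩ := S.exists_op_smul_gen (k x)
  have hkx : op (a * S.e₀ 0) • S.gen = k x := by
    rw [op_mul, mul_smul, hak, ← map_smul, hx]
  have hG (s) : (h x).1 s = S.G s 0 * (a * S.e₀ 0) := by
    rw [← hk, ← hkx, cokerEmb_op_smul_gen]
  have hne : (a * S.e₀ 0) * ∑ s, q s * S.G s 0 ≠ 0 := by
    intro h0
    apply hφx
    have hs (s) : φ s (op (q s) • x) = lam ((a * S.e₀ 0) * (q s * S.G s 0)) := by
      rw [← hq, ← hφh, hq, hG, mul_assoc, hl.symm, mul_assoc, mul_assoc]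
    rw [Finset.sum_congr rfl fun s _ => hs s, ← map_sum, ← Finset.mul_sum, h0, map_zero]
  obtain ⟨b, hb⟩ := hunit (a * S.e₀ 0) (by rw [← mul_assoc, ha])
    (by rw [mul_assoc, S.idem₀]) hne
  have hkf (y) (c : A) (hy : op c • S.gen = y) : k (f y) = op (a * S.e₀ 0 * c) • S.gen := by
    rw [← hy, map_smul, map_smul, hf, ← hkx, smul_smul, ← op_mul]
  have hsurj : Function.Surjective (k ∘ₗ f) := by
    intro y
    obtain ⟨c, hc, rfl⟩ := S.exists_op_smul_gen y
    refine ⟨op (b * c) • S.gen, ?_⟩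
    rw [LinearMap.comp_apply, hkf _ _ rfl, ← mul_assoc, hb, hc]
  have : Module.Finite K Aᵐᵒᵖ := .equiv (opLinearEquiv K)
  have : IsNoetherianRing Aᵐᵒᵖ := isNoetherian_of_tower K inferInstance
  have := S.finite_coker
  have hbij : Function.Bijective (k ∘ₗ f) :=
    IsNoetherian.bijective_of_surjective_endomorphism _ hsurj
  let θ := LinearEquiv.ofBijective _ hbij
  refine ⟨f ∘ₗ θ.symm, k, ?_, ?_⟩
  · refine LinearMap.ext fun y => ?_
    exact θ.apply_symm_apply y
  · intro hk0
    refine hφx (Finset.sum_eq_zero fun s _ => ?_)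
    have := hk x
    rw [hk0, LinearMap.zero_apply, map_zero] at this
    rw [← hq, ← hφh, ← this]
    simp

end CyclicRes

end CyclicResolutions

section AddClosure

theorem MemAdd.of_add_eq_id {R : Type u} [Ring R] {M X Y Z : ModuleCat.{u} R}
    (hY : MemAdd R M Y) (hZ : MemAdd R M Z) (f : X →ₗ[R] Y) (g : Y →ₗ[R] X) (f' : X →ₗ[R] Z)
    (g' : Z →ₗ[R] X) (h : g ∘ₗ f + g' ∘ₗ f' = LinearMap.id) : MemAdd R M X := by
  obtain ⟨a, i, p, hip⟩ := hY
  obtain ⟨b, j, q, hjq⟩ := hZ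
  let e := (LinearEquiv.sumPiEquivProdPi R (Fin a) (Fin b) (fun _ => M)).symm ≪≫ₗ
    LinearEquiv.funCongrLeft R M finSumFinEquiv.symm
  refine ⟨a + b, e ∘ₗ LinearMap.prod (i ∘ₗ f) (j ∘ₗ f'),
    LinearMap.coprod (g ∘ₗ p) (g' ∘ₗ q) ∘ₗ e.symm, ?_⟩
  refine LinearMap.ext fun x => ?_
  have hp (y) : p (i y) = y := LinearMap.congr_fun hip y
  have hq (z) : q (j z) = z := LinearMap.congr_fun hjq z
  simpa [hp, hq] using LinearMap.congr_fun h x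

variable {K : Type u} [Field K] {A : Type u} [Ring A] [Algebra K A]

theorem memAdd_of_acyclic {κ : Type*} (S : κ → CyclicRes A) (M : ModuleCat.{u} Aᵐᵒᵖ)
    (hM : ∀ k, MemAdd Aᵐᵒᵖ M (ModuleCat.of Aᵐᵒᵖ (S k).Coker))
    (hsplit : ∀ (X : Type u) [AddCommGroup X] [Module Aᵐᵒᵖ X] [Module K X]
      [IsScalarTower K Aᵐᵒᵖ X], (∀ k, (S k).Acyclic X) → Nontrivial X →
      ∃ (k : κ) (f : (S k).Coker →ₗ[Aᵐᵒᵖ] X) (g : X →ₗ[Aᵐᵒᵖ] (S k).Coker),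
        g ∘ₗ f = LinearMap.id ∧ g ≠ 0) (n : ℕ) :
    ∀ (X : Type u) [AddCommGroup X] [Module Aᵐᵒᵖ X] [Module K X] [IsScalarTower K Aᵐᵒᵖ X]
      [Module.Finite K X], Module.finrank K X ≤ n → (∀ k, (S k).Acyclic X) →
      MemAdd Aᵐᵒᵖ M (ModuleCat.of Aᵐᵒᵖ X) := by
  induction n with
  | zero =>
    intro X _ _ _ _ _ hX _
    have : Subsingleton X := Module.finrank_zero_iff.1 (Nat.le_zero.1 hX)
    exact ⟨0, 0, 0, LinearMap.ext fun x => Subsingleton.elim (α := X) _ _⟩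
  | succ n ih =>
    intro X _ _ _ _ _ hX hS
    obtain h | h := subsingleton_or_nontrivial X
    · exact ⟨0, 0, 0, LinearMap.ext fun x => Subsingleton.elim (α := X) _ _⟩
    obtain ⟨k, f, g, hgf, hg⟩ := hsplit X hS h
    have hgf' (y) : g (f y) = y := LinearMap.congr_fun hgf y
    let π : X →ₗ[Aᵐᵒᵖ] LinearMap.ker g := (LinearMap.id - f ∘ₗ g).codRestrict _ fun x => by
      simp [hgf']
    have hπ : π ∘ₗ (LinearMap.ker g).subtype = LinearMap.id := by
      ext x
      have : g x = 0 := x.2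
      simp [π, this]
    have hlt : Module.finrank K (LinearMap.ker g) < Module.finrank K X :=
      Submodule.finrank_lt (s := (LinearMap.ker g).restrictScalars K) fun h => hg
        (LinearMap.ker_eq_top.1 (by simpa using h))
    have : Module.Finite K (LinearMap.ker g) :=
      inferInstanceAs (Module.Finite K ((LinearMap.ker g).restrictScalars K))
    refine MemAdd.of_add_eq_id (hM k) (ih (LinearMap.ker g) (by omega) fun k =>
      ⟨(hS k).1.of_retract _ _ hπ, (hS k).2.of_retract _ _ hπ⟩) g f π (LinearMap.ker g).subtype ?_
    ext x
    simp [π]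

end AddClosure

section CyclicResolutionBuilders

open MulOpposite

variable {A : Type u} [Ring A]

theorem MatExact.of_one {e r r' : A} (h : r * r' = 0)
    (H : ∀ x, e * x = x → r * x = 0 → ∃ z, x = r' * z) :
    MatExact (fun _ : Fin 1 => e) (fun _ _ : Fin 1 => r) (fun _ _ : Fin 1 => r') where
  mul_eq_zero _ _ := by rw [Fin.sum_univ_one, h]
  exists_eq v hv hv' := by
    obtain ⟨z, hz⟩ := H (v 0) (hv 0) (by simpa only [Fin.sum_univ_one] using hv' 0)
    exact ⟨fun _ => z, fun j => by rw [Fin.sum_univ_one, Subsingleton.elim j 0, hz]⟩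

theorem IsPeirce.of_one {e e' r : A} (h : e * r = r) (h' : r * e' = r) :
    IsPeirce (fun _ : Fin 1 => e) (fun _ : Fin 1 => e') (fun _ _ : Fin 1 => r) :=
  fun _ _ => ⟨h, h'⟩

/-- A `CyclicRes` all of whose terms are of the form `eA`. -/
@[reducible] def CyclicRes.ofOne (e₀ e₁ e₂ e₃ D₀ D₁ D₂ G : A) (h₀ : e₀ * e₀ = e₀) (h₁ : e₁ * e₁ = e₁)
    (h₂ : e₂ * e₂ = e₂) (h₃ : e₃ * e₃ = e₃) (p₀ : e₀ * D₀ = D₀ ∧ D₀ * e₁ = D₀)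
    (p₁ : e₁ * D₁ = D₁ ∧ D₁ * e₂ = D₁) (p₂ : e₂ * D₂ = D₂ ∧ D₂ * e₃ = D₂)
    (pG : e₃ * G = G ∧ G * e₀ = G) (z₀ : G * D₀ = 0) (z₁ : D₀ * D₁ = 0) (z₂ : D₁ * D₂ = 0)
    (z₃ : D₂ * G = 0) (x₀ : ∀ x, e₀ * x = x → G * x = 0 → ∃ z, x = D₀ * z)
    (x₁ : ∀ x, e₁ * x = x → D₀ * x = 0 → ∃ z, x = D₁ * z)
    (x₂ : ∀ x, e₂ * x = x → D₁ * x = 0 → ∃ z, x = D₂ * z)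
    (x₃ : ∀ x, e₃ * x = x → D₂ * x = 0 → ∃ z, x = G * z) : CyclicRes A where
  m := 1
  p := 1
  e₀ := fun _ => e₀
  e₁ := fun _ => e₁
  e₂ := fun _ => e₂
  e₃ := fun _ => e₃
  D₀ := fun _ _ => D₀
  D₁ := fun _ _ => D₁
  D₂ := fun _ _ => D₂
  G := fun _ _ => G
  idem₀ _ := h₀
  idem₁ _ := h₁
  idem₂ _ := h₂
  idem₃ _ := h₃
  peirce₀ _ _ := p₀
  peirce₁ _ _ := p₁
  peirce₂ _ _ := p₂
  peirceG _ _ := pG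
  ex₀ := .of_one z₀ x₀
  ex₁ := .of_one z₁ x₁
  ex₂ := .of_one z₂ x₂
  ex₃ := .of_one z₃ x₃

/-- The `CyclicRes` presenting the projective module `eA`. -/
@[reducible] def CyclicRes.ofIdem (e : A) (he : e * e = e) : CyclicRes A :=
  .ofOne e e e e 0 e 0 e he he he he ⟨mul_zero e, zero_mul e⟩ ⟨he, he⟩ ⟨mul_zero e, zero_mul e⟩
    ⟨he, he⟩ (mul_zero e) (zero_mul e) (mul_zero e) (zero_mul e)
    (fun x hx hx' => ⟨0, by rw [mul_zero, ← hx, hx']⟩) (fun x hx _ => ⟨x, hx.symm⟩)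
    (fun x hx hx' => ⟨0, by rw [mul_zero, ← hx, hx']⟩) (fun x hx _ => ⟨x, hx.symm⟩)

theorem acyclic_ofIdem (e : A) (he : e * e = e) (X : Type*) [AddCommGroup X] [Module Aᵐᵒᵖ X] :
    (CyclicRes.ofIdem e he).Acyclic X := by
  constructor
  · intro x hx hx'
    refine ⟨0, fun j => ?_⟩
    have := hx' 0
    have h2 := hx j
    obtain rfl : j = 0 := Subsingleton.elim _ _
    change ∑ j : Fin 1, op e • x j = 0 at this
    change op e • x 0 = x 0 at h2
    rw [Fin.sum_univ_one, h2] at this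
    simpa using this
  · intro x hx _
    refine ⟨x, fun j => ?_⟩
    change x j = ∑ i : Fin 1, op e • x i
    rw [Fin.sum_univ_one, Subsingleton.elim j (0 : Fin 1)]
    exact (hx 0).symm

variable {K : Type u} [Field K] [Algebra K A] [Module.Finite K A] in
theorem CyclicRes.acyclic_coker_ofIdem (S : CyclicRes A) {lam : A →ₗ[K] K}
    (hl : IsSymmetrizing lam) (e : A) (he : e * e = e) :
    S.Acyclic (CyclicRes.ofIdem e he).Coker := by
  have key {I J L : Type} [Fintype I] [Fintype J] [Fintype L] {f : J → A} {g : L → A}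
      {r : I → J → A} {r' : J → L → A} (hf : ∀ j, f j * f j = f j) (hr : IsPeirce f g r')
      (H : RowExact f r r' A) : RowExact f r r' (CyclicRes.ofIdem e he).Coker := by
    refine (CyclicRes.ofIdem e he).rowExact_coker hf hr fun a h h' hz => ?_
    have h : ∀ j, e * a j = a j := h
    obtain ⟨c, hc⟩ := H a h' fun l => by
      have := hz 0 l
      change e * _ = 0 at this
      simpa only [Finset.mul_sum, ← mul_assoc, h, op_smul_eq_mul] using this
    refine ⟨c, fun t j => ?_⟩
    change e * a j = e * ∑ i, c i * r i j
    rw [hc j]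
    rfl
  exact ⟨key S.idem₁ S.peirce₁ (S.acyclic_self hl).1, key S.idem₂ S.peirce₂ (S.acyclic_self hl).2⟩

end CyclicResolutionBuilders

/-- An element `c • e + ν` of a corner ring `eAe`, with `ν` nilpotent, has a right inverse as soon
as it does not kill an element `s` killed by `ν`. -/
theorem exists_mul_eq_of_nilpotent {K A : Type*} [Field K] [Ring A] [Algebra K A] {e ν s : A} {c : K}
    (he : e * e = e) (hν : e * ν = ν) (hs : ν * s = 0) (hn : ν * (ν * (ν * (ν * ν))) = 0)
    (hne : (c • e + ν) * s ≠ 0) : ∃ b, (c • e + ν) * b = e := by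
  have hc : c ≠ 0 := by
    rintro rfl
    simp [hs] at hne
  have hnil : IsNilpotent (c⁻¹ • ν) :=
    IsNilpotent.smul ⟨5, by simpa only [pow_succ', pow_zero, mul_one] using hn⟩ c⁻¹
  obtain ⟨u, hu⟩ := hnil.isUnit_one_add
  refine ⟨c⁻¹ • (↑u⁻¹ * e), ?_⟩
  have : c • e + ν = c • (e * u) := by
    rw [hu, mul_add, mul_one, mul_smul_comm, hν, smul_add, smul_smul, mul_inv_cancel₀ hc, one_smul]
  rw [this, smul_mul_smul_comm, mul_inv_cancel₀ hc, one_smul, mul_assoc, Units.mul_inv_cancel_left,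
    he]

section Chase
open MulOpposite
variable {A : Type u} [Ring A] {X : Type*} [AddCommGroup X] [Module Aᵐᵒᵖ X]

theorem RowExact.exists_of_one {e r r' : A}
    (h : RowExact (fun _ : Fin 1 => e) (fun _ _ : Fin 1 => r) (fun _ _ : Fin 1 => r') X)
    (he : e * e = e) (hr' : e * r' = r') (x : X) (hx : op r' • x = 0) :
    ∃ z : X, op e • x = op r • z := by
  obtain ⟨z, hz⟩ := h (fun _ => op e • x) (fun _ => by rw [op_smul_op_smul, he])
    (fun _ => by rw [Fin.sum_univ_one, op_smul_op_smul, hr', hx])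
  exact ⟨z 0, by simpa only [Fin.sum_univ_one] using hz 0⟩

end Chase

theorem CyclicRes.rowExact_coker_of_one {A : Type u} [Ring A] (S : CyclicRes A) {e e' r r' : A}
    (he : e * e = e) (hr' : e * r' = r' ∧ r' * e' = r')
    (H : ∀ a, S.e₀ 0 * a = a → a * e = a → (∀ t, S.G t 0 * (a * r') = 0) →
      ∃ c, ∀ t, S.G t 0 * a = S.G t 0 * (c * r)) :
    RowExact (fun _ : Fin 1 => e) (fun _ _ : Fin 1 => r) (fun _ _ : Fin 1 => r') S.Coker := by
  refine S.rowExact_coker (fun _ => he) (.of_one hr'.1 hr'.2) fun a h h' hz => ?_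
  obtain ⟨c, hc⟩ := H (a 0) (h 0) (h' 0) fun t => by
    simpa only [Fin.sum_univ_one] using hz t 0
  exact ⟨fun _ => c, fun t j => by rw [Subsingleton.elim j 0, hc, Fin.sum_univ_one]⟩

section Splitting

open MulOpposite

variable {K A : Type u} [Field K] [Ring A] [Algebra K A] [Module.Finite K A] {lam : A →ₗ[K] K}

theorem CyclicRes.exists_of_forall_split (S : CyclicRes A) (hl : IsSymmetrizing lam) {X : Type u}
    [AddCommGroup X] [Module Aᵐᵒᵖ X] [Module K X] [IsScalarTower K Aᵐᵒᵖ X]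
    (hX : ∀ (f : S.Coker →ₗ[Aᵐᵒᵖ] X) (g : X →ₗ[Aᵐᵒᵖ] S.Coker), g ∘ₗ f = LinearMap.id → g = 0)
    (q : Fin S.p → A) (hq : ∀ s, q s * S.e₃ s = q s) {σ : A} (hσ : ∑ s, q s * S.G s 0 = σ)
    (hunit : ∀ a, S.e₀ 0 * a = a → a * S.e₀ 0 = a → a * σ ≠ 0 → ∃ b, a * b = S.e₀ 0)
    (hq' : ∀ s, S.e₀ 0 * q s = q s) (x : X) (hx : op (S.D₀ 0 0) • x = 0) :
    ∃ z : Fin S.m → X, ∀ s, op (q s) • x = ∑ t, op (S.D₂ t s) • z t := by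
  by_contra h
  have hD : S.e₀ 0 * S.D₀ 0 0 = S.D₀ 0 0 := (S.peirce₀ 0 0).1
  obtain ⟨f, g, hgf, hg⟩ := S.exists_split hl q hq (by rwa [hσ]) (op (S.e₀ 0) • x)
    (by rw [op_smul_op_smul, S.idem₀]) (by rw [op_smul_op_smul, hD, hx])
    (by simpa only [op_smul_op_smul, hq'] using h)
  exact hg (hX f g hgf)

theorem op_smul_eq_zero_of_forall_split (hl : IsSymmetrizing lam) {X : Type u} [AddCommGroup X]
    [Module Aᵐᵒᵖ X] [Module K X] [IsScalarTower K Aᵐᵒᵖ X] {e σ : A} (he : e * e = e)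
    (hσ : e * σ = σ) (hσ' : σ * e = σ)
    (hunit : ∀ a, e * a = a → a * e = a → a * σ ≠ 0 → ∃ b, a * b = e)
    (hX : ∀ (f : (CyclicRes.ofIdem e he).Coker →ₗ[Aᵐᵒᵖ] X)
      (g : X →ₗ[Aᵐᵒᵖ] (CyclicRes.ofIdem e he).Coker), g ∘ₗ f = LinearMap.id → g = 0) (x : X) :
    op σ • x = 0 := by
  obtain ⟨z, hz⟩ := (CyclicRes.ofIdem e he).exists_of_forall_split hl hX (fun _ => σ)
    (fun _ => hσ') ((Fin.sum_univ_one _).trans hσ') hunit (fun _ => hσ) x (zero_smul _ x)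
  exact (hz 0).trans ((Fin.sum_univ_one _).trans (zero_smul _ _))

end Splitting

section ClusterTilting

variable {A : Type u} [Ring A]

theorem MemAdd.exists_sum_comp_eq_id {R : Type u} [Ring R] {M X : ModuleCat.{u} R}
    (h : MemAdd R M X) : ∃ (n : ℕ) (f : Fin n → (X →ₗ[R] M)) (g : Fin n → (M →ₗ[R] X)),
      ∑ i, g i ∘ₗ f i = LinearMap.id := by
  obtain ⟨n, f, g, hgf⟩ := h
  refine ⟨n, fun i => .proj i ∘ₗ f, fun i => g ∘ₗ .single R (fun _ => M) i, ?_⟩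
  refine LinearMap.ext fun x => ?_
  have hx : g (f x) = x := LinearMap.congr_fun hgf x
  conv_rhs => rw [LinearMap.id_apply, ← hx, ← LinearMap.sum_single_apply _ (f x), map_sum]
  simp [LinearMap.sum_apply]

theorem MemAdd.of_comp_eq_id {R : Type u} [Ring R] {M X : ModuleCat.{u} R} (f : X →ₗ[R] M)
    (g : M →ₗ[R] X) (h : g ∘ₗ f = LinearMap.id) : MemAdd R M X :=
  ⟨1, LinearMap.pi fun _ => f, g ∘ₗ .proj 0, h⟩

variable {K : Type u} [Field K] [Algebra K A] [Module.Finite K A] {lam : A →ₗ[K] K}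

/-- Over a symmetric algebra, a finite direct sum of modules presented by `CyclicRes` is
`3`-cluster tilting if it is rigid and every module `X ≠ 0` orthogonal to it has one of the
summands as a direct summand. -/
theorem isNClusterTilting_three_of_cyclicRes (hl : IsSymmetrizing lam) {κ : Type*} [Fintype κ]
    (S : κ → CyclicRes A) (M : ModuleCat.{u} Aᵐᵒᵖ) (f : ∀ k, M →ₗ[Aᵐᵒᵖ] (S k).Coker)
    (g : ∀ k, (S k).Coker →ₗ[Aᵐᵒᵖ] M) (hfg : ∑ k, g k ∘ₗ f k = LinearMap.id)
    (hgf : ∀ k, f k ∘ₗ g k = LinearMap.id) (hrigid : ∀ k l, (S k).Acyclic (S l).Coker)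
    (hsplit : ∀ (X : Type u) [AddCommGroup X] [Module Aᵐᵒᵖ X] [Module K X]
      [IsScalarTower K Aᵐᵒᵖ X], (∀ k, (S k).Acyclic X) → Nontrivial X →
      ∃ (k : κ) (f : (S k).Coker →ₗ[Aᵐᵒᵖ] X) (g : X →ₗ[Aᵐᵒᵖ] (S k).Coker),
        g ∘ₗ f = LinearMap.id ∧ g ≠ 0) :
    IsNClusterTilting Aᵐᵒᵖ 3 M := by
  let N (k : κ) : ModuleCat.{u} Aᵐᵒᵖ := ModuleCat.of Aᵐᵒᵖ (S k).Coker
  have hN k : MemAdd Aᵐᵒᵖ M (N k) := .of_comp_eq_id (g k) (f k) (hgf k)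
  have hMl {Z} (h : ∀ k, ExtVanish₂ (N k) Z) : ExtVanish₂ M Z :=
    .of_sum_comp_eq_id (Y := N) f g hfg h
  have hMr {Z} (h : ∀ k, ExtVanish₂ Z (N k)) : ExtVanish₂ Z M :=
    .of_sum_comp_eq_id_right (Y := N) f g hfg h
  have hMM : ExtVanish₂ M M :=
    hMr fun l => hMl fun k => ((S k).extVanish₂_iff (N l)).2 (hrigid k l)
  have hacyc (X : ModuleCat.{u} Aᵐᵒᵖ) (hX : Module.Finite Aᵐᵒᵖ X) (h : ∀ k, (S k).Acyclic X) :
      MemAdd Aᵐᵒᵖ M X := by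
    let _ := Module.compHom X (algebraMap K Aᵐᵒᵖ)
    have : IsScalarTower K Aᵐᵒᵖ X := ⟨fun k a x => by rw [Algebra.smul_def, mul_smul]; rfl⟩
    have : Module.Finite K Aᵐᵒᵖ := .equiv (MulOpposite.opLinearEquiv K)
    have : Module.Finite K X := .trans Aᵐᵒᵖ X
    exact memAdd_of_acyclic S M hN hsplit _ X le_rfl h
  have hfin (k) : Module.Finite Aᵐᵒᵖ (S k).Coker := (S k).finite_coker
  refine ⟨?_, fun X hX => ?_, fun X hX => ?_⟩
  · refine .of_surjective (∑ k, g k ∘ₗ (.proj k : (∀ k, (S k).Coker) →ₗ[Aᵐᵒᵖ] _)) fun x =>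
      ⟨fun k => f k x, ?_⟩
    simpa [LinearMap.sum_apply] using LinearMap.congr_fun hfg x
  · rw [forall_extVanish_iff]
    refine ⟨fun h => ?_, fun h => hacyc X hX fun k => ((S k).extVanish₂_iff X).1 ?_⟩
    · obtain ⟨n, p, q, hpq⟩ := h.exists_sum_comp_eq_id
      exact .of_sum_comp_eq_id_right (Y := fun _ => M) p q hpq fun _ => hMM
    · exact .of_sum_comp_eq_id (κ := Unit) (Y := fun _ => M) (fun _ => g k) (fun _ => f k)
        (by simpa using hgf k) fun _ => h
  · rw [forall_extVanish_iff]
    refine ⟨fun h => ?_, fun h => hacyc X hX fun k => (S k).acyclic_of_extVanish₂ hl X ?_⟩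
    · obtain ⟨n, p, q, hpq⟩ := h.exists_sum_comp_eq_id
      exact .of_sum_comp_eq_id (Y := fun _ => M) p q hpq fun _ => hMM
    · exact .of_sum_comp_eq_id_right (κ := Unit) (Y := fun _ => M) (fun _ => g k) (fun _ => f k)
        (by simpa using hgf k) fun _ => h

end ClusterTilting

section Arithmetic

open QGen

/-- The vertex at which an arrow (or a trivial path) starts. -/
def QGen.src : QGen → Fin 3
  | v1 => 0 | v2 => 1 | v3 => 2 | ab => 0 | ay => 1 | ad => 1 | an => 2

/-- The vertex at which an arrow (or a trivial path) ends. -/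
def QGen.tgt : QGen → Fin 3
  | v1 => 0 | v2 => 1 | v3 => 2 | ab => 1 | ay => 0 | ad => 2 | an => 1

/-- The vertex idempotents of the algebra. -/
noncomputable def qidem (K : Type u) [Field K] : Fin 3 → QuatAlg K :=
  ![qgen K v1, qgen K v2, qgen K v3]

variable (K : Type u) [Field K]

local notation "𝖾₁" => qgen K v1
local notation "𝖾₂" => qgen K v2
local notation "𝖾₃" => qgen K v3
local notation "𝖻" => qgen K ab
local notation "𝗒" => qgen K ay
local notation "𝖽" => qgen K ad
local notation "𝗇" => qgen K an

theorem qgen_rel {p q : FreeAlgebra K QGen} (h : QuatRel K p q) :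
    RingQuot.mkAlgHom K (QuatRel K) p = RingQuot.mkAlgHom K (QuatRel K) q :=
  RingQuot.mkAlgHom_rel K h

theorem qgen_unit : 𝖾₁ + 𝖾₂ + 𝖾₃ = 1 := by
  simpa [qgen] using qgen_rel K .unit

theorem qidem_mul_qidem (i j : Fin 3) :
    qidem K i * qidem K j = if i = j then qidem K i else 0 := by
  have h1 := qgen_rel K .idem1
  have h2 := qgen_rel K .idem2
  have h3 := qgen_rel K .idem3
  have h12 := qgen_rel K .orth12
  have h13 := qgen_rel K .orth13
  have h21 := qgen_rel K .orth21
  have h23 := qgen_rel K .orth23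
  have h31 := qgen_rel K .orth31
  have h32 := qgen_rel K .orth32
  simp only [map_mul, map_zero] at h1 h2 h3 h12 h13 h21 h23 h31 h32
  fin_cases i <;> fin_cases j <;> simpa [qidem, qgen]

theorem qidem_src_mul (g : QGen) : qidem K g.src * qgen K g = qgen K g := by
  have h1 := qgen_rel K .src_b
  have h2 := qgen_rel K .src_y
  have h3 := qgen_rel K .src_d
  have h4 := qgen_rel K .src_n
  simp only [map_mul] at h1 h2 h3 h4
  cases g
  · exact (qidem_mul_qidem K 0 0).trans (if_pos rfl)
  · exact (qidem_mul_qidem K 1 1).trans (if_pos rfl)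
  · exact (qidem_mul_qidem K 2 2).trans (if_pos rfl)
  all_goals simpa [qidem, qgen, QGen.src]

theorem mul_qidem_tgt (g : QGen) : qgen K g * qidem K g.tgt = qgen K g := by
  have h1 := qgen_rel K .tgt_b
  have h2 := qgen_rel K .tgt_y
  have h3 := qgen_rel K .tgt_d
  have h4 := qgen_rel K .tgt_n
  simp only [map_mul] at h1 h2 h3 h4
  cases g
  · exact (qidem_mul_qidem K 0 0).trans (if_pos rfl)
  · exact (qidem_mul_qidem K 1 1).trans (if_pos rfl)
  · exact (qidem_mul_qidem K 2 2).trans (if_pos rfl)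
  all_goals simpa [qidem, qgen, QGen.tgt]

theorem qgen_mul_qgen_eq_zero (g h : QGen) (hgh : g.tgt ≠ h.src) : qgen K g * qgen K h = 0 := by
  rw [← mul_qidem_tgt, ← qidem_src_mul K h, mul_assoc, ← mul_assoc (qidem K _), qidem_mul_qidem,
    if_neg hgh, zero_mul, mul_zero]

theorem qgen_orthogonal :
    𝖾₁ * 𝖾₂ = 0 ∧ 𝖾₁ * 𝖾₃ = 0 ∧ 𝖾₁ * 𝗒 = 0 ∧ 𝖾₁ * 𝖽 = 0 ∧ 𝖾₁ * 𝗇 = 0 ∧ 𝖾₂ * 𝖾₁ = 0 ∧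
    𝖾₂ * 𝖾₃ = 0 ∧ 𝖾₂ * 𝖻 = 0 ∧ 𝖾₂ * 𝗇 = 0 ∧ 𝖾₃ * 𝖾₁ = 0 ∧ 𝖾₃ * 𝖾₂ = 0 ∧ 𝖾₃ * 𝖻 = 0 ∧ 𝖾₃ * 𝗒 = 0 ∧
    𝖾₃ * 𝖽 = 0 ∧ 𝖻 * 𝖾₁ = 0 ∧ 𝖻 * 𝖾₃ = 0 ∧ 𝖻 * 𝖻 = 0 ∧ 𝖻 * 𝗇 = 0 ∧ 𝗒 * 𝖾₂ = 0 ∧ 𝗒 * 𝖾₃ = 0 ∧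
    𝗒 * 𝗒 = 0 ∧ 𝗒 * 𝖽 = 0 ∧ 𝗒 * 𝗇 = 0 ∧ 𝖽 * 𝖾₁ = 0 ∧ 𝖽 * 𝖾₂ = 0 ∧ 𝖽 * 𝖻 = 0 ∧ 𝖽 * 𝗒 = 0 ∧
    𝖽 * 𝖽 = 0 ∧ 𝗇 * 𝖾₁ = 0 ∧ 𝗇 * 𝖾₃ = 0 ∧ 𝗇 * 𝖻 = 0 ∧ 𝗇 * 𝗇 = 0 := by
  refine ⟨?_, ?_, ?_, ?_, ?_, ?_, ?_, ?_, ?_, ?_, ?_, ?_, ?_, ?_, ?_, ?_, ?_, ?_, ?_, ?_, ?_, ?_, ?_,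
    ?_, ?_, ?_, ?_, ?_, ?_, ?_, ?_, ?_⟩ <;>
  exact qgen_mul_qgen_eq_zero K _ _ (by decide)

theorem qgen_idem :
    𝖾₁ * 𝖾₁ = 𝖾₁ ∧ 𝖾₁ * 𝖻 = 𝖻 ∧ 𝖾₂ * 𝖾₂ = 𝖾₂ ∧ 𝖾₂ * 𝗒 = 𝗒 ∧ 𝖾₂ * 𝖽 = 𝖽 ∧ 𝖾₃ * 𝖾₃ = 𝖾₃ ∧
    𝖾₃ * 𝗇 = 𝗇 ∧ 𝖻 * 𝖾₂ = 𝖻 ∧ 𝗒 * 𝖾₁ = 𝗒 ∧ 𝖽 * 𝖾₃ = 𝖽 ∧ 𝗇 * 𝖾₂ = 𝗇 :=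
  ⟨qidem_src_mul K v1, qidem_src_mul K ab, qidem_src_mul K v2, qidem_src_mul K ay, qidem_src_mul K ad, qidem_src_mul K v3, qidem_src_mul K an, mul_qidem_tgt K ab, mul_qidem_tgt K ay, mul_qidem_tgt K ad, mul_qidem_tgt K an⟩

theorem qgen_relations :
    𝖻 * (𝗒 * (𝖻)) = 𝖻 * (𝖽 * (𝗇 * (𝗒 * (𝖻 * (𝖽 * (𝗇)))))) ∧
    𝗒 * (𝖻 * (𝗒)) = 𝖽 * (𝗇 * (𝗒 * (𝖻 * (𝖽 * (𝗇 * (𝗒)))))) ∧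
    𝗇 * (𝖽 * (𝗇)) = 𝗇 * (𝗒 * (𝖻 * (𝖽 * (𝗇 * (𝗒 * (𝖻)))))) ∧
    𝖽 * (𝗇 * (𝖽)) = 𝗒 * (𝖻 * (𝖽 * (𝗇 * (𝗒 * (𝖻 * (𝖽)))))) ∧ 𝖻 * (𝗒 * (𝖻 * (𝖽))) = 0 ∧
    𝗇 * (𝖽 * (𝗇 * (𝗒))) = 0 := by
  have h1 := qgen_rel K .rel1
  have h2 := qgen_rel K .rel2
  have h3 := qgen_rel K .rel3
  have h4 := qgen_rel K .rel4
  have h5 := qgen_rel K .rel5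
  have h6 := qgen_rel K .rel6
  simp only [map_mul, map_zero, mul_assoc] at h1 h2 h3 h4 h5 h6
  exact ⟨h1, h2, h3, h4, h5, h6⟩

theorem qgen_derived_relations :
    𝖽 * (𝗇 * (𝖽 * (𝗇))) = 𝗒 * (𝖻 * (𝗒 * (𝖻))) ∧ 𝗇 * (𝗒 * (𝖻 * (𝗒))) = 0 ∧
    𝖻 * (𝖽 * (𝗇 * (𝖽))) = 0 ∧ 𝖻 * (𝗒 * (𝖻 * (𝗒 * (𝖻)))) = 0 ∧ 𝗒 * (𝖻 * (𝗒 * (𝖻 * (𝗒)))) = 0 := by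
  obtain ⟨h1, h2, h3, h4, h5, h6⟩ := qgen_relations K
  have h5' : ∀ x, 𝖻 * (𝗒 * (𝖻 * (𝖽 * x))) = 0 := fun x => by
    simpa only [mul_assoc, zero_mul] using congrArg (· * x) h5
  have h6' : ∀ x, 𝗇 * (𝖽 * (𝗇 * (𝗒 * x))) = 0 := fun x => by
    simpa only [mul_assoc, zero_mul] using congrArg (· * x) h6
  have h4' := congrArg (· * 𝗇) h4
  simp only [mul_assoc] at h4'
  have s : 𝖽 * (𝗇 * (𝖽 * 𝗇)) = 𝗒 * (𝖻 * (𝗒 * 𝖻)) := by rw [h4', ← h1]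
  have s' := congrArg (· * 𝗒) s
  simp only [mul_assoc] at s'
  refine ⟨s, by rw [h2, h6'], by rw [h4, h5'], by rw [h1, h5'], ?_⟩
  rw [← s', h6, mul_zero]

/-- A complete set of rewriting rules bringing products of arrows to normal form. -/
theorem qgen_rules :
    𝖻 * (𝖽 * (𝗇 * (𝗒 * (𝖻 * (𝖽 * (𝗇)))))) = 𝖻 * (𝗒 * (𝖻)) ∧
    𝖽 * (𝗇 * (𝗒 * (𝖻 * (𝖽 * (𝗇 * (𝗒)))))) = 𝗒 * (𝖻 * (𝗒)) ∧
    𝗇 * (𝗒 * (𝖻 * (𝖽 * (𝗇 * (𝗒 * (𝖻)))))) = 𝗇 * (𝖽 * (𝗇)) ∧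
    𝗒 * (𝖻 * (𝖽 * (𝗇 * (𝗒 * (𝖻 * (𝖽)))))) = 𝖽 * (𝗇 * (𝖽)) ∧
    𝖽 * (𝗇 * (𝖽 * (𝗇))) = 𝗒 * (𝖻 * (𝗒 * (𝖻))) ∧ 𝖻 * (𝗒 * (𝖻 * (𝖽))) = 0 ∧
    𝗇 * (𝖽 * (𝗇 * (𝗒))) = 0 ∧ 𝗇 * (𝗒 * (𝖻 * (𝗒))) = 0 ∧ 𝖻 * (𝖽 * (𝗇 * (𝖽))) = 0 ∧
    𝖻 * (𝗒 * (𝖻 * (𝗒 * (𝖻)))) = 0 ∧ 𝗒 * (𝖻 * (𝗒 * (𝖻 * (𝗒)))) = 0 := by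
  obtain ⟨h1, h2, h3, h4, h5, h6⟩ := qgen_relations K
  obtain ⟨s, z1, z2, z3, z4⟩ := qgen_derived_relations K
  exact ⟨h1.symm, h2.symm, h3.symm, h4.symm, s, h5, h6, z1, z2, z3, z4⟩

theorem qgen_rules_assoc (x : QuatAlg K) :
    𝖻 * (𝖽 * (𝗇 * (𝗒 * (𝖻 * (𝖽 * (𝗇 * x)))))) = 𝖻 * (𝗒 * (𝖻 * x)) ∧
    𝖽 * (𝗇 * (𝗒 * (𝖻 * (𝖽 * (𝗇 * (𝗒 * x)))))) = 𝗒 * (𝖻 * (𝗒 * x)) ∧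
    𝗇 * (𝗒 * (𝖻 * (𝖽 * (𝗇 * (𝗒 * (𝖻 * x)))))) = 𝗇 * (𝖽 * (𝗇 * x)) ∧
    𝗒 * (𝖻 * (𝖽 * (𝗇 * (𝗒 * (𝖻 * (𝖽 * x)))))) = 𝖽 * (𝗇 * (𝖽 * x)) ∧
    𝖽 * (𝗇 * (𝖽 * (𝗇 * x))) = 𝗒 * (𝖻 * (𝗒 * (𝖻 * x))) ∧ 𝖻 * (𝗒 * (𝖻 * (𝖽 * x))) = 0 ∧
    𝗇 * (𝖽 * (𝗇 * (𝗒 * x))) = 0 ∧ 𝗇 * (𝗒 * (𝖻 * (𝗒 * x))) = 0 ∧ 𝖻 * (𝖽 * (𝗇 * (𝖽 * x))) = 0 ∧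
    𝖻 * (𝗒 * (𝖻 * (𝗒 * (𝖻 * x)))) = 0 ∧ 𝗒 * (𝖻 * (𝗒 * (𝖻 * (𝗒 * x)))) = 0 := by
  obtain ⟨h1, h2, h3, h4, h5, h6, h7, h8, h9, h10, h11⟩ := qgen_rules K
  refine ⟨?_, ?_, ?_, ?_, ?_, ?_, ?_, ?_, ?_, ?_, ?_⟩
  · simpa only [mul_assoc] using congrArg (· * x) h1
  · simpa only [mul_assoc] using congrArg (· * x) h2
  · simpa only [mul_assoc] using congrArg (· * x) h3
  · simpa only [mul_assoc] using congrArg (· * x) h4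
  · simpa only [mul_assoc] using congrArg (· * x) h5
  · simpa only [mul_assoc, zero_mul] using congrArg (· * x) h6
  · simpa only [mul_assoc, zero_mul] using congrArg (· * x) h7
  · simpa only [mul_assoc, zero_mul] using congrArg (· * x) h8
  · simpa only [mul_assoc, zero_mul] using congrArg (· * x) h9
  · simpa only [mul_assoc, zero_mul] using congrArg (· * x) h10
  · simpa only [mul_assoc, zero_mul] using congrArg (· * x) h11

theorem qgen_orthogonal_assoc (x : QuatAlg K) :
    𝖾₁ * (𝖾₂ * x) = 0 ∧ 𝖾₁ * (𝖾₃ * x) = 0 ∧ 𝖾₁ * (𝗒 * x) = 0 ∧ 𝖾₁ * (𝖽 * x) = 0 ∧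
    𝖾₁ * (𝗇 * x) = 0 ∧ 𝖾₂ * (𝖾₁ * x) = 0 ∧ 𝖾₂ * (𝖾₃ * x) = 0 ∧ 𝖾₂ * (𝖻 * x) = 0 ∧
    𝖾₂ * (𝗇 * x) = 0 ∧ 𝖾₃ * (𝖾₁ * x) = 0 ∧ 𝖾₃ * (𝖾₂ * x) = 0 ∧ 𝖾₃ * (𝖻 * x) = 0 ∧
    𝖾₃ * (𝗒 * x) = 0 ∧ 𝖾₃ * (𝖽 * x) = 0 ∧ 𝖻 * (𝖾₁ * x) = 0 ∧ 𝖻 * (𝖾₃ * x) = 0 ∧ 𝖻 * (𝖻 * x) = 0 ∧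
    𝖻 * (𝗇 * x) = 0 ∧ 𝗒 * (𝖾₂ * x) = 0 ∧ 𝗒 * (𝖾₃ * x) = 0 ∧ 𝗒 * (𝗒 * x) = 0 ∧ 𝗒 * (𝖽 * x) = 0 ∧
    𝗒 * (𝗇 * x) = 0 ∧ 𝖽 * (𝖾₁ * x) = 0 ∧ 𝖽 * (𝖾₂ * x) = 0 ∧ 𝖽 * (𝖻 * x) = 0 ∧ 𝖽 * (𝗒 * x) = 0 ∧
    𝖽 * (𝖽 * x) = 0 ∧ 𝗇 * (𝖾₁ * x) = 0 ∧ 𝗇 * (𝖾₃ * x) = 0 ∧ 𝗇 * (𝖻 * x) = 0 ∧ 𝗇 * (𝗇 * x) = 0 := by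
  refine ⟨?_, ?_, ?_, ?_, ?_, ?_, ?_, ?_, ?_, ?_, ?_, ?_, ?_, ?_, ?_, ?_, ?_, ?_, ?_, ?_, ?_, ?_, ?_,
    ?_, ?_, ?_, ?_, ?_, ?_, ?_, ?_, ?_⟩ <;>
  rw [← mul_assoc, qgen_mul_qgen_eq_zero K _ _ (by decide), zero_mul]

theorem qgen_idem_assoc (x : QuatAlg K) :
    𝖾₁ * (𝖾₁ * x) = 𝖾₁ * x ∧ 𝖾₁ * (𝖻 * x) = 𝖻 * x ∧ 𝖾₂ * (𝖾₂ * x) = 𝖾₂ * x ∧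
    𝖾₂ * (𝗒 * x) = 𝗒 * x ∧ 𝖾₂ * (𝖽 * x) = 𝖽 * x ∧ 𝖾₃ * (𝖾₃ * x) = 𝖾₃ * x ∧ 𝖾₃ * (𝗇 * x) = 𝗇 * x ∧
    𝖻 * (𝖾₂ * x) = 𝖻 * x ∧ 𝗒 * (𝖾₁ * x) = 𝗒 * x ∧ 𝖽 * (𝖾₃ * x) = 𝖽 * x ∧ 𝗇 * (𝖾₂ * x) = 𝗇 * x := by
  obtain ⟨h1, h2, h3, h4, h5, h6, h7, h8, h9, h10, h11⟩ := qgen_idem K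
  simp only [← mul_assoc, h1, h2, h3, h4, h5, h6, h7, h8, h9, h10, h11, and_self]

/-- The normal words in the arrows, which form a basis of the algebra. -/
noncomputable def qword : Fin 36 → QuatAlg K := ![
    𝖾₁, 𝖻, 𝖻 * (𝗒), 𝖻 * (𝖽), 𝖻 * (𝖽 * (𝗇)), 𝖻 * (𝖽 * (𝗇 * (𝗒))), 𝖻 * (𝖽 * (𝗇 * (𝗒 * (𝖻)))),
    𝖻 * (𝖽 * (𝗇 * (𝗒 * (𝖻 * (𝖽))))), 𝖻 * (𝗒 * (𝖻)), 𝖻 * (𝗒 * (𝖻 * (𝗒))), 𝖾₂, 𝗒, 𝖽, 𝗒 * (𝖻),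
    𝖽 * (𝗇), 𝗒 * (𝖻 * (𝖽)), 𝖽 * (𝗇 * (𝗒)), 𝗒 * (𝖻 * (𝖽 * (𝗇))), 𝖽 * (𝗇 * (𝗒 * (𝖻))),
    𝗒 * (𝖻 * (𝖽 * (𝗇 * (𝗒)))), 𝖽 * (𝗇 * (𝗒 * (𝖻 * (𝖽)))), 𝗒 * (𝖻 * (𝖽 * (𝗇 * (𝗒 * (𝖻))))),
    𝖽 * (𝗇 * (𝗒 * (𝖻 * (𝖽 * (𝗇))))), 𝖽 * (𝗇 * (𝖽)), 𝗒 * (𝖻 * (𝗒)), 𝗒 * (𝖻 * (𝗒 * (𝖻))), 𝖾₃, 𝗇,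
    𝗇 * (𝖽), 𝗇 * (𝗒), 𝗇 * (𝗒 * (𝖻)), 𝗇 * (𝗒 * (𝖻 * (𝖽))), 𝗇 * (𝗒 * (𝖻 * (𝖽 * (𝗇)))),
    𝗇 * (𝗒 * (𝖻 * (𝖽 * (𝗇 * (𝗒))))), 𝗇 * (𝖽 * (𝗇)), 𝗇 * (𝖽 * (𝗇 * (𝖽)))]

/-- The final vertices of the normal words. -/
def qwordTgt : Fin 36 → Fin 3 := ![0, 1, 0, 2, 1, 0, 1, 2, 1, 0, 1, 0, 2, 1, 1, 2, 0, 1, 1, 0, 2, 1, 1, 2, 0, 1, 2, 1, 2, 0, 1, 2, 1, 0, 1, 2]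

/-- Right multiplication of the normal words by the arrows: the word number `i` times an arrow is
either zero or again a normal word. -/
def qstepArrow : QGen → Fin 36 → Option (Fin 36)
  | ab, i => match i with
    | 0 => some 1 | 2 => some 8 | 5 => some 6 | 11 => some 13 | 16 => some 18
    | 19 => some 21 | 24 => some 25 | 29 => some 30 | 33 => some 34
    | _ => none
  | ay, i => match i with
    | 1 => some 2 | 4 => some 5 | 8 => some 9 | 10 => some 11 | 13 => some 24
    | 14 => some 16 | 17 => some 19 | 22 => some 24 | 27 => some 29 | 32 => some 33
    | _ => none
  | ad, i => match i with
    | 1 => some 3 | 6 => some 7 | 10 => some 12 | 13 => some 15 | 14 => some 23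
    | 18 => some 20 | 21 => some 23 | 27 => some 28 | 30 => some 31 | 34 => some 35
    | _ => none
  | an, i => match i with
    | 3 => some 4 | 7 => some 8 | 12 => some 14 | 15 => some 17 | 20 => some 22
    | 23 => some 25 | 26 => some 27 | 28 => some 34 | 31 => some 32
    | _ => none
  | _, i => some i

/-- Right multiplication of the normal words by the generators. -/
def qstep (g : QGen) (i : Fin 36) : Option (Fin 36) :=
  if qwordTgt i = g.src then qstepArrow g i else none

theorem qword_mul_qidem (i : Fin 36) : qword K i * qidem K (qwordTgt i) = qword K i := by
  fin_cases i <;> simp [qword, qwordTgt, qidem, mul_assoc, qgen_idem]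

theorem qword_mul_qgen (i : Fin 36) (g : QGen) :
    qword K i * qgen K g = (qstep g i).elim 0 (qword K) := by
  rw [qstep]
  split_ifs with h
  · cases g
    · exact (congrArg (qword K i * qidem K ·) h.symm).trans (qword_mul_qidem K i)
    · exact (congrArg (qword K i * qidem K ·) h.symm).trans (qword_mul_qidem K i)
    · exact (congrArg (qword K i * qidem K ·) h.symm).trans (qword_mul_qidem K i)
    all_goals
      fin_cases i <;> first
      | (exfalso; revert h; decide)
      | simp [qword, mul_assoc, qgen_idem, qgen_rules, qgen_rules_assoc, qstepArrow]
  · rw [← qword_mul_qidem, ← qidem_src_mul, mul_assoc, ← mul_assoc (qidem K _), qidem_mul_qidem,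
      if_neg h, zero_mul, mul_zero]
    rfl

theorem qword_mem_span_mul (a : QuatAlg K) :
    ∀ s ∈ Submodule.span K (Set.range (qword K)), s * a ∈ Submodule.span K (Set.range (qword K)) := by
  obtain ⟨p, rfl⟩ := RingQuot.mkAlgHom_surjective K (QuatRel K) a
  induction p using FreeAlgebra.induction with
  | grade0 r =>
    intro s hs
    rw [AlgHom.commutes, ← Algebra.commutes, ← Algebra.smul_def]
    exact Submodule.smul_mem _ _ hs
  | grade1 g =>
    intro s hs
    induction hs using Submodule.span_induction with
    | mem x hx =>
      obtain ⟨i, rfl⟩ := hx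
      change qword K i * qgen K g ∈ _
      rw [qword_mul_qgen]
      cases qstep g i
      · exact zero_mem _
      · exact Submodule.subset_span ⟨_, rfl⟩
    | zero => rw [zero_mul]; exact zero_mem _
    | add x y _ _ hx hy => rw [add_mul]; exact add_mem hx hy
    | smul c x _ hx => rw [smul_mul_assoc]; exact Submodule.smul_mem _ _ hx
  | mul x y hx hy =>
    intro s hs
    rw [map_mul, ← mul_assoc]
    exact hy _ (hx _ hs)
  | add x y hx hy =>
    intro s hs
    rw [map_add, mul_add]
    exact add_mem (hx _ hs) (hy _ hs)

theorem span_range_qword : Submodule.span K (Set.range (qword K)) = ⊤ := by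
  refine eq_top_iff.2 fun a _ => ?_
  rw [← one_mul a]
  refine qword_mem_span_mul K a _ ?_
  rw [← qgen_unit]
  exact add_mem (add_mem (Submodule.subset_span ⟨0, rfl⟩) (Submodule.subset_span ⟨10, rfl⟩))
    (Submodule.subset_span ⟨26, rfl⟩)

/-- The action of a generator in the combinatorial model of the algebra. -/
def qmodelGen (g : QGen) : Module.End K (Fin 36 → K) where
  toFun f i := (qstep g i).elim 0 f
  map_add' f f' := by
    ext i
    simp only [Pi.add_apply]
    cases qstep g i <;> simp
  map_smul' c f := by
    ext i
    simp only [Pi.smul_apply, RingHom.id_apply]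
    cases qstep g i <;> simp

/-- Iterated right multiplication of the normal words by generators. -/
def qrun : List QGen → Fin 36 → Option (Fin 36)
  | [], i => some i
  | g :: l, i => (qstep g i).bind (qrun l)

theorem qmodelGen_prod (l : List QGen) (f : Fin 36 → K) (i : Fin 36) :
    (l.map (qmodelGen K)).prod f i = (qrun l i).elim 0 f := by
  induction l generalizing i with
  | nil => rfl
  | cons g l ih =>
    rw [List.map_cons, List.prod_cons, qrun]
    change (qstep g i).elim 0 _ = _
    cases h : qstep g i with
    | none => rfl
    | some j => exact ih j

theorem qmodelGen_prod_congr (l l' : List QGen) (h : ∀ i, qrun l i = qrun l' i) :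
    (l.map (qmodelGen K)).prod = (l'.map (qmodelGen K)).prod := by
  refine LinearMap.ext fun f => funext fun i => ?_
  rw [qmodelGen_prod, qmodelGen_prod, h]

theorem qmodelGen_prod_eq_zero (l : List QGen) (h : ∀ i, qrun l i = none) :
    (l.map (qmodelGen K)).prod = 0 := by
  refine LinearMap.ext fun f => funext fun i => ?_
  rw [qmodelGen_prod, h]
  rfl

/-- The combinatorial model of the algebra, acting on functions on the set of normal words. -/
noncomputable def qmodel : QuatAlg K →ₐ[K] Module.End K (Fin 36 → K) :=
  RingQuot.liftAlgHom K ⟨FreeAlgebra.lift K (qmodelGen K), by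
    intro p q h
    cases h
    case unit =>
      simp only [map_add, map_one, FreeAlgebra.lift_ι_apply]
      refine LinearMap.ext fun f => funext fun i => ?_
      change (qstep v1 i).elim 0 f + (qstep v2 i).elim 0 f + (qstep v3 i).elim 0 f = f i
      simp only [qstep, QGen.src, qstepArrow]
      generalize qwordTgt i = t
      fin_cases t <;> simp
    all_goals
      simp only [map_mul, map_zero, FreeAlgebra.lift_ι_apply, mul_assoc]
    · exact qmodelGen_prod_congr K [v1, v1] [v1] (by decide)
    · exact qmodelGen_prod_congr K [v2, v2] [v2] (by decide)
    · exact qmodelGen_prod_congr K [v3, v3] [v3] (by decide)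
    · exact qmodelGen_prod_eq_zero K [v1, v2] (by decide)
    · exact qmodelGen_prod_eq_zero K [v2, v1] (by decide)
    · exact qmodelGen_prod_eq_zero K [v1, v3] (by decide)
    · exact qmodelGen_prod_eq_zero K [v3, v1] (by decide)
    · exact qmodelGen_prod_eq_zero K [v2, v3] (by decide)
    · exact qmodelGen_prod_eq_zero K [v3, v2] (by decide)
    · exact qmodelGen_prod_congr K [v1, ab] [ab] (by decide)
    · exact qmodelGen_prod_congr K [ab, v2] [ab] (by decide)
    · exact qmodelGen_prod_congr K [v2, ay] [ay] (by decide)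
    · exact qmodelGen_prod_congr K [ay, v1] [ay] (by decide)
    · exact qmodelGen_prod_congr K [v2, ad] [ad] (by decide)
    · exact qmodelGen_prod_congr K [ad, v3] [ad] (by decide)
    · exact qmodelGen_prod_congr K [v3, an] [an] (by decide)
    · exact qmodelGen_prod_congr K [an, v2] [an] (by decide)
    · exact qmodelGen_prod_congr K [ab, ay, ab] [ab, ad, an, ay, ab, ad, an] (by decide)
    · exact qmodelGen_prod_congr K [ay, ab, ay] [ad, an, ay, ab, ad, an, ay] (by decide)
    · exact qmodelGen_prod_congr K [an, ad, an] [an, ay, ab, ad, an, ay, ab] (by decide)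
    · exact qmodelGen_prod_congr K [ad, an, ad] [ay, ab, ad, an, ay, ab, ad] (by decide)
    · exact qmodelGen_prod_eq_zero K [ab, ay, ab, ad] (by decide)
    · exact qmodelGen_prod_eq_zero K [an, ad, an, ay] (by decide)⟩

theorem qmodel_qgen (g : QGen) : qmodel K (qgen K g) = qmodelGen K g := by
  rw [qmodel, qgen, RingQuot.liftAlgHom_mkAlgHom_apply, FreeAlgebra.lift_ι_apply]

theorem qmodel_qword (j : Fin 36) (f : Fin 36 → K) :
    qmodel K (qword K j) f 0 + qmodel K (qword K j) f 10 + qmodel K (qword K j) f 26 = f j := by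
  induction j using WellFoundedLT.induction generalizing f with
  | ind j ih =>
    by_cases h : j = 0 ∨ j = 10 ∨ j = 26
    · have h1 : qword K 0 = qgen K v1 := rfl
      have h2 : qword K 10 = qgen K v2 := rfl
      have h3 : qword K 26 = qgen K v3 := rfl
      obtain rfl | rfl | rfl := h
      · rw [h1, qmodel_qgen]
        exact (congrArg₂ _ (add_zero _) rfl).trans (add_zero _)
      · rw [h2, qmodel_qgen]
        exact (congrArg₂ _ (zero_add _) rfl).trans (add_zero _)
      · rw [h3, qmodel_qgen]
        exact (congrArg₂ _ (add_zero _) rfl).trans (zero_add _)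
    · have key : ∀ j : Fin 36, ¬ (j = 0 ∨ j = 10 ∨ j = 26) →
          ∃ i < j, ∃ g ∈ [ab, ay, ad, an], qstep g i = some j := by decide
      obtain ⟨i, hij, g, -, hg⟩ := key j h
      have h1 : qword K j = qword K i * qgen K g := by rw [qword_mul_qgen, hg]; rfl
      rw [h1, map_mul, qmodel_qgen]
      refine (ih i hij (qmodelGen K g f)).trans ?_
      change (qstep g i).elim 0 f = f j
      rw [hg]
      rfl

theorem linearIndependent_qword : LinearIndependent K (qword K) := by
  rw [Fintype.linearIndependent_iff]
  intro c hc j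
  have h1 (a : QuatAlg K) (ha : a = 0) : qmodel K a (Pi.single j 1) 0 +
      qmodel K a (Pi.single j 1) 10 + qmodel K a (Pi.single j 1) 26 = 0 := by
    simp [ha]
  have h2 := h1 _ hc
  simp only [map_sum, map_smul, LinearMap.sum_apply, LinearMap.smul_apply, Finset.sum_apply,
    Pi.smul_apply, ← Finset.sum_add_distrib, ← smul_add, qmodel_qword] at h2
  simpa [Pi.single_apply] using h2

/-- The basis of normal words. -/
noncomputable def qbasis : Module.Basis (Fin 36) K (QuatAlg K) :=
  .mk (linearIndependent_qword K) (span_range_qword K).ge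

theorem qbasis_apply (i : Fin 36) : qbasis K i = qword K i := by
  rw [qbasis, Module.Basis.mk_apply]

/-- The coordinate with respect to a normal word. -/
noncomputable def qcoord (i : Fin 36) : QuatAlg K →ₗ[K] K := (qbasis K).coord i

theorem qcoord_qword (i j : Fin 36) : qcoord K i (qword K j) = if j = i then 1 else 0 := by
  rw [qcoord, ← qbasis_apply, Module.Basis.coord_apply, Module.Basis.repr_self,
    Finsupp.single_apply]

theorem sum_qcoord_smul_qword (a : QuatAlg K) : ∑ i, qcoord K i a • qword K i = a := by
  simp only [← qbasis_apply]
  exact (qbasis K).sum_repr a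

instance finite_quatAlg : Module.Finite K (QuatAlg K) := .of_basis (qbasis K)

theorem exists_expansion (a : QuatAlg K) : ∃ c : Fin 36 → K, a = ∑ i, c i • qword K i :=
  ⟨fun i => qcoord K i a, (sum_qcoord_smul_qword K a).symm⟩

theorem qcoord_words (i : Fin 36) :
    qcoord K i 𝖾₁ = (if 0 = i then 1 else 0) ∧ qcoord K i 𝖻 = (if 1 = i then 1 else 0) ∧
    qcoord K i (𝖻 * (𝗒)) = (if 2 = i then 1 else 0) ∧
    qcoord K i (𝖻 * (𝖽)) = (if 3 = i then 1 else 0) ∧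
    qcoord K i (𝖻 * (𝖽 * (𝗇))) = (if 4 = i then 1 else 0) ∧
    qcoord K i (𝖻 * (𝖽 * (𝗇 * (𝗒)))) = (if 5 = i then 1 else 0) ∧
    qcoord K i (𝖻 * (𝖽 * (𝗇 * (𝗒 * (𝖻))))) = (if 6 = i then 1 else 0) ∧
    qcoord K i (𝖻 * (𝖽 * (𝗇 * (𝗒 * (𝖻 * (𝖽)))))) = (if 7 = i then 1 else 0) ∧
    qcoord K i (𝖻 * (𝗒 * (𝖻))) = (if 8 = i then 1 else 0) ∧
    qcoord K i (𝖻 * (𝗒 * (𝖻 * (𝗒)))) = (if 9 = i then 1 else 0) ∧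
    qcoord K i 𝖾₂ = (if 10 = i then 1 else 0) ∧ qcoord K i 𝗒 = (if 11 = i then 1 else 0) ∧
    qcoord K i 𝖽 = (if 12 = i then 1 else 0) ∧ qcoord K i (𝗒 * (𝖻)) = (if 13 = i then 1 else 0) ∧
    qcoord K i (𝖽 * (𝗇)) = (if 14 = i then 1 else 0) ∧
    qcoord K i (𝗒 * (𝖻 * (𝖽))) = (if 15 = i then 1 else 0) ∧
    qcoord K i (𝖽 * (𝗇 * (𝗒))) = (if 16 = i then 1 else 0) ∧
    qcoord K i (𝗒 * (𝖻 * (𝖽 * (𝗇)))) = (if 17 = i then 1 else 0) ∧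
    qcoord K i (𝖽 * (𝗇 * (𝗒 * (𝖻)))) = (if 18 = i then 1 else 0) ∧
    qcoord K i (𝗒 * (𝖻 * (𝖽 * (𝗇 * (𝗒))))) = (if 19 = i then 1 else 0) ∧
    qcoord K i (𝖽 * (𝗇 * (𝗒 * (𝖻 * (𝖽))))) = (if 20 = i then 1 else 0) ∧
    qcoord K i (𝗒 * (𝖻 * (𝖽 * (𝗇 * (𝗒 * (𝖻)))))) = (if 21 = i then 1 else 0) ∧
    qcoord K i (𝖽 * (𝗇 * (𝗒 * (𝖻 * (𝖽 * (𝗇)))))) = (if 22 = i then 1 else 0) ∧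
    qcoord K i (𝖽 * (𝗇 * (𝖽))) = (if 23 = i then 1 else 0) ∧
    qcoord K i (𝗒 * (𝖻 * (𝗒))) = (if 24 = i then 1 else 0) ∧
    qcoord K i (𝗒 * (𝖻 * (𝗒 * (𝖻)))) = (if 25 = i then 1 else 0) ∧
    qcoord K i 𝖾₃ = (if 26 = i then 1 else 0) ∧ qcoord K i 𝗇 = (if 27 = i then 1 else 0) ∧
    qcoord K i (𝗇 * (𝖽)) = (if 28 = i then 1 else 0) ∧
    qcoord K i (𝗇 * (𝗒)) = (if 29 = i then 1 else 0) ∧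
    qcoord K i (𝗇 * (𝗒 * (𝖻))) = (if 30 = i then 1 else 0) ∧
    qcoord K i (𝗇 * (𝗒 * (𝖻 * (𝖽)))) = (if 31 = i then 1 else 0) ∧
    qcoord K i (𝗇 * (𝗒 * (𝖻 * (𝖽 * (𝗇))))) = (if 32 = i then 1 else 0) ∧
    qcoord K i (𝗇 * (𝗒 * (𝖻 * (𝖽 * (𝗇 * (𝗒)))))) = (if 33 = i then 1 else 0) ∧
    qcoord K i (𝗇 * (𝖽 * (𝗇))) = (if 34 = i then 1 else 0) ∧
    qcoord K i (𝗇 * (𝖽 * (𝗇 * (𝖽)))) = (if 35 = i then 1 else 0) :=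
  have h := qcoord_qword K i
  ⟨h 0, h 1, h 2, h 3, h 4, h 5, h 6, h 7, h 8, h 9, h 10, h 11, h 12, h 13, h 14, h 15, h 16, h 17, h 18, h 19, h 20, h 21, h 22, h 23, h 24, h 25, h 26, h 27, h 28, h 29, h 30, h 31, h 32, h 33, h 34, h 35⟩

theorem exists_expansion_left1 (a : QuatAlg K) (h : 𝖾₁ * a = a) :
    ∃ c₀ c₁ c₂ c₃ c₄ c₅ c₆ c₇ c₈ c₉ : K, a = c₀ • 𝖾₁ + c₁ • 𝖻 + c₂ • (𝖻 * (𝗒)) + c₃ • (𝖻 * (𝖽)) +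
    c₄ • (𝖻 * (𝖽 * (𝗇))) + c₅ • (𝖻 * (𝖽 * (𝗇 * (𝗒)))) + c₆ • (𝖻 * (𝖽 * (𝗇 * (𝗒 * (𝖻))))) + c₇ •
    (𝖻 * (𝖽 * (𝗇 * (𝗒 * (𝖻 * (𝖽)))))) + c₈ • (𝖻 * (𝗒 * (𝖻))) + c₉ • (𝖻 * (𝗒 * (𝖻 * (𝗒)))) := by
  obtain ⟨c, hc⟩ := exists_expansion K a
  rw [hc] at h
  refine ⟨c 0, c 1, c 2, c 3, c 4, c 5, c 6, c 7, c 8, c 9, ?_⟩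
  rw [hc, ← h]
  simp [Fin.sum_univ_succ, qword, mul_add, qgen_orthogonal, qgen_orthogonal_assoc, qgen_idem,
    qgen_idem_assoc, add_assoc]

theorem exists_expansion_left2 (a : QuatAlg K) (h : 𝖾₂ * a = a) :
    ∃ c₀ c₁ c₂ c₃ c₄ c₅ c₆ c₇ c₈ c₉ c₁₀ c₁₁ c₁₂ c₁₃ c₁₄ c₁₅ : K, a = c₀ • 𝖾₂ + c₁ • 𝗒 + c₂ • 𝖽 +
    c₃ • (𝗒 * (𝖻)) + c₄ • (𝖽 * (𝗇)) + c₅ • (𝗒 * (𝖻 * (𝖽))) + c₆ • (𝖽 * (𝗇 * (𝗒))) + c₇ • (𝗒 * (𝖻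
    * (𝖽 * (𝗇)))) + c₈ • (𝖽 * (𝗇 * (𝗒 * (𝖻)))) + c₉ • (𝗒 * (𝖻 * (𝖽 * (𝗇 * (𝗒))))) + c₁₀ • (𝖽 * (𝗇
    * (𝗒 * (𝖻 * (𝖽))))) + c₁₁ • (𝗒 * (𝖻 * (𝖽 * (𝗇 * (𝗒 * (𝖻)))))) + c₁₂ • (𝖽 * (𝗇 * (𝗒 * (𝖻 * (𝖽
    * (𝗇)))))) + c₁₃ • (𝖽 * (𝗇 * (𝖽))) + c₁₄ • (𝗒 * (𝖻 * (𝗒))) + c₁₅ • (𝗒 * (𝖻 * (𝗒 * (𝖻)))) := by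
  obtain ⟨c, hc⟩ := exists_expansion K a
  rw [hc] at h
  refine ⟨c 10, c 11, c 12, c 13, c 14, c 15, c 16, c 17, c 18, c 19, c 20, c 21, c 22, c 23, c 24, c 25, ?_⟩
  rw [hc, ← h]
  simp [Fin.sum_univ_succ, qword, mul_add, qgen_orthogonal, qgen_orthogonal_assoc, qgen_idem,
    qgen_idem_assoc, add_assoc]

theorem exists_expansion_left3 (a : QuatAlg K) (h : 𝖾₃ * a = a) :
    ∃ c₀ c₁ c₂ c₃ c₄ c₅ c₆ c₇ c₈ c₉ : K, a = c₀ • 𝖾₃ + c₁ • 𝗇 + c₂ • (𝗇 * (𝖽)) + c₃ • (𝗇 * (𝗒)) +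
    c₄ • (𝗇 * (𝗒 * (𝖻))) + c₅ • (𝗇 * (𝗒 * (𝖻 * (𝖽)))) + c₆ • (𝗇 * (𝗒 * (𝖻 * (𝖽 * (𝗇))))) + c₇ •
    (𝗇 * (𝗒 * (𝖻 * (𝖽 * (𝗇 * (𝗒)))))) + c₈ • (𝗇 * (𝖽 * (𝗇))) + c₉ • (𝗇 * (𝖽 * (𝗇 * (𝖽)))) := by
  obtain ⟨c, hc⟩ := exists_expansion K a
  rw [hc] at h
  refine ⟨c 26, c 27, c 28, c 29, c 30, c 31, c 32, c 33, c 34, c 35, ?_⟩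
  rw [hc, ← h]
  simp [Fin.sum_univ_succ, qword, mul_add, qgen_orthogonal, qgen_orthogonal_assoc, qgen_idem,
    qgen_idem_assoc, add_assoc]

theorem exists_expansion_11 (a : QuatAlg K) (h : 𝖾₁ * a = a) (h' : a * 𝖾₁ = a) :
    ∃ c₀ c₁ c₂ c₃ : K, a = c₀ • 𝖾₁ + c₁ • (𝖻 * (𝗒)) + c₂ • (𝖻 * (𝖽 * (𝗇 * (𝗒)))) + c₃ • (𝖻 * (𝗒 *
    (𝖻 * (𝗒)))) := by
  obtain ⟨c₀, c₁, c₂, c₃, c₄, c₅, c₆, c₇, c₈, c₉, hc⟩ := exists_expansion_left1 K a h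
  rw [hc] at h'
  refine ⟨c₀, c₂, c₅, c₉, ?_⟩
  rw [hc, ← h']
  simp [add_mul, mul_assoc, qgen_orthogonal, qgen_idem]

theorem exists_expansion_12 (a : QuatAlg K) (h : 𝖾₁ * a = a) (h' : a * 𝖾₂ = a) :
    ∃ c₀ c₁ c₂ c₃ : K, a = c₀ • 𝖻 + c₁ • (𝖻 * (𝖽 * (𝗇))) + c₂ • (𝖻 * (𝖽 * (𝗇 * (𝗒 * (𝖻))))) + c₃
    • (𝖻 * (𝗒 * (𝖻))) := by
  obtain ⟨c₀, c₁, c₂, c₃, c₄, c₅, c₆, c₇, c₈, c₉, hc⟩ := exists_expansion_left1 K a h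
  rw [hc] at h'
  refine ⟨c₁, c₄, c₆, c₈, ?_⟩
  rw [hc, ← h']
  simp [add_mul, mul_assoc, qgen_orthogonal, qgen_idem]

theorem exists_expansion_13 (a : QuatAlg K) (h : 𝖾₁ * a = a) (h' : a * 𝖾₃ = a) :
    ∃ c₀ c₁ : K, a = c₀ • (𝖻 * (𝖽)) + c₁ • (𝖻 * (𝖽 * (𝗇 * (𝗒 * (𝖻 * (𝖽)))))) := by
  obtain ⟨c₀, c₁, c₂, c₃, c₄, c₅, c₆, c₇, c₈, c₉, hc⟩ := exists_expansion_left1 K a h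
  rw [hc] at h'
  refine ⟨c₃, c₇, ?_⟩
  rw [hc, ← h']
  simp [add_mul, mul_assoc, qgen_orthogonal, qgen_idem]

theorem exists_expansion_21 (a : QuatAlg K) (h : 𝖾₂ * a = a) (h' : a * 𝖾₁ = a) :
    ∃ c₀ c₁ c₂ c₃ : K, a = c₀ • 𝗒 + c₁ • (𝖽 * (𝗇 * (𝗒))) + c₂ • (𝗒 * (𝖻 * (𝖽 * (𝗇 * (𝗒))))) + c₃
    • (𝗒 * (𝖻 * (𝗒))) := by
  obtain ⟨c₀, c₁, c₂, c₃, c₄, c₅, c₆, c₇, c₈, c₉, c₁₀, c₁₁, c₁₂, c₁₃, c₁₄, c₁₅, hc⟩ := exists_expansion_left2 K a h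
  rw [hc] at h'
  refine ⟨c₁, c₆, c₉, c₁₄, ?_⟩
  rw [hc, ← h']
  simp [add_mul, mul_assoc, qgen_orthogonal, qgen_idem]

theorem exists_expansion_22 (a : QuatAlg K) (h : 𝖾₂ * a = a) (h' : a * 𝖾₂ = a) :
    ∃ c₀ c₁ c₂ c₃ c₄ c₅ c₆ c₇ : K, a = c₀ • 𝖾₂ + c₁ • (𝗒 * (𝖻)) + c₂ • (𝖽 * (𝗇)) + c₃ • (𝗒 * (𝖻 *
    (𝖽 * (𝗇)))) + c₄ • (𝖽 * (𝗇 * (𝗒 * (𝖻)))) + c₅ • (𝗒 * (𝖻 * (𝖽 * (𝗇 * (𝗒 * (𝖻)))))) + c₆ • (𝖽 *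
    (𝗇 * (𝗒 * (𝖻 * (𝖽 * (𝗇)))))) + c₇ • (𝗒 * (𝖻 * (𝗒 * (𝖻)))) := by
  obtain ⟨c₀, c₁, c₂, c₃, c₄, c₅, c₆, c₇, c₈, c₉, c₁₀, c₁₁, c₁₂, c₁₃, c₁₄, c₁₅, hc⟩ := exists_expansion_left2 K a h
  rw [hc] at h'
  refine ⟨c₀, c₃, c₄, c₇, c₈, c₁₁, c₁₂, c₁₅, ?_⟩
  rw [hc, ← h']
  simp [add_mul, mul_assoc, qgen_orthogonal, qgen_idem]

theorem exists_expansion_23 (a : QuatAlg K) (h : 𝖾₂ * a = a) (h' : a * 𝖾₃ = a) :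
    ∃ c₀ c₁ c₂ c₃ : K, a = c₀ • 𝖽 + c₁ • (𝗒 * (𝖻 * (𝖽))) + c₂ • (𝖽 * (𝗇 * (𝗒 * (𝖻 * (𝖽))))) + c₃
    • (𝖽 * (𝗇 * (𝖽))) := by
  obtain ⟨c₀, c₁, c₂, c₃, c₄, c₅, c₆, c₇, c₈, c₉, c₁₀, c₁₁, c₁₂, c₁₃, c₁₄, c₁₅, hc⟩ := exists_expansion_left2 K a h
  rw [hc] at h'
  refine ⟨c₂, c₅, c₁₀, c₁₃, ?_⟩
  rw [hc, ← h']
  simp [add_mul, mul_assoc, qgen_orthogonal, qgen_idem]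

theorem exists_expansion_31 (a : QuatAlg K) (h : 𝖾₃ * a = a) (h' : a * 𝖾₁ = a) :
    ∃ c₀ c₁ : K, a = c₀ • (𝗇 * (𝗒)) + c₁ • (𝗇 * (𝗒 * (𝖻 * (𝖽 * (𝗇 * (𝗒)))))) := by
  obtain ⟨c₀, c₁, c₂, c₃, c₄, c₅, c₆, c₇, c₈, c₉, hc⟩ := exists_expansion_left3 K a h
  rw [hc] at h'
  refine ⟨c₃, c₇, ?_⟩
  rw [hc, ← h']
  simp [add_mul, mul_assoc, qgen_orthogonal, qgen_idem]

theorem exists_expansion_32 (a : QuatAlg K) (h : 𝖾₃ * a = a) (h' : a * 𝖾₂ = a) :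
    ∃ c₀ c₁ c₂ c₃ : K, a = c₀ • 𝗇 + c₁ • (𝗇 * (𝗒 * (𝖻))) + c₂ • (𝗇 * (𝗒 * (𝖻 * (𝖽 * (𝗇))))) + c₃
    • (𝗇 * (𝖽 * (𝗇))) := by
  obtain ⟨c₀, c₁, c₂, c₃, c₄, c₅, c₆, c₇, c₈, c₉, hc⟩ := exists_expansion_left3 K a h
  rw [hc] at h'
  refine ⟨c₁, c₄, c₆, c₈, ?_⟩
  rw [hc, ← h']
  simp [add_mul, mul_assoc, qgen_orthogonal, qgen_idem]

theorem exists_expansion_33 (a : QuatAlg K) (h : 𝖾₃ * a = a) (h' : a * 𝖾₃ = a) :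
    ∃ c₀ c₁ c₂ c₃ : K, a = c₀ • 𝖾₃ + c₁ • (𝗇 * (𝖽)) + c₂ • (𝗇 * (𝗒 * (𝖻 * (𝖽)))) + c₃ • (𝗇 * (𝖽 *
    (𝗇 * (𝖽)))) := by
  obtain ⟨c₀, c₁, c₂, c₃, c₄, c₅, c₆, c₇, c₈, c₉, hc⟩ := exists_expansion_left3 K a h
  rw [hc] at h'
  refine ⟨c₀, c₂, c₅, c₉, ?_⟩
  rw [hc, ← h']
  simp [add_mul, mul_assoc, qgen_orthogonal, qgen_idem]

/-- The symmetrizing form: the sum of the coefficients at the three socle words. -/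
noncomputable def qform : QuatAlg K →ₗ[K] K := qcoord K 9 + qcoord K 25 + qcoord K 35

set_option maxHeartbeats 2000000 in
theorem qform_qgen_mul_qword (g : QGen) (i : Fin 36) :
    qform K (qgen K g * qword K i) = qform K (qword K i * qgen K g) := by
  fin_cases i <;> cases g <;>
  simp [qword, qform, qcoord_words, mul_assoc, qgen_rules, qgen_rules_assoc, qgen_orthogonal,
    qgen_orthogonal_assoc, qgen_idem, qgen_idem_assoc]

theorem qform_mul_comm (a b : QuatAlg K) : qform K (a * b) = qform K (b * a) := by
  obtain ⟨p, rfl⟩ := RingQuot.mkAlgHom_surjective K (QuatRel K) a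
  induction p using FreeAlgebra.induction generalizing b with
  | grade0 r => rw [AlgHom.commutes, Algebra.commutes]
  | grade1 g =>
    change qform K (qgen K g * b) = qform K (b * qgen K g)
    obtain ⟨c, rfl⟩ := exists_expansion K b
    simp only [Finset.mul_sum, Finset.sum_mul, mul_smul_comm, smul_mul_assoc, map_sum, map_smul,
      qform_qgen_mul_qword]
  | add p q hp hq => rw [map_add, add_mul, mul_add, map_add, map_add, hp, hq]
  | mul p q hp hq => rw [map_mul (RingQuot.mkAlgHom K (QuatRel K)), mul_assoc, hp, mul_assoc, hq, mul_assoc]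

theorem eq_zero_of_qform_11 (a : QuatAlg K) (h : 𝖾₁ * a = a) (h' : a * 𝖾₁ = a)
    (H : ∀ b, qform K (a * b) = 0) : a = 0 := by
  obtain ⟨c₀, c₁, c₂, c₃, rfl⟩ := exists_expansion_11 K a h h'
  have h0 := H (𝖾₁)
  have h2 := H (𝖻 * (𝗒))
  have h5 := H (𝖻 * (𝖽 * (𝗇 * (𝗒))))
  have h9 := H (𝖻 * (𝗒 * (𝖻 * (𝗒))))
  clear H h h'
  simp [qform, qcoord_words, add_mul, mul_assoc, qgen_rules, qgen_rules_assoc, qgen_idem, qgen_idem_assoc] at h0 h2 h5 h9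
  simp_all

theorem eq_zero_of_qform_12 (a : QuatAlg K) (h : 𝖾₁ * a = a) (h' : a * 𝖾₂ = a)
    (H : ∀ b, qform K (a * b) = 0) : a = 0 := by
  obtain ⟨c₀, c₁, c₂, c₃, rfl⟩ := exists_expansion_12 K a h h'
  have h11 := H (𝗒)
  have h16 := H (𝖽 * (𝗇 * (𝗒)))
  have h19 := H (𝗒 * (𝖻 * (𝖽 * (𝗇 * (𝗒)))))
  have h24 := H (𝗒 * (𝖻 * (𝗒)))
  clear H h h'
  simp [qform, qcoord_words, add_mul, mul_assoc, qgen_rules, qgen_rules_assoc] at h11 h16 h19 h24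
  simp_all

theorem eq_zero_of_qform_13 (a : QuatAlg K) (h : 𝖾₁ * a = a) (h' : a * 𝖾₃ = a)
    (H : ∀ b, qform K (a * b) = 0) : a = 0 := by
  obtain ⟨c₀, c₁, rfl⟩ := exists_expansion_13 K a h h'
  have h29 := H (𝗇 * (𝗒))
  have h33 := H (𝗇 * (𝗒 * (𝖻 * (𝖽 * (𝗇 * (𝗒))))))
  clear H h h'
  simp [qform, qcoord_words, add_mul, mul_assoc, qgen_rules] at h29 h33
  simp_all

theorem eq_zero_of_qform_21 (a : QuatAlg K) (h : 𝖾₂ * a = a) (h' : a * 𝖾₁ = a)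
    (H : ∀ b, qform K (a * b) = 0) : a = 0 := by
  obtain ⟨c₀, c₁, c₂, c₃, rfl⟩ := exists_expansion_21 K a h h'
  have h1 := H (𝖻)
  have h4 := H (𝖻 * (𝖽 * (𝗇)))
  have h6 := H (𝖻 * (𝖽 * (𝗇 * (𝗒 * (𝖻)))))
  have h8 := H (𝖻 * (𝗒 * (𝖻)))
  clear H h h'
  simp [qform, qcoord_words, add_mul, mul_assoc, qgen_rules, qgen_rules_assoc] at h1 h4 h6 h8
  simp_all

theorem eq_zero_of_qform_22 (a : QuatAlg K) (h : 𝖾₂ * a = a) (h' : a * 𝖾₂ = a)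
    (H : ∀ b, qform K (a * b) = 0) : a = 0 := by
  obtain ⟨c₀, c₁, c₂, c₃, c₄, c₅, c₆, c₇, rfl⟩ := exists_expansion_22 K a h h'
  have h10 := H (𝖾₂)
  have h13 := H (𝗒 * (𝖻))
  have h14 := H (𝖽 * (𝗇))
  have h17 := H (𝗒 * (𝖻 * (𝖽 * (𝗇))))
  have h18 := H (𝖽 * (𝗇 * (𝗒 * (𝖻))))
  have h21 := H (𝗒 * (𝖻 * (𝖽 * (𝗇 * (𝗒 * (𝖻))))))
  have h22 := H (𝖽 * (𝗇 * (𝗒 * (𝖻 * (𝖽 * (𝗇))))))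
  have h25 := H (𝗒 * (𝖻 * (𝗒 * (𝖻))))
  clear H h h'
  simp [qform, qcoord_words, add_mul, mul_assoc, qgen_rules, qgen_rules_assoc, qgen_idem, qgen_idem_assoc] at h10 h13 h14 h17 h18 h21 h22 h25
  simp_all

theorem eq_zero_of_qform_23 (a : QuatAlg K) (h : 𝖾₂ * a = a) (h' : a * 𝖾₃ = a)
    (H : ∀ b, qform K (a * b) = 0) : a = 0 := by
  obtain ⟨c₀, c₁, c₂, c₃, rfl⟩ := exists_expansion_23 K a h h'
  have h27 := H (𝗇)
  have h30 := H (𝗇 * (𝗒 * (𝖻)))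
  have h32 := H (𝗇 * (𝗒 * (𝖻 * (𝖽 * (𝗇)))))
  have h34 := H (𝗇 * (𝖽 * (𝗇)))
  clear H h h'
  simp [qform, qcoord_words, add_mul, mul_assoc, qgen_rules, qgen_rules_assoc] at h27 h30 h32 h34
  simp_all

theorem eq_zero_of_qform_31 (a : QuatAlg K) (h : 𝖾₃ * a = a) (h' : a * 𝖾₁ = a)
    (H : ∀ b, qform K (a * b) = 0) : a = 0 := by
  obtain ⟨c₀, c₁, rfl⟩ := exists_expansion_31 K a h h'
  have h3 := H (𝖻 * (𝖽))
  have h7 := H (𝖻 * (𝖽 * (𝗇 * (𝗒 * (𝖻 * (𝖽))))))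
  clear H h h'
  simp [qform, qcoord_words, add_mul, mul_assoc, qgen_rules, qgen_rules_assoc] at h3 h7
  simp_all

theorem eq_zero_of_qform_32 (a : QuatAlg K) (h : 𝖾₃ * a = a) (h' : a * 𝖾₂ = a)
    (H : ∀ b, qform K (a * b) = 0) : a = 0 := by
  obtain ⟨c₀, c₁, c₂, c₃, rfl⟩ := exists_expansion_32 K a h h'
  have h12 := H (𝖽)
  have h15 := H (𝗒 * (𝖻 * (𝖽)))
  have h20 := H (𝖽 * (𝗇 * (𝗒 * (𝖻 * (𝖽)))))
  have h23 := H (𝖽 * (𝗇 * (𝖽)))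
  clear H h h'
  simp [qform, qcoord_words, add_mul, mul_assoc, qgen_rules, qgen_rules_assoc] at h12 h15 h20 h23
  simp_all

theorem eq_zero_of_qform_33 (a : QuatAlg K) (h : 𝖾₃ * a = a) (h' : a * 𝖾₃ = a)
    (H : ∀ b, qform K (a * b) = 0) : a = 0 := by
  obtain ⟨c₀, c₁, c₂, c₃, rfl⟩ := exists_expansion_33 K a h h'
  have h26 := H (𝖾₃)
  have h28 := H (𝗇 * (𝖽))
  have h31 := H (𝗇 * (𝗒 * (𝖻 * (𝖽))))
  have h35 := H (𝗇 * (𝖽 * (𝗇 * (𝖽))))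
  clear H h h'
  simp [qform, qcoord_words, add_mul, mul_assoc, qgen_rules, qgen_rules_assoc, qgen_idem, qgen_idem_assoc] at h26 h28 h31 h35
  simp_all

theorem eq_zero_of_corners (a : QuatAlg K)
    (H : ∀ i j, qidem K i * a * qidem K j = 0) : a = 0 := by
  have h : a = (𝖾₁ + 𝖾₂ + 𝖾₃) * a * (𝖾₁ + 𝖾₂ + 𝖾₃) := by rw [qgen_unit, one_mul, mul_one]
  have := fun i j => H i j
  simp only [Fin.forall_fin_succ, qidem, IsEmpty.forall_iff] at this
  simp at this
  rw [h]
  simp [add_mul, mul_add, this]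

theorem isSymmetrizing_qform : IsSymmetrizing (qform K) where
  symm := qform_mul_comm K
  nondeg a H := by
    refine eq_zero_of_corners K a fun i j => ?_
    have H' : ∀ b, qform K (qidem K i * a * qidem K j * b) = 0 := fun b => by
      rw [mul_assoc, mul_assoc, qform_mul_comm, mul_assoc, H]
    have hi : qidem K i * (qidem K i * a * qidem K j) = qidem K i * a * qidem K j := by
      rw [← mul_assoc, ← mul_assoc, qidem_mul_qidem, if_pos rfl]
    have hj : qidem K i * a * qidem K j * qidem K j = qidem K i * a * qidem K j := by
      rw [mul_assoc _ (qidem K j), qidem_mul_qidem, if_pos rfl]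
    fin_cases i <;> fin_cases j
    · exact eq_zero_of_qform_11 K _ hi hj H'
    · exact eq_zero_of_qform_12 K _ hi hj H'
    · exact eq_zero_of_qform_13 K _ hi hj H'
    · exact eq_zero_of_qform_21 K _ hi hj H'
    · exact eq_zero_of_qform_22 K _ hi hj H'
    · exact eq_zero_of_qform_23 K _ hi hj H'
    · exact eq_zero_of_qform_31 K _ hi hj H'
    · exact eq_zero_of_qform_32 K _ hi hj H'
    · exact eq_zero_of_qform_33 K _ hi hj H'

theorem qneg_mul : (∀ a b : QuatAlg K, -a * b = -(a * b)) ∧ ∀ a b : QuatAlg K, a * -b = -(a * b) :=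
  ⟨fun a b => neg_mul a b, fun a b => mul_neg a b⟩

theorem exists_eq_n_mul (x : QuatAlg K) (h0 : 𝖾₃ * x = x) (H0 : (𝗇 * (𝖽 * (𝗇 * 𝖽))) * x = 0) :
    ∃ z, x = 𝗇 * z := by
  obtain ⟨c₀, c₁, c₂, c₃, c₄, c₅, c₆, c₇, c₈, c₉, rfl⟩ := exists_expansion_left3 K x h0
  simp only [mul_assoc, mul_add, mul_smul_comm, mul_zero, smul_zero, add_zero, qgen_rules,
    qgen_rules_assoc, qgen_idem] at H0
  obtain rfl : c₀ = 0 := by simpa [qcoord_words] using congrArg (qcoord K 35) H0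
  refine ⟨c₁ • 𝖾₂ + c₃ • 𝗒 + c₂ • 𝖽 + c₄ • (𝗒 * 𝖻) + c₈ • (𝖽 * 𝗇) + c₅ • (𝗒 * (𝖻 * 𝖽)) + c₆ • (𝗒
  * (𝖻 * (𝖽 * 𝗇))) + c₇ • (𝗒 * (𝖻 * (𝖽 * (𝗇 * 𝗒)))) + c₉ • (𝖽 * (𝗇 * 𝖽)), ?_⟩
  simp only [mul_add, mul_smul_comm, zero_add, qgen_idem, zero_smul]
  module

theorem exists_eq_dn_sub_ybdnyb_mul (x : QuatAlg K) (h0 : 𝖾₂ * x = x) (H0 : 𝗇 * x = 0) : ∃ z,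
    x = (𝖽 * 𝗇 - 𝗒 * (𝖻 * (𝖽 * (𝗇 * (𝗒 * 𝖻))))) * z := by
  obtain ⟨c₀, c₁, c₂, c₃, c₄, c₅, c₆, c₇, c₈, c₉, c₁₀, c₁₁, c₁₂, c₁₃, c₁₄, c₁₅, rfl⟩ := exists_expansion_left2 K x h0
  simp only [mul_add, mul_smul_comm, smul_zero, add_zero, qgen_rules, qgen_rules_assoc,
    qgen_idem] at H0
  obtain rfl : c₀ = 0 := by simpa [qcoord_words] using congrArg (qcoord K 27) H0
  obtain rfl : c₂ = 0 := by simpa [qcoord_words] using congrArg (qcoord K 28) H0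
  obtain rfl : c₁ = 0 := by simpa [qcoord_words] using congrArg (qcoord K 29) H0
  obtain rfl : c₃ = 0 := by simpa [qcoord_words] using congrArg (qcoord K 30) H0
  obtain rfl : c₅ = 0 := by simpa [qcoord_words] using congrArg (qcoord K 31) H0
  obtain rfl : c₇ = 0 := by simpa [qcoord_words] using congrArg (qcoord K 32) H0
  obtain rfl : c₉ = 0 := by simpa [qcoord_words] using congrArg (qcoord K 33) H0
  obtain rfl : c₁₃ = 0 := by simpa [qcoord_words] using congrArg (qcoord K 35) H0
  obtain rfl : -c₄ = c₁₁ := by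
    linear_combination (norm := skip) -congrArg (qcoord K 34) H0
    simp [qcoord_words]
  refine ⟨c₄ • 𝖾₂ + c₆ • 𝗒 + c₈ • (𝗒 * 𝖻) + c₁₀ • (𝗒 * (𝖻 * 𝖽)) + c₁₂ • (𝗒 * (𝖻 * (𝖽 * 𝗇))) + c₁₄
  • (𝗒 * (𝖻 * (𝖽 * (𝗇 * 𝗒)))) + c₁₅ • (𝗒 * (𝖻 * (𝖽 * (𝗇 * (𝗒 * 𝖻))))), ?_⟩
  simp only [mul_assoc, mul_add, sub_mul, mul_smul_comm, mul_zero, add_zero, zero_add, sub_zero,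
    qgen_rules, qgen_rules_assoc, qgen_idem, zero_smul]
  module

theorem exists_eq_d_mul (x : QuatAlg K) (h0 : 𝖾₂ * x = x) (H0 : (𝖽 * 𝗇 - 𝗒 * (𝖻 * (𝖽 * (𝗇 *
    (𝗒 * 𝖻))))) * x = 0) : ∃ z, x = 𝖽 * z := by
  obtain ⟨c₀, c₁, c₂, c₃, c₄, c₅, c₆, c₇, c₈, c₉, c₁₀, c₁₁, c₁₂, c₁₃, c₁₄, c₁₅, rfl⟩ := exists_expansion_left2 K x h0
  simp only [mul_assoc, mul_add, sub_mul, mul_smul_comm, mul_zero, smul_zero, add_zero, sub_zero,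
    qgen_rules, qgen_rules_assoc, qgen_idem] at H0
  obtain rfl : c₀ = 0 := by simpa [qcoord_words] using congrArg (qcoord K 14) H0
  obtain rfl : c₁ = 0 := by simpa [qcoord_words] using congrArg (qcoord K 16) H0
  obtain rfl : c₃ = 0 := by simpa [qcoord_words] using congrArg (qcoord K 18) H0
  obtain rfl : c₅ = 0 := by simpa [qcoord_words] using congrArg (qcoord K 20) H0
  obtain rfl : c₇ = 0 := by simpa [qcoord_words] using congrArg (qcoord K 22) H0
  obtain rfl : c₉ = 0 := by simpa [qcoord_words] using congrArg (qcoord K 24) H0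
  obtain rfl : c₁₁ = 0 := by simpa [qcoord_words] using congrArg (qcoord K 25) H0
  refine ⟨c₂ • 𝖾₃ + c₄ • 𝗇 + c₁₃ • (𝗇 * 𝖽) + c₆ • (𝗇 * 𝗒) + c₈ • (𝗇 * (𝗒 * 𝖻)) + c₁₀ • (𝗇 * (𝗒 *
  (𝖻 * 𝖽))) + c₁₂ • (𝗇 * (𝗒 * (𝖻 * (𝖽 * 𝗇)))) + c₁₄ • (𝗇 * (𝗒 * (𝖻 * (𝖽 * (𝗇 * 𝗒))))) + c₁₅ • (𝗇
  * (𝖽 * 𝗇)), ?_⟩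
  simp only [mul_add, mul_smul_comm, add_zero, zero_add, qgen_rules, qgen_idem, zero_smul]
  module

theorem exists_eq_ndnd_mul (x : QuatAlg K) (h0 : 𝖾₃ * x = x) (H0 : 𝖽 * x = 0) : ∃ z, x = (𝗇 *
    (𝖽 * (𝗇 * 𝖽))) * z := by
  obtain ⟨c₀, c₁, c₂, c₃, c₄, c₅, c₆, c₇, c₈, c₉, rfl⟩ := exists_expansion_left3 K x h0
  simp only [mul_add, mul_smul_comm, mul_zero, smul_zero, add_zero, qgen_rules, qgen_rules_assoc,
    qgen_idem] at H0
  obtain rfl : c₀ = 0 := by simpa [qcoord_words] using congrArg (qcoord K 12) H0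
  obtain rfl : c₁ = 0 := by simpa [qcoord_words] using congrArg (qcoord K 14) H0
  obtain rfl : c₃ = 0 := by simpa [qcoord_words] using congrArg (qcoord K 16) H0
  obtain rfl : c₄ = 0 := by simpa [qcoord_words] using congrArg (qcoord K 18) H0
  obtain rfl : c₅ = 0 := by simpa [qcoord_words] using congrArg (qcoord K 20) H0
  obtain rfl : c₆ = 0 := by simpa [qcoord_words] using congrArg (qcoord K 22) H0
  obtain rfl : c₂ = 0 := by simpa [qcoord_words] using congrArg (qcoord K 23) H0
  obtain rfl : c₇ = 0 := by simpa [qcoord_words] using congrArg (qcoord K 24) H0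
  obtain rfl : c₈ = 0 := by simpa [qcoord_words] using congrArg (qcoord K 25) H0
  refine ⟨c₉ • 𝖾₃, ?_⟩
  simp only [mul_assoc, mul_smul_comm, add_zero, zero_add, qgen_idem, zero_smul]

theorem exists_eq_ny_mul (x : QuatAlg K) (h0 : 𝖾₃ * x = x) (H0 : (𝗇 * 𝖽) * x = 0) : ∃ z, x =
    (𝗇 * 𝗒) * z := by
  obtain ⟨c₀, c₁, c₂, c₃, c₄, c₅, c₆, c₇, c₈, c₉, rfl⟩ := exists_expansion_left3 K x h0
  simp only [mul_assoc, mul_add, mul_smul_comm, mul_zero, smul_zero, add_zero, qgen_rules,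
    qgen_rules_assoc, qgen_idem] at H0
  obtain rfl : c₀ = 0 := by simpa [qcoord_words] using congrArg (qcoord K 28) H0
  obtain rfl : c₁ = 0 := by simpa [qcoord_words] using congrArg (qcoord K 34) H0
  obtain rfl : c₂ = 0 := by simpa [qcoord_words] using congrArg (qcoord K 35) H0
  refine ⟨c₃ • 𝖾₁ + c₄ • 𝖻 + c₅ • (𝖻 * 𝖽) + c₆ • (𝖻 * (𝖽 * 𝗇)) + c₇ • (𝖻 * (𝖽 * (𝗇 * 𝗒))) + c₈ •
  (𝖻 * (𝖽 * (𝗇 * (𝗒 * 𝖻)))) + c₉ • (𝖻 * (𝖽 * (𝗇 * (𝗒 * (𝖻 * 𝖽))))), ?_⟩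
  simp only [mul_assoc, mul_add, mul_smul_comm, add_zero, zero_add, qgen_rules, qgen_idem,
    zero_smul]

theorem exists_eq_by_mul (x : QuatAlg K) (h0 : 𝖾₁ * x = x) (H0 : (𝗇 * 𝗒) * x = 0) : ∃ z, x =
    (𝖻 * 𝗒) * z := by
  obtain ⟨c₀, c₁, c₂, c₃, c₄, c₅, c₆, c₇, c₈, c₉, rfl⟩ := exists_expansion_left1 K x h0
  simp only [mul_assoc, mul_add, mul_smul_comm, mul_zero, smul_zero, add_zero, qgen_rules,
    qgen_rules_assoc, qgen_idem] at H0
  obtain rfl : c₀ = 0 := by simpa [qcoord_words] using congrArg (qcoord K 29) H0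
  obtain rfl : c₁ = 0 := by simpa [qcoord_words] using congrArg (qcoord K 30) H0
  obtain rfl : c₃ = 0 := by simpa [qcoord_words] using congrArg (qcoord K 31) H0
  obtain rfl : c₄ = 0 := by simpa [qcoord_words] using congrArg (qcoord K 32) H0
  obtain rfl : c₅ = 0 := by simpa [qcoord_words] using congrArg (qcoord K 33) H0
  obtain rfl : c₆ = 0 := by simpa [qcoord_words] using congrArg (qcoord K 34) H0
  obtain rfl : c₇ = 0 := by simpa [qcoord_words] using congrArg (qcoord K 35) H0
  refine ⟨c₂ • 𝖾₁ + c₈ • 𝖻 + c₉ • (𝖻 * 𝗒), ?_⟩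
  simp only [mul_assoc, mul_add, mul_smul_comm, add_zero, zero_add, qgen_idem, zero_smul]

theorem exists_eq_bd_mul (x : QuatAlg K) (h0 : 𝖾₁ * x = x) (H0 : (𝖻 * 𝗒) * x = 0) : ∃ z, x =
    (𝖻 * 𝖽) * z := by
  obtain ⟨c₀, c₁, c₂, c₃, c₄, c₅, c₆, c₇, c₈, c₉, rfl⟩ := exists_expansion_left1 K x h0
  simp only [mul_assoc, mul_add, mul_smul_comm, mul_zero, smul_zero, add_zero, qgen_rules,
    qgen_rules_assoc, qgen_idem] at H0
  obtain rfl : c₀ = 0 := by simpa [qcoord_words] using congrArg (qcoord K 2) H0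
  obtain rfl : c₁ = 0 := by simpa [qcoord_words] using congrArg (qcoord K 8) H0
  obtain rfl : c₂ = 0 := by simpa [qcoord_words] using congrArg (qcoord K 9) H0
  refine ⟨c₃ • 𝖾₃ + c₄ • 𝗇 + c₅ • (𝗇 * 𝗒) + c₆ • (𝗇 * (𝗒 * 𝖻)) + c₇ • (𝗇 * (𝗒 * (𝖻 * 𝖽))) + c₈ •
  (𝗇 * (𝗒 * (𝖻 * (𝖽 * 𝗇)))) + c₉ • (𝗇 * (𝗒 * (𝖻 * (𝖽 * (𝗇 * 𝗒))))), ?_⟩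
  simp only [mul_assoc, mul_add, mul_smul_comm, add_zero, zero_add, qgen_rules, qgen_idem,
    zero_smul]

theorem exists_eq_nd_mul (x : QuatAlg K) (h0 : 𝖾₃ * x = x) (H0 : (𝖻 * 𝖽) * x = 0) : ∃ z, x =
    (𝗇 * 𝖽) * z := by
  obtain ⟨c₀, c₁, c₂, c₃, c₄, c₅, c₆, c₇, c₈, c₉, rfl⟩ := exists_expansion_left3 K x h0
  simp only [mul_assoc, mul_add, mul_smul_comm, mul_zero, smul_zero, add_zero, qgen_rules,
    qgen_rules_assoc, qgen_idem] at H0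
  obtain rfl : c₀ = 0 := by simpa [qcoord_words] using congrArg (qcoord K 3) H0
  obtain rfl : c₁ = 0 := by simpa [qcoord_words] using congrArg (qcoord K 4) H0
  obtain rfl : c₃ = 0 := by simpa [qcoord_words] using congrArg (qcoord K 5) H0
  obtain rfl : c₄ = 0 := by simpa [qcoord_words] using congrArg (qcoord K 6) H0
  obtain rfl : c₅ = 0 := by simpa [qcoord_words] using congrArg (qcoord K 7) H0
  obtain rfl : c₆ = 0 := by simpa [qcoord_words] using congrArg (qcoord K 8) H0
  obtain rfl : c₇ = 0 := by simpa [qcoord_words] using congrArg (qcoord K 9) H0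
  refine ⟨c₂ • 𝖾₃ + c₈ • 𝗇 + c₉ • (𝗇 * 𝖽), ?_⟩
  simp only [mul_assoc, mul_add, mul_smul_comm, add_zero, zero_add, qgen_idem, zero_smul]

theorem exists_eq_y_mul (x : QuatAlg K) (h0 : 𝖾₂ * x = x) (H0 : (𝗒 * 𝖻 - 𝖽 * (𝗇 * (𝗒 * (𝖻 *
    (𝖽 * 𝗇))))) * x = 0) : ∃ z, x = 𝗒 * z := by
  obtain ⟨c₀, c₁, c₂, c₃, c₄, c₅, c₆, c₇, c₈, c₉, c₁₀, c₁₁, c₁₂, c₁₃, c₁₄, c₁₅, rfl⟩ := exists_expansion_left2 K x h0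
  simp only [mul_assoc, mul_add, sub_mul, mul_smul_comm, mul_zero, smul_zero, add_zero, sub_zero,
    qgen_rules, qgen_rules_assoc, qgen_idem] at H0
  obtain rfl : c₀ = 0 := by simpa [qcoord_words] using congrArg (qcoord K 13) H0
  obtain rfl : c₂ = 0 := by simpa [qcoord_words] using congrArg (qcoord K 15) H0
  obtain rfl : c₄ = 0 := by simpa [qcoord_words] using congrArg (qcoord K 17) H0
  obtain rfl : c₆ = 0 := by simpa [qcoord_words] using congrArg (qcoord K 19) H0
  obtain rfl : c₈ = 0 := by simpa [qcoord_words] using congrArg (qcoord K 21) H0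
  obtain rfl : c₁₀ = 0 := by simpa [qcoord_words] using congrArg (qcoord K 23) H0
  obtain rfl : c₁₂ = 0 := by simpa [qcoord_words] using congrArg (qcoord K 25) H0
  refine ⟨c₁ • 𝖾₁ + c₃ • 𝖻 + c₁₄ • (𝖻 * 𝗒) + c₅ • (𝖻 * 𝖽) + c₇ • (𝖻 * (𝖽 * 𝗇)) + c₉ • (𝖻 * (𝖽 *
  (𝗇 * 𝗒))) + c₁₁ • (𝖻 * (𝖽 * (𝗇 * (𝗒 * 𝖻)))) + c₁₃ • (𝖻 * (𝖽 * (𝗇 * (𝗒 * (𝖻 * 𝖽))))) + c₁₅ • (𝖻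
  * (𝗒 * 𝖻)), ?_⟩
  simp only [mul_add, mul_smul_comm, add_zero, zero_add, qgen_rules, qgen_idem, zero_smul]
  module

theorem exists_eq_byby_mul (x : QuatAlg K) (h0 : 𝖾₁ * x = x) (H0 : 𝗒 * x = 0) : ∃ z, x = (𝖻 *
    (𝗒 * (𝖻 * 𝗒))) * z := by
  obtain ⟨c₀, c₁, c₂, c₃, c₄, c₅, c₆, c₇, c₈, c₉, rfl⟩ := exists_expansion_left1 K x h0
  simp only [mul_add, mul_smul_comm, smul_zero, add_zero, qgen_rules, qgen_idem] at H0
  obtain rfl : c₀ = 0 := by simpa [qcoord_words] using congrArg (qcoord K 11) H0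
  obtain rfl : c₁ = 0 := by simpa [qcoord_words] using congrArg (qcoord K 13) H0
  obtain rfl : c₃ = 0 := by simpa [qcoord_words] using congrArg (qcoord K 15) H0
  obtain rfl : c₄ = 0 := by simpa [qcoord_words] using congrArg (qcoord K 17) H0
  obtain rfl : c₅ = 0 := by simpa [qcoord_words] using congrArg (qcoord K 19) H0
  obtain rfl : c₆ = 0 := by simpa [qcoord_words] using congrArg (qcoord K 21) H0
  obtain rfl : c₇ = 0 := by simpa [qcoord_words] using congrArg (qcoord K 23) H0
  obtain rfl : c₂ = 0 := by simpa [qcoord_words] using congrArg (qcoord K 24) H0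
  obtain rfl : c₈ = 0 := by simpa [qcoord_words] using congrArg (qcoord K 25) H0
  refine ⟨c₉ • 𝖾₁, ?_⟩
  simp only [mul_assoc, mul_smul_comm, add_zero, zero_add, qgen_idem, zero_smul]

theorem exists_eq_b_mul (x : QuatAlg K) (h0 : 𝖾₁ * x = x) (H0 : (𝖻 * (𝗒 * (𝖻 * 𝗒))) * x = 0) :
    ∃ z, x = 𝖻 * z := by
  obtain ⟨c₀, c₁, c₂, c₃, c₄, c₅, c₆, c₇, c₈, c₉, rfl⟩ := exists_expansion_left1 K x h0
  simp only [mul_assoc, mul_add, mul_smul_comm, mul_zero, smul_zero, add_zero, qgen_rules,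
    qgen_rules_assoc, qgen_idem] at H0
  obtain rfl : c₀ = 0 := by simpa [qcoord_words] using congrArg (qcoord K 9) H0
  refine ⟨c₁ • 𝖾₂ + c₂ • 𝗒 + c₃ • 𝖽 + c₈ • (𝗒 * 𝖻) + c₄ • (𝖽 * 𝗇) + c₅ • (𝖽 * (𝗇 * 𝗒)) + c₆ • (𝖽
  * (𝗇 * (𝗒 * 𝖻))) + c₇ • (𝖽 * (𝗇 * (𝗒 * (𝖻 * 𝖽)))) + c₉ • (𝗒 * (𝖻 * 𝗒)), ?_⟩
  simp only [mul_add, mul_smul_comm, zero_add, qgen_idem, zero_smul]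
  module

theorem exists_eq_yb_sub_dnybdn_mul (x : QuatAlg K) (h0 : 𝖾₂ * x = x) (H0 : 𝖻 * x = 0) : ∃ z,
    x = (𝗒 * 𝖻 - 𝖽 * (𝗇 * (𝗒 * (𝖻 * (𝖽 * 𝗇))))) * z := by
  obtain ⟨c₀, c₁, c₂, c₃, c₄, c₅, c₆, c₇, c₈, c₉, c₁₀, c₁₁, c₁₂, c₁₃, c₁₄, c₁₅, rfl⟩ := exists_expansion_left2 K x h0
  simp only [mul_add, mul_smul_comm, smul_zero, add_zero, qgen_rules, qgen_rules_assoc,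
    qgen_idem] at H0
  obtain rfl : c₀ = 0 := by simpa [qcoord_words] using congrArg (qcoord K 1) H0
  obtain rfl : c₁ = 0 := by simpa [qcoord_words] using congrArg (qcoord K 2) H0
  obtain rfl : c₂ = 0 := by simpa [qcoord_words] using congrArg (qcoord K 3) H0
  obtain rfl : c₄ = 0 := by simpa [qcoord_words] using congrArg (qcoord K 4) H0
  obtain rfl : c₆ = 0 := by simpa [qcoord_words] using congrArg (qcoord K 5) H0
  obtain rfl : c₈ = 0 := by simpa [qcoord_words] using congrArg (qcoord K 6) H0
  obtain rfl : c₁₀ = 0 := by simpa [qcoord_words] using congrArg (qcoord K 7) H0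
  obtain rfl : c₁₄ = 0 := by simpa [qcoord_words] using congrArg (qcoord K 9) H0
  obtain rfl : -c₃ = c₁₂ := by
    linear_combination (norm := skip) -congrArg (qcoord K 8) H0
    simp [qcoord_words]
  refine ⟨c₃ • 𝖾₂ + c₅ • 𝖽 + c₇ • (𝖽 * 𝗇) + c₉ • (𝖽 * (𝗇 * 𝗒)) + c₁₁ • (𝖽 * (𝗇 * (𝗒 * 𝖻))) + c₁₃
  • (𝖽 * (𝗇 * (𝗒 * (𝖻 * 𝖽)))) + c₁₅ • (𝖽 * (𝗇 * (𝗒 * (𝖻 * (𝖽 * 𝗇))))), ?_⟩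
  simp only [mul_assoc, mul_add, sub_mul, mul_smul_comm, mul_zero, add_zero, zero_add, sub_zero,
    qgen_rules, qgen_rules_assoc, qgen_idem, zero_smul]
  module

theorem exists_eq_nybdny_mul (x : QuatAlg K) (h0 : 𝖾₃ * x = x) (H0 : (𝗒 * (𝖻 * 𝖽)) * x = 0)
    (H1 : (𝗇 * 𝖽) * x = 0) : ∃ z, x = (𝗇 * (𝗒 * (𝖻 * (𝖽 * (𝗇 * 𝗒))))) * z := by
  obtain ⟨c₀, c₁, c₂, c₃, c₄, c₅, c₆, c₇, c₈, c₉, rfl⟩ := exists_expansion_left3 K x h0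
  simp only [mul_assoc, mul_add, mul_smul_comm, mul_zero, smul_zero, add_zero, qgen_rules, qgen_rules_assoc,
    qgen_idem] at H0 H1
  obtain rfl : c₀ = 0 := by simpa [qcoord_words] using congrArg (qcoord K 15) H0
  obtain rfl : c₁ = 0 := by simpa [qcoord_words] using congrArg (qcoord K 17) H0
  obtain rfl : c₃ = 0 := by simpa [qcoord_words] using congrArg (qcoord K 19) H0
  obtain rfl : c₄ = 0 := by simpa [qcoord_words] using congrArg (qcoord K 21) H0
  obtain rfl : c₅ = 0 := by simpa [qcoord_words] using congrArg (qcoord K 23) H0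
  obtain rfl : c₆ = 0 := by simpa [qcoord_words] using congrArg (qcoord K 25) H0
  obtain rfl : c₂ = 0 := by simpa [qcoord_words] using congrArg (qcoord K 35) H1
  refine ⟨c₇ • 𝖾₁ + c₈ • 𝖻 + c₉ • (𝖻 * 𝖽), ?_⟩
  simp only [mul_assoc, mul_add, mul_smul_comm, add_zero, zero_add, qgen_rules, qgen_idem,
    zero_smul]

theorem exists_eq_by_bdn_mul (x : QuatAlg K) (h0 : 𝖾₁ * x = x) (H0 : (𝗇 * (𝗒 * (𝖻 * (𝖽 * (𝗇 *
    𝗒))))) * x = 0) : ∃ z w, x = (𝖻 * 𝗒) * z + (𝖻 * (𝖽 * 𝗇)) * w := by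
  obtain ⟨c₀, c₁, c₂, c₃, c₄, c₅, c₆, c₇, c₈, c₉, rfl⟩ := exists_expansion_left1 K x h0
  simp only [mul_assoc, mul_add, mul_smul_comm, mul_zero, smul_zero, add_zero, qgen_rules,
    qgen_rules_assoc, qgen_idem] at H0
  obtain rfl : c₀ = 0 := by simpa [qcoord_words] using congrArg (qcoord K 33) H0
  obtain rfl : c₁ = 0 := by simpa [qcoord_words] using congrArg (qcoord K 34) H0
  obtain rfl : c₃ = 0 := by simpa [qcoord_words] using congrArg (qcoord K 35) H0
  refine ⟨c₂ • 𝖾₁ + c₈ • 𝖻 + c₉ • (𝖻 * 𝗒), c₄ • 𝖾₂ + c₅ • 𝗒 + c₆ • (𝗒 * 𝖻) + c₇ • (𝗒 * (𝖻 * 𝖽)),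
  ?_⟩
  simp only [mul_assoc, mul_add, mul_smul_comm, add_zero, zero_add, qgen_idem, zero_smul]
  module

theorem exists_eq_b_neg_ybdn_d_mul (x y : QuatAlg K) (h0 : 𝖾₁ * x = x) (h1 : 𝖾₂ * y = y) (H0
    : (𝖻 * 𝗒) * x + (𝖻 * (𝖽 * 𝗇)) * y = 0) : ∃ z w, x = 𝖻 * z ∧ y = (-𝗒 * (𝖻 * (𝖽 * 𝗇))) * z + 𝖽
    * w := by
  obtain ⟨c₀, c₁, c₂, c₃, c₄, c₅, c₆, c₇, c₈, c₉, rfl⟩ := exists_expansion_left1 K x h0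
  obtain ⟨c₁₀, c₁₁, c₁₂, c₁₃, c₁₄, c₁₅, c₁₆, c₁₇, c₁₈, c₁₉, c₂₀, c₂₁, c₂₂, c₂₃, c₂₄, c₂₅, rfl⟩ := exists_expansion_left2 K y h1
  simp only [mul_assoc, mul_add, mul_smul_comm, mul_zero, smul_zero, add_zero, qgen_rules,
    qgen_rules_assoc, qgen_idem] at H0
  obtain rfl : c₀ = 0 := by simpa [qcoord_words] using congrArg (qcoord K 2) H0
  obtain rfl : c₁₀ = 0 := by simpa [qcoord_words] using congrArg (qcoord K 4) H0
  obtain rfl : c₁₁ = 0 := by simpa [qcoord_words] using congrArg (qcoord K 5) H0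
  obtain rfl : c₁₃ = 0 := by simpa [qcoord_words] using congrArg (qcoord K 6) H0
  obtain rfl : c₁₅ = 0 := by simpa [qcoord_words] using congrArg (qcoord K 7) H0
  obtain rfl : -c₁ = c₁₇ := by
    linear_combination (norm := skip) -congrArg (qcoord K 8) H0
    simp [qcoord_words]
  obtain rfl : -c₂ = c₁₉ := by
    linear_combination (norm := skip) -congrArg (qcoord K 9) H0
    simp [qcoord_words]
  refine ⟨c₁ • 𝖾₂ + c₂ • 𝗒 + c₃ • 𝖽 - c₂₁ • (𝗒 * 𝖻) + c₄ • (𝖽 * 𝗇) - c₂₃ • (𝗒 * (𝖻 * 𝖽)) + c₅ •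
  (𝖽 * (𝗇 * 𝗒)) - c₂₅ • (𝗒 * (𝖻 * (𝖽 * 𝗇))) + c₆ • (𝖽 * (𝗇 * (𝗒 * 𝖻))) + c₇ • (𝖽 * (𝗇 * (𝗒 * (𝖻 *
  𝖽)))) + c₈ • (𝖽 * (𝗇 * (𝗒 * (𝖻 * (𝖽 * 𝗇))))) + c₂₁ • (𝖽 * (𝗇 * (𝗒 * (𝖻 * (𝖽 * 𝗇))))) + c₉ • (𝗒
  * (𝖻 * 𝗒)), c₁₂ • 𝖾₃ + c₁₄ • 𝗇 + c₁₆ • (𝗇 * 𝗒) + c₁₈ • (𝗇 * (𝗒 * 𝖻)) + c₂₀ • (𝗇 * (𝗒 * (𝖻 *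
  𝖽))) + c₂₂ • (𝗇 * (𝗒 * (𝖻 * (𝖽 * 𝗇)))) + c₂₄ • (𝗇 * (𝗒 * (𝖻 * (𝖽 * (𝗇 * 𝗒))))), ?_, ?_⟩ <;>
  simp only [mul_assoc, mul_add, mul_sub, qneg_mul, mul_smul_comm, mul_zero, smul_zero, neg_zero, add_zero, zero_add, sub_zero, qgen_rules, qgen_rules_assoc,
    qgen_idem, zero_smul] <;> module

theorem exists_eq_ybd_nd_mul (x y : QuatAlg K) (h0 : 𝖾₂ * x = x) (h1 : 𝖾₃ * y = y) (H0 : 𝖻 *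
    x = 0) (H1 : (-𝗒 * (𝖻 * (𝖽 * 𝗇))) * x + 𝖽 * y = 0) : ∃ z, x = (𝗒 * (𝖻 * 𝖽)) * z ∧ y = (𝗇 * 𝖽)
    * z := by
  obtain ⟨c₀, c₁, c₂, c₃, c₄, c₅, c₆, c₇, c₈, c₉, c₁₀, c₁₁, c₁₂, c₁₃, c₁₄, c₁₅, rfl⟩ := exists_expansion_left2 K x h0
  obtain ⟨c₁₆, c₁₇, c₁₈, c₁₉, c₂₀, c₂₁, c₂₂, c₂₃, c₂₄, c₂₅, rfl⟩ := exists_expansion_left3 K y h1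
  simp only [mul_assoc, mul_add, qneg_mul, mul_smul_comm, mul_zero, smul_zero, neg_zero, add_zero, qgen_rules, qgen_rules_assoc,
    qgen_idem] at H0 H1
  obtain rfl : c₀ = 0 := by simpa [qcoord_words] using congrArg (qcoord K 1) H0
  obtain rfl : c₁ = 0 := by simpa [qcoord_words] using congrArg (qcoord K 2) H0
  obtain rfl : c₂ = 0 := by simpa [qcoord_words] using congrArg (qcoord K 3) H0
  obtain rfl : c₄ = 0 := by simpa [qcoord_words] using congrArg (qcoord K 4) H0
  obtain rfl : c₆ = 0 := by simpa [qcoord_words] using congrArg (qcoord K 5) H0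
  obtain rfl : c₈ = 0 := by simpa [qcoord_words] using congrArg (qcoord K 6) H0
  obtain rfl : c₁₀ = 0 := by simpa [qcoord_words] using congrArg (qcoord K 7) H0
  obtain rfl : c₁₄ = 0 := by simpa [qcoord_words] using congrArg (qcoord K 9) H0
  obtain rfl : c₁₆ = 0 := by simpa [qcoord_words] using congrArg (qcoord K 12) H1
  obtain rfl : c₁₇ = 0 := by simpa [qcoord_words] using congrArg (qcoord K 14) H1
  obtain rfl : c₁₉ = 0 := by simpa [qcoord_words] using congrArg (qcoord K 16) H1
  obtain rfl : c₂₀ = 0 := by simpa [qcoord_words] using congrArg (qcoord K 18) H1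
  obtain rfl : c₂₁ = 0 := by simpa [qcoord_words] using congrArg (qcoord K 20) H1
  obtain rfl : c₃ = 0 := by simpa [qcoord_words] using congrArg (qcoord K 21) H1
  obtain rfl : c₂₂ = 0 := by simpa [qcoord_words] using congrArg (qcoord K 22) H1
  obtain rfl : c₂₃ = 0 := by simpa [qcoord_words] using congrArg (qcoord K 24) H1
  obtain rfl : c₁₂ = 0 := by simpa [qcoord_words] using congrArg (qcoord K 8) H0
  obtain rfl : c₅ = c₁₈ := by
    linear_combination (norm := skip) -congrArg (qcoord K 23) H1
    simp [qcoord_words]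
  obtain rfl : c₇ = c₂₄ := by
    linear_combination (norm := skip) -congrArg (qcoord K 25) H1
    simp [qcoord_words]
  refine ⟨c₅ • 𝖾₃ + c₇ • 𝗇 + c₂₅ • (𝗇 * 𝖽) + c₉ • (𝗇 * 𝗒) + c₁₁ • (𝗇 * (𝗒 * 𝖻)) + c₁₃ • (𝗇 * (𝗒 *
  (𝖻 * 𝖽))) + c₁₅ • (𝗇 * (𝗒 * (𝖻 * (𝖽 * 𝗇)))), ?_, ?_⟩ <;>
  simp only [mul_assoc, mul_add, mul_smul_comm, mul_zero, smul_zero, add_zero, zero_add,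
    qgen_rules, qgen_rules_assoc, qgen_idem, zero_smul]

/-- The periodic resolution of `e₃A/nA`. -/
@[reducible] noncomputable def qres₁ : CyclicRes (QuatAlg K) :=
  .ofOne 𝖾₃ 𝖾₂ 𝖾₂ 𝖾₃ 𝗇 (𝖽 * 𝗇 - 𝗒 * (𝖻 * (𝖽 * (𝗇 * (𝗒 * 𝖻))))) 𝖽 (𝗇 * (𝖽 * (𝗇 * 𝖽)))
    (by simp only [qgen_idem]) (by simp only [qgen_idem]) (by simp only [qgen_idem])
    (by simp only [qgen_idem])
    (by simp only [qgen_idem, and_self])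
    (by simp only [mul_assoc, mul_sub, sub_mul, qgen_idem, qgen_idem_assoc, and_self])
    (by simp only [qgen_idem, and_self])
    (by simp only [mul_assoc, qgen_idem, qgen_idem_assoc, and_self])
    (by simp only [mul_assoc, qgen_rules, qgen_rules_assoc])
    (by simp only [mul_sub, qgen_rules, sub_self])
    (by simp only [mul_assoc, sub_mul, qgen_rules, sub_self])
    (by simp only [qgen_rules, qgen_rules_assoc, mul_zero])
    (exists_eq_n_mul K) (exists_eq_dn_sub_ybdnyb_mul K) (exists_eq_d_mul K) (exists_eq_ndnd_mul K)

/-- The periodic resolution of `e₃A/nyA`. -/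
@[reducible] noncomputable def qres₃ : CyclicRes (QuatAlg K) :=
  .ofOne 𝖾₃ 𝖾₁ 𝖾₁ 𝖾₃ (𝗇 * 𝗒) (𝖻 * 𝗒) (𝖻 * 𝖽) (𝗇 * 𝖽)
    (by simp only [qgen_idem]) (by simp only [qgen_idem]) (by simp only [qgen_idem])
    (by simp only [qgen_idem])
    (by simp only [mul_assoc, qgen_idem, qgen_idem_assoc, and_self])
    (by simp only [mul_assoc, qgen_idem, qgen_idem_assoc, and_self])
    (by simp only [mul_assoc, qgen_idem, qgen_idem_assoc, and_self])
    (by simp only [mul_assoc, qgen_idem, qgen_idem_assoc, and_self])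
    (by simp only [mul_assoc, qgen_rules]) (by simp only [mul_assoc, qgen_rules])
    (by simp only [mul_assoc, qgen_rules]) (by simp only [mul_assoc, qgen_rules])
    (exists_eq_ny_mul K) (exists_eq_by_mul K) (exists_eq_bd_mul K) (exists_eq_nd_mul K)

/-- The periodic resolution of `e₂A/yA`. -/
@[reducible] noncomputable def qres₄ : CyclicRes (QuatAlg K) :=
  .ofOne 𝖾₂ 𝖾₁ 𝖾₁ 𝖾₂ 𝗒 (𝖻 * (𝗒 * (𝖻 * 𝗒))) 𝖻 (𝗒 * 𝖻 - 𝖽 * (𝗇 * (𝗒 * (𝖻 * (𝖽 * 𝗇)))))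
    (by simp only [qgen_idem]) (by simp only [qgen_idem]) (by simp only [qgen_idem])
    (by simp only [qgen_idem])
    (by simp only [qgen_idem, and_self])
    (by simp only [mul_assoc, qgen_idem, qgen_idem_assoc, and_self])
    (by simp only [qgen_idem, and_self])
    (by simp only [mul_assoc, mul_sub, sub_mul, qgen_idem, qgen_idem_assoc, and_self])
    (by simp only [mul_assoc, sub_mul, qgen_rules, sub_self])
    (by simp only [qgen_rules])
    (by simp only [mul_assoc, qgen_rules])
    (by simp only [mul_sub, qgen_rules, sub_self])
    (exists_eq_y_mul K) (exists_eq_byby_mul K) (exists_eq_b_mul K) (exists_eq_yb_sub_dnybdn_mul K)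

/-- The periodic resolution of `e₃A/nybdnyA`. -/
@[reducible] noncomputable def qres₂ : CyclicRes (QuatAlg K) where
  m := 2
  p := 2
  e₀ := fun _ => 𝖾₃
  e₁ := fun _ => 𝖾₁
  e₂ := ![𝖾₁, 𝖾₂]
  e₃ := ![𝖾₂, 𝖾₃]
  D₀ := fun _ _ => 𝗇 * (𝗒 * (𝖻 * (𝖽 * (𝗇 * 𝗒))))
  D₁ := fun _ => ![𝖻 * 𝗒, 𝖻 * (𝖽 * 𝗇)]
  D₂ := ![![𝖻, 0], ![-𝗒 * (𝖻 * (𝖽 * 𝗇)), 𝖽]]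
  G := fun t _ => ![𝗒 * (𝖻 * 𝖽), 𝗇 * 𝖽] t
  idem₀ _ := by simp only [qgen_idem]
  idem₁ _ := by simp only [qgen_idem]
  idem₂ := by simp [Fin.forall_fin_two, qgen_idem]
  idem₃ := by simp [Fin.forall_fin_two, qgen_idem]
  peirce₀ _ _ := by simp only [mul_assoc, qgen_idem, qgen_idem_assoc, and_self]
  peirce₁ := by simp [IsPeirce, Fin.forall_fin_two, mul_assoc, qgen_idem, qgen_idem_assoc]
  peirce₂ := by simp [IsPeirce, Fin.forall_fin_two, mul_assoc, qneg_mul, qgen_idem, qgen_idem_assoc]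
  peirceG := by simp [IsPeirce, Fin.forall_fin_two, mul_assoc, qgen_idem, qgen_idem_assoc]
  ex₀ :=
    ⟨by simp [Fin.forall_fin_two, mul_assoc, qgen_rules], fun v h H => by
      obtain ⟨z, hz⟩ := exists_eq_nybdny_mul K (v 0) (h 0) (by simpa using H 0)
        (by simpa using H 1)
      exact ⟨fun _ => z, fun j => by rw [Subsingleton.elim j 0, Fin.sum_univ_one, ← hz]⟩⟩
  ex₁ :=
    ⟨by simp [Fin.forall_fin_two, mul_assoc, qgen_rules, qgen_rules_assoc], fun v h H => by
      obtain ⟨z, w, hz⟩ := exists_eq_by_bdn_mul K (v 0) (h 0) (by simpa using H 0)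
      exact ⟨![z, w], fun j => by rw [Subsingleton.elim j 0, Fin.sum_univ_two]; exact hz⟩⟩
  ex₂ :=
    ⟨by simp [Fin.forall_fin_two, mul_assoc, qneg_mul, qgen_rules], fun v h H => by
      obtain ⟨z, w, hz, hw⟩ := exists_eq_b_neg_ybdn_d_mul K (v 0) (v 1) (h 0) (h 1)
        (by simpa [Fin.sum_univ_two] using H 0)
      exact ⟨![z, w], Fin.forall_fin_two.2 ⟨by simpa [Fin.sum_univ_two] using hz,
        by simpa [Fin.sum_univ_two] using hw⟩⟩⟩
  ex₃ :=
    ⟨by simp [Fin.forall_fin_two, mul_assoc, qneg_mul, qgen_rules], fun v h H => by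
      obtain ⟨z, hz, hw⟩ := exists_eq_ybd_nd_mul K (v 0) (v 1) (h 0) (h 1)
        (by simpa [Fin.sum_univ_two] using H 0) (by simpa [Fin.sum_univ_two] using H 1)
      exact ⟨fun _ => z, Fin.forall_fin_two.2 ⟨by simpa using hz, by simpa using hw⟩⟩⟩

theorem exists_mul_eq_idem1 (a : QuatAlg K) (h : 𝖾₁ * a = a) (h' : a * 𝖾₁ = a)
    (hne : a * (𝖻 * (𝗒 * (𝖻 * 𝗒))) ≠ 0) : ∃ b, a * b = 𝖾₁ := by
  obtain ⟨c₀, c₁, c₂, c₃, rfl⟩ := exists_expansion_11 K a h h'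
  simp only [add_assoc] at hne ⊢
  refine exists_mul_eq_of_nilpotent (K := K) (A := QuatAlg K) ?_ ?_ ?_ ?_ hne <;>
    simp only [mul_assoc, mul_add, add_mul, mul_smul_comm, smul_mul_assoc, qgen_rules,
      qgen_rules_assoc, qgen_idem, qgen_idem_assoc, mul_zero, smul_zero, add_zero, zero_add]

theorem exists_mul_eq_idem2 (a : QuatAlg K) (h : 𝖾₂ * a = a) (h' : a * 𝖾₂ = a)
    (hne : a * (𝗒 * (𝖻 * (𝗒 * 𝖻))) ≠ 0) : ∃ b, a * b = 𝖾₂ := by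
  obtain ⟨c₀, c₁, c₂, c₃, c₄, c₅, c₆, c₇, rfl⟩ := exists_expansion_22 K a h h'
  simp only [add_assoc] at hne ⊢
  refine exists_mul_eq_of_nilpotent (K := K) (A := QuatAlg K) ?_ ?_ ?_ ?_ hne <;>
    simp only [mul_assoc, mul_add, add_mul, mul_smul_comm, smul_mul_assoc, qgen_rules,
      qgen_rules_assoc, qgen_idem, qgen_idem_assoc, mul_zero, smul_zero, add_zero, zero_add]

theorem exists_mul_eq_idem3 (a : QuatAlg K) (h : 𝖾₃ * a = a) (h' : a * 𝖾₃ = a)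
    (hne : a * (𝗇 * (𝖽 * (𝗇 * 𝖽))) ≠ 0) : ∃ b, a * b = 𝖾₃ := by
  obtain ⟨c₀, c₁, c₂, c₃, rfl⟩ := exists_expansion_33 K a h h'
  simp only [add_assoc] at hne ⊢
  refine exists_mul_eq_of_nilpotent (K := K) (A := QuatAlg K) ?_ ?_ ?_ ?_ hne <;>
    simp only [mul_assoc, mul_add, add_mul, mul_smul_comm, smul_mul_assoc, qgen_rules,
      qgen_rules_assoc, qgen_idem, qgen_idem_assoc, mul_zero, smul_zero, add_zero, zero_add]

open scoped RightActions in
/-- The diagram chase showing that a module satisfying all vanishing conditions and having none of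
the modules presented by the resolutions as a direct summand is zero. -/
theorem eq_zero_of_chase {X : Type*} [AddCommGroup X] [Module (QuatAlg K)ᵐᵒᵖ X]
    (E₁ : ∀ x : X, x <• (𝖽 * 𝗇 - 𝗒 * (𝖻 * (𝖽 * (𝗇 * (𝗒 * 𝖻))))) = 0 → ∃ z : X, x <• 𝖾₂ = z <• 𝗇)
    (E₂ : ∀ x : X, x <• 𝖽 = 0 →
      ∃ z : X, x <• 𝖾₂ = z <• (𝖽 * 𝗇 - 𝗒 * (𝖻 * (𝖽 * (𝗇 * (𝗒 * 𝖻))))))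
    (F₁ : ∀ x : X, x <• (𝖻 * 𝗒) = 0 → ∃ z : X, x <• 𝖾₁ = z <• (𝗇 * 𝗒))
    (F₂ : ∀ x : X, x <• (𝖻 * 𝖽) = 0 → ∃ z : X, x <• 𝖾₁ = z <• (𝖻 * 𝗒))
    (G₁ : ∀ x : X, x <• (𝖻 * (𝗒 * (𝖻 * 𝗒))) = 0 → ∃ z : X, x <• 𝖾₁ = z <• 𝗒)
    (G₂ : ∀ x : X, x <• 𝖻 = 0 → ∃ z : X, x <• 𝖾₁ = z <• (𝖻 * (𝗒 * (𝖻 * 𝗒))))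
    (H₁ : ∀ x : X, x <• (𝖻 * 𝗒) = 0 → x <• (𝖻 * (𝖽 * 𝗇)) = 0 →
      ∃ z : X, x <• 𝖾₁ = z <• (𝗇 * (𝗒 * (𝖻 * (𝖽 * (𝗇 * 𝗒))))))
    (H₂ : ∀ v : X, v <• (𝗒 * (𝖻 * (𝖽 * 𝗇))) = 0 → v <• 𝖽 = 0 →
      ∃ x : X, v <• 𝖾₂ = x <• (𝖻 * (𝖽 * 𝗇)))
    (Z₁ : ∀ x : X, x <• (𝖻 * (𝗒 * (𝖻 * 𝗒))) = 0) (Z₂ : ∀ x : X, x <• (𝗒 * (𝖻 * (𝗒 * 𝖻))) = 0)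
    (Z₃ : ∀ x : X, x <• (𝗇 * (𝖽 * (𝗇 * 𝖽))) = 0)
    (N₁ : ∀ x : X, x <• 𝗇 = 0 → ∃ z : X, x <• 𝖾₃ = z <• 𝖽)
    (N₂ : ∀ x : X, x <• (𝗇 * (𝗒 * (𝖻 * (𝖽 * (𝗇 * 𝗒))))) = 0 →
      ∃ u v : X, u <• 𝖻 = v <• (𝗒 * (𝖻 * (𝖽 * 𝗇))) ∧ v <• 𝖽 = x <• (𝗇 * 𝖽))
    (N₃ : ∀ x : X, x <• (𝗇 * 𝗒) = 0 → ∃ z : X, x <• (𝗇 * 𝖽) = z <• (𝖻 * 𝖽))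
    (N₄ : ∀ x : X, x <• 𝗒 = 0 → ∃ z : X, x <• (𝖽 * (𝗇 * (𝗒 * (𝖻 * (𝖽 * 𝗇))))) = z <• 𝖻) (x : X) :
    x = 0 := by
  have mulr (x : X) (a b : QuatAlg K) : x <• a <• b = x <• (a * b) := op_smul_op_smul x a b
  have e₁b (x : X) : x <• 𝖾₁ <• 𝖻 = x <• 𝖻 := by simp only [mulr, qgen_idem]
  have e₂d (x : X) : x <• 𝖾₂ <• 𝖽 = x <• 𝖽 := by simp only [mulr, qgen_idem]
  have e₂y (x : X) : x <• 𝖾₂ <• 𝗒 = x <• 𝗒 := by simp only [mulr, qgen_idem]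
  have ye₁ (x : X) : x <• 𝗒 <• 𝖾₁ = x <• 𝗒 := by simp only [mulr, qgen_idem]
  have ne₂ (x : X) : x <• 𝗇 <• 𝖾₂ = x <• 𝗇 := by simp only [mulr, qgen_idem]
  have b_inj (x : X) (h : x <• 𝖻 = 0) : x <• 𝖾₁ = 0 := by
    obtain ⟨z, hz⟩ := G₂ x h
    rw [hz, Z₁]
  have yby (x : X) : x <• (𝗒 * (𝖻 * 𝗒)) = 0 := by
    have := b_inj (x <• (𝗒 * (𝖻 * 𝗒))) (by rw [mulr, mul_assoc, mul_assoc, Z₂])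
    simpa only [mulr, mul_assoc, qgen_idem] using this
  have b_y (x : X) : x <• (𝖻 * 𝗒) = 0 := by
    obtain ⟨z, hz⟩ := G₁ x (Z₁ x)
    rw [← mulr, ← e₁b, hz, mulr, mulr, yby]
  have bd_inj (x : X) (h : x <• (𝖻 * 𝖽) = 0) : x <• 𝖾₁ = 0 := by
    obtain ⟨z, hz⟩ := F₂ x h
    rw [hz, b_y]
  have nybdny (x : X) : x <• (𝗇 * (𝗒 * (𝖻 * (𝖽 * (𝗇 * 𝗒))))) = 0 := by
    have := bd_inj (x <• (𝗇 * (𝗒 * (𝖻 * (𝖽 * (𝗇 * 𝗒))))))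
      (by simpa only [mulr, mul_assoc, qgen_rules] using Z₃ x)
    simpa only [mulr, mul_assoc, qgen_idem] using this
  have bdn_inj (x : X) (h : x <• (𝖻 * (𝖽 * 𝗇)) = 0) : x <• 𝖾₁ = 0 := by
    obtain ⟨z, hz⟩ := H₁ x (b_y x) h
    rw [hz, nybdny]
  have bdny (x : X) : x <• (𝖻 * (𝖽 * (𝗇 * 𝗒))) = 0 := by
    have := bdn_inj (x <• (𝖻 * (𝖽 * (𝗇 * 𝗒)))) (by
      simp only [mulr, mul_assoc, qgen_rules]
      rw [← mul_assoc, ← mulr, b_y, smul_zero])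
    simpa only [mulr, mul_assoc, qgen_idem] using this
  have ybdnyb (x : X) : x <• (𝗒 * (𝖻 * (𝖽 * (𝗇 * (𝗒 * 𝖻))))) = 0 := by
    have := congrArg (· <• 𝖻) (bdny (x <• 𝗒))
    simpa only [mulr, mul_assoc, smul_zero] using this
  have dnd (x : X) : x <• (𝖽 * (𝗇 * 𝖽)) = 0 := by
    have := congrArg (· <• 𝖽) (ybdnyb x)
    simpa only [mulr, mul_assoc, smul_zero, qgen_rules] using this
  have bdnd (x : X) : x <• (𝖻 * (𝖽 * (𝗇 * 𝖽))) = 0 := by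
    rw [← mulr, dnd]
  have ny (z : X) : ∃ t : X, z <• (𝗇 * 𝗒) = t <• (𝖽 * (𝗇 * 𝗒)) := by
    obtain ⟨u, v, h, h'⟩ := N₂ z (nybdny z)
    obtain ⟨t, ht⟩ := E₂ (v - z <• 𝗇) (by rw [smul_sub, h', mulr, sub_self])
    rw [MulOpposite.op_sub, sub_smul, ybdnyb, sub_zero, smul_sub, ne₂, sub_eq_iff_eq_add] at ht
    have hu : u <• 𝖻 = (t <• (𝖽 * (𝗇 * 𝗒)) + z <• (𝗇 * 𝗒)) <• (𝖻 * (𝖽 * 𝗇)) := by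
      rw [h, ← mulr, ← e₂y, ht]
      simp only [smul_add, mulr, mul_assoc]
    have hu' := bd_inj u (by rw [← mulr, hu, mulr, mul_assoc, mul_assoc, bdnd])
    rw [← e₁b, hu', smul_zero] at hu
    have := bdn_inj _ hu.symm
    simp only [smul_add, mulr, mul_assoc, qgen_idem] at this
    exact ⟨-t, by rw [smul_neg, eq_neg_iff_add_eq_zero, add_comm, this]⟩
  have dny_of_y (u : X) (h : u <• 𝗒 = 0) : u <• (𝖽 * (𝗇 * 𝗒)) = 0 := by
    obtain ⟨z, hz⟩ := N₄ u h
    have hz' := bd_inj z (by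
      rw [← mulr, ← hz]
      simpa only [mulr, mul_assoc] using bdnd (u <• (𝖽 * (𝗇 * 𝗒))))
    rw [← e₁b, hz', smul_zero] at hz
    have := bdn_inj (u <• (𝖽 * (𝗇 * 𝗒))) (by simpa only [mulr, mul_assoc] using hz)
    simpa only [mulr, mul_assoc, qgen_idem] using this
  have dny (t : X) : t <• (𝖽 * (𝗇 * 𝗒)) = 0 := by
    obtain ⟨z, hz⟩ := F₁ (t <• 𝗒) (b_y _)
    obtain ⟨s, hs⟩ := ny z
    rw [ye₁, hs] at hz
    have := dny_of_y (t - s <• (𝖽 * 𝗇)) (by rw [smul_sub, hz, mulr, mul_assoc, sub_self])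
    simpa only [smul_sub, mulr, mul_assoc, qgen_rules, qgen_rules_assoc, mul_zero, MulOpposite.op_zero,
      zero_smul, sub_zero] using this
  have e₁ (x : X) : x <• 𝖾₁ = 0 := by
    obtain ⟨z, hz⟩ := F₁ x (b_y _)
    obtain ⟨s, hs⟩ := ny z
    rw [hz, hs, dny]
  have b (x : X) : x <• 𝖻 = 0 := by rw [← e₁b, e₁, smul_zero]
  have y (x : X) : x <• 𝗒 = 0 := by rw [← ye₁, e₁]
  have n (x : X) : x <• 𝗇 = 0 := by
    obtain ⟨z, hz⟩ := N₃ x (by rw [← mulr, y])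
    obtain ⟨w, hw⟩ := H₂ (x <• 𝗇) (by rw [← mulr, y, smul_zero])
      (by rw [mulr, hz, ← mulr, b, smul_zero])
    rw [← ne₂, hw, ← mulr, b, smul_zero]
  have e₂ (x : X) : x <• 𝖾₂ = 0 := by
    obtain ⟨z, hz⟩ := E₁ x (by rw [MulOpposite.op_sub, sub_smul, ybdnyb, sub_zero, ← mulr, n])
    rw [hz, n]
  have e₃ (x : X) : x <• 𝖾₃ = 0 := by
    obtain ⟨z, hz⟩ := N₁ x (n x)
    rw [hz, ← e₂d, e₂, smul_zero]
  rw [← one_smul (QuatAlg K)ᵐᵒᵖ x, ← MulOpposite.op_one, ← qgen_unit K, MulOpposite.op_add, MulOpposite.op_add, add_smul, add_smul, e₁,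
    e₂, e₃, add_zero, add_zero]

theorem ext_one₁₁ (x : QuatAlg K) (h0 : 𝖾₃ * x = x) (h1 : x * 𝖾₂ = x) : ∃ z, (𝗇 * (𝖽 * (𝗇 *
    𝖽))) * x = (𝗇 * (𝖽 * (𝗇 * 𝖽))) * (z * 𝗇) := by
  obtain ⟨c₀, c₁, c₂, c₃, rfl⟩ := exists_expansion_32 K x h0 h1
  refine ⟨0, ?_⟩
  simp only [mul_assoc, mul_add, mul_smul_comm, mul_zero, zero_mul, smul_zero, add_zero,
    qgen_rules, qgen_rules_assoc]

theorem ext_two₁₁ (x : QuatAlg K) (h0 : 𝖾₃ * x = x) (h1 : x * 𝖾₂ = x) : ∃ z, (𝗇 * (𝖽 * (𝗇 *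
    𝖽))) * x = (𝗇 * (𝖽 * (𝗇 * 𝖽))) * (z * (𝖽 * 𝗇 - 𝗒 * (𝖻 * (𝖽 * (𝗇 * (𝗒 * 𝖻)))))) := by
  obtain ⟨c₀, c₁, c₂, c₃, rfl⟩ := exists_expansion_32 K x h0 h1
  refine ⟨0, ?_⟩
  simp only [mul_assoc, mul_add, mul_sub, mul_smul_comm, mul_zero, zero_mul, smul_zero, add_zero,
    sub_zero, qgen_rules, qgen_rules_assoc]

theorem ext_one₁₃ (x : QuatAlg K) (h0 : 𝖾₃ * x = x) (h1 : x * 𝖾₂ = x) : ∃ z, (𝗇 * 𝖽) * x = (𝗇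
    * 𝖽) * (z * 𝗇) := by
  obtain ⟨c₀, c₁, c₂, c₃, rfl⟩ := exists_expansion_32 K x h0 h1
  refine ⟨c₀ • 𝖾₃, ?_⟩
  simp only [mul_assoc, mul_add, mul_smul_comm, smul_mul_assoc, smul_zero, add_zero, qgen_rules,
    qgen_rules_assoc, qgen_idem]

theorem ext_two₁₃ (x : QuatAlg K) (h0 : 𝖾₃ * x = x) (h1 : x * 𝖾₂ = x) (H0 : (𝗇 * 𝖽) * (x * 𝖽)
    = 0) : ∃ z, (𝗇 * 𝖽) * x = (𝗇 * 𝖽) * (z * (𝖽 * 𝗇 - 𝗒 * (𝖻 * (𝖽 * (𝗇 * (𝗒 * 𝖻)))))) := by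
  obtain ⟨c₀, c₁, c₂, c₃, rfl⟩ := exists_expansion_32 K x h0 h1
  simp only [mul_assoc, mul_add, add_mul, mul_smul_comm, smul_mul_assoc, mul_zero, smul_zero,
    add_zero, qgen_rules, qgen_rules_assoc] at H0
  obtain rfl : c₀ = 0 := by simpa [qcoord_words] using congrArg (qcoord K 35) H0
  refine ⟨0, ?_⟩
  simp only [mul_assoc, mul_add, mul_sub, mul_smul_comm, mul_zero, zero_mul, smul_zero, add_zero,
    zero_add, sub_zero, qgen_rules, qgen_rules_assoc, zero_smul]

theorem ext_one₁₄ (x : QuatAlg K) (h0 : 𝖾₂ * x = x) (h1 : x * 𝖾₂ = x) (H0 : (𝗒 * 𝖻 - 𝖽 * (𝗇 *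
    (𝗒 * (𝖻 * (𝖽 * 𝗇))))) * (x * (𝖽 * 𝗇 - 𝗒 * (𝖻 * (𝖽 * (𝗇 * (𝗒 * 𝖻)))))) = 0) : ∃ z, (𝗒 * 𝖻 - 𝖽
    * (𝗇 * (𝗒 * (𝖻 * (𝖽 * 𝗇))))) * x = (𝗒 * 𝖻 - 𝖽 * (𝗇 * (𝗒 * (𝖻 * (𝖽 * 𝗇))))) * (z * 𝗇) := by
  obtain ⟨c₀, c₁, c₂, c₃, c₄, c₅, c₆, c₇, rfl⟩ := exists_expansion_22 K x h0 h1
  simp only [mul_assoc, mul_add, add_mul, mul_sub, sub_mul, mul_smul_comm, smul_mul_assoc,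
    mul_zero, smul_zero, add_zero, sub_zero, qgen_rules, qgen_rules_assoc, qgen_idem_assoc] at H0
  obtain rfl : c₀ = 0 := by simpa [qcoord_words] using congrArg (qcoord K 17) H0
  obtain rfl : c₄ = 0 := by simpa [qcoord_words] using congrArg (qcoord K 25) H0
  refine ⟨c₂ • 𝖽 + c₆ • (𝖽 * (𝗇 * (𝗒 * (𝖻 * 𝖽)))), ?_⟩
  simp only [mul_assoc, mul_add, add_mul, sub_mul, mul_smul_comm, smul_mul_assoc, mul_zero,
    smul_zero, add_zero, zero_add, sub_zero, qgen_rules, qgen_rules_assoc, zero_smul]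
  module

theorem ext_two₁₄ (x : QuatAlg K) (h0 : 𝖾₂ * x = x) (h1 : x * 𝖾₂ = x) (H0 : (𝗒 * 𝖻 - 𝖽 * (𝗇 *
    (𝗒 * (𝖻 * (𝖽 * 𝗇))))) * (x * 𝖽) = 0) : ∃ z, (𝗒 * 𝖻 - 𝖽 * (𝗇 * (𝗒 * (𝖻 * (𝖽 * 𝗇))))) * x = (𝗒
    * 𝖻 - 𝖽 * (𝗇 * (𝗒 * (𝖻 * (𝖽 * 𝗇))))) * (z * (𝖽 * 𝗇 - 𝗒 * (𝖻 * (𝖽 * (𝗇 * (𝗒 * 𝖻)))))) := by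
  obtain ⟨c₀, c₁, c₂, c₃, c₄, c₅, c₆, c₇, rfl⟩ := exists_expansion_22 K x h0 h1
  simp only [mul_assoc, mul_add, add_mul, sub_mul, mul_smul_comm, smul_mul_assoc, mul_zero,
    smul_zero, add_zero, sub_zero, qgen_rules, qgen_rules_assoc, qgen_idem] at H0
  obtain rfl : c₀ = 0 := by simpa [qcoord_words] using congrArg (qcoord K 15) H0
  obtain rfl : c₄ = 0 := by simpa [qcoord_words] using congrArg (qcoord K 23) H0
  refine ⟨c₂ • 𝖾₂ + c₆ • (𝖽 * (𝗇 * (𝗒 * 𝖻))), ?_⟩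
  simp only [mul_assoc, mul_add, add_mul, mul_sub, sub_mul, mul_smul_comm, smul_mul_assoc,
    mul_zero, smul_zero, add_zero, zero_add, sub_zero, qgen_rules, qgen_rules_assoc,
    qgen_idem_assoc, zero_smul]
  module

theorem ext_one₁₂ (x : QuatAlg K) (h0 : 𝖾₃ * x = x) (h1 : x * 𝖾₂ = x) (H0 : (𝗒 * (𝖻 * 𝖽)) *
    (x * (𝖽 * 𝗇 - 𝗒 * (𝖻 * (𝖽 * (𝗇 * (𝗒 * 𝖻)))))) = 0) : ∃ z, (𝗒 * (𝖻 * 𝖽)) * x = (𝗒 * (𝖻 * 𝖽)) *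
    (z * 𝗇) ∧ (𝗇 * 𝖽) * x = (𝗇 * 𝖽) * (z * 𝗇) := by
  obtain ⟨c₀, c₁, c₂, c₃, rfl⟩ := exists_expansion_32 K x h0 h1
  simp only [mul_assoc, mul_add, add_mul, mul_sub, mul_smul_comm, smul_mul_assoc, mul_zero,
    smul_zero, add_zero, zero_add, sub_zero, qgen_rules, qgen_rules_assoc] at H0
  obtain rfl : c₁ = 0 := by simpa [qcoord_words] using congrArg (qcoord K 25) H0
  refine ⟨c₀ • 𝖾₃ + c₂ • (𝗇 * (𝗒 * (𝖻 * 𝖽))), ?_, ?_⟩ <;>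
  simp only [mul_assoc, mul_add, add_mul, mul_smul_comm, smul_mul_assoc, mul_zero, smul_zero,
    add_zero, qgen_rules, qgen_rules_assoc, qgen_idem, zero_smul]

theorem ext_two₁₂ (x : QuatAlg K) (h0 : 𝖾₃ * x = x) (h1 : x * 𝖾₂ = x) (H0 : (𝗒 * (𝖻 * 𝖽)) *
    (x * 𝖽) = 0) (H1 : (𝗇 * 𝖽) * (x * 𝖽) = 0) : ∃ z, (𝗒 * (𝖻 * 𝖽)) * x = (𝗒 * (𝖻 * 𝖽)) * (z * (𝖽
    * 𝗇 - 𝗒 * (𝖻 * (𝖽 * (𝗇 * (𝗒 * 𝖻)))))) ∧ (𝗇 * 𝖽) * x = (𝗇 * 𝖽) * (z * (𝖽 * 𝗇 - 𝗒 * (𝖻 * (𝖽 *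
    (𝗇 * (𝗒 * 𝖻)))))) := by
  obtain ⟨c₀, c₁, c₂, c₃, rfl⟩ := exists_expansion_32 K x h0 h1
  simp only [mul_assoc, mul_add, add_mul, mul_smul_comm, smul_mul_assoc,
    mul_zero, smul_zero, add_zero, zero_add, qgen_rules, qgen_rules_assoc] at H0 H1
  obtain rfl : c₁ = 0 := by simpa [qcoord_words] using congrArg (qcoord K 23) H0
  obtain rfl : c₀ = 0 := by simpa [qcoord_words] using congrArg (qcoord K 35) H1
  refine ⟨c₂ • (𝗇 * (𝗒 * 𝖻)), ?_, ?_⟩ <;>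
  simp only [mul_assoc, mul_add, mul_sub, mul_smul_comm, smul_mul_assoc, mul_zero, smul_zero,
    add_zero, zero_add, sub_zero, qgen_rules, qgen_rules_assoc, zero_smul]

theorem ext_one₃₁ (x : QuatAlg K) (h0 : 𝖾₃ * x = x) (h1 : x * 𝖾₁ = x) : ∃ z, (𝗇 * (𝖽 * (𝗇 *
    𝖽))) * x = (𝗇 * (𝖽 * (𝗇 * 𝖽))) * (z * (𝗇 * 𝗒)) := by
  obtain ⟨c₀, c₁, rfl⟩ := exists_expansion_31 K x h0 h1
  refine ⟨0, ?_⟩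
  simp only [mul_assoc, mul_add, mul_smul_comm, mul_zero, zero_mul, smul_zero, add_zero,
    qgen_rules]

theorem ext_two₃₁ (x : QuatAlg K) (h0 : 𝖾₃ * x = x) (h1 : x * 𝖾₁ = x) : ∃ z, (𝗇 * (𝖽 * (𝗇 *
    𝖽))) * x = (𝗇 * (𝖽 * (𝗇 * 𝖽))) * (z * (𝖻 * 𝗒)) := by
  obtain ⟨c₀, c₁, rfl⟩ := exists_expansion_31 K x h0 h1
  refine ⟨0, ?_⟩
  simp only [mul_assoc, mul_add, mul_smul_comm, mul_zero, zero_mul, smul_zero, add_zero,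
    qgen_rules]

theorem ext_one₃₃ (x : QuatAlg K) (h0 : 𝖾₃ * x = x) (h1 : x * 𝖾₁ = x) : ∃ z, (𝗇 * 𝖽) * x = (𝗇
    * 𝖽) * (z * (𝗇 * 𝗒)) := by
  obtain ⟨c₀, c₁, rfl⟩ := exists_expansion_31 K x h0 h1
  refine ⟨0, ?_⟩
  simp only [mul_assoc, mul_add, mul_smul_comm, mul_zero, zero_mul, smul_zero, add_zero,
    qgen_rules]

theorem ext_two₃₃ (x : QuatAlg K) (h0 : 𝖾₃ * x = x) (h1 : x * 𝖾₁ = x) : ∃ z, (𝗇 * 𝖽) * x = (𝗇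
    * 𝖽) * (z * (𝖻 * 𝗒)) := by
  obtain ⟨c₀, c₁, rfl⟩ := exists_expansion_31 K x h0 h1
  refine ⟨0, ?_⟩
  simp only [mul_assoc, mul_add, mul_smul_comm, mul_zero, zero_mul, smul_zero, add_zero,
    qgen_rules]

theorem ext_one₃₄ (x : QuatAlg K) (h0 : 𝖾₂ * x = x) (h1 : x * 𝖾₁ = x) : ∃ z, (𝗒 * 𝖻 - 𝖽 * (𝗇
    * (𝗒 * (𝖻 * (𝖽 * 𝗇))))) * x = (𝗒 * 𝖻 - 𝖽 * (𝗇 * (𝗒 * (𝖻 * (𝖽 * 𝗇))))) * (z * (𝗇 * 𝗒)) := by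
  obtain ⟨c₀, c₁, c₂, c₃, rfl⟩ := exists_expansion_21 K x h0 h1
  refine ⟨c₁ • 𝖽, ?_⟩
  simp only [mul_assoc, mul_add, sub_mul, mul_smul_comm, smul_mul_assoc, mul_zero, smul_zero,
    add_zero, sub_zero, qgen_rules, qgen_rules_assoc]
  module

theorem ext_two₃₄ (x : QuatAlg K) (h0 : 𝖾₂ * x = x) (h1 : x * 𝖾₁ = x) (H0 : (𝗒 * 𝖻 - 𝖽 * (𝗇 *
    (𝗒 * (𝖻 * (𝖽 * 𝗇))))) * (x * (𝖻 * 𝖽)) = 0) : ∃ z, (𝗒 * 𝖻 - 𝖽 * (𝗇 * (𝗒 * (𝖻 * (𝖽 * 𝗇))))) * x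
    = (𝗒 * 𝖻 - 𝖽 * (𝗇 * (𝗒 * (𝖻 * (𝖽 * 𝗇))))) * (z * (𝖻 * 𝗒)) := by
  obtain ⟨c₀, c₁, c₂, c₃, rfl⟩ := exists_expansion_21 K x h0 h1
  simp only [mul_assoc, mul_add, add_mul, sub_mul, mul_smul_comm, smul_mul_assoc, mul_zero,
    smul_zero, add_zero, zero_add, sub_zero, qgen_rules, qgen_rules_assoc] at H0
  obtain rfl : c₁ = 0 := by simpa [qcoord_words] using congrArg (qcoord K 23) H0
  refine ⟨0, ?_⟩
  simp only [mul_assoc, mul_add, sub_mul, mul_smul_comm, mul_zero, zero_mul, smul_zero, add_zero,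
    sub_zero, qgen_rules, qgen_rules_assoc, zero_smul]
  module

theorem ext_one₃₂ (x : QuatAlg K) (h0 : 𝖾₃ * x = x) (h1 : x * 𝖾₁ = x) : ∃ z, (𝗒 * (𝖻 * 𝖽)) *
    x = (𝗒 * (𝖻 * 𝖽)) * (z * (𝗇 * 𝗒)) ∧ (𝗇 * 𝖽) * x = (𝗇 * 𝖽) * (z * (𝗇 * 𝗒)) := by
  obtain ⟨c₀, c₁, rfl⟩ := exists_expansion_31 K x h0 h1
  refine ⟨c₀ • 𝖾₃, ?_, ?_⟩ <;>
  simp only [mul_assoc, mul_add, mul_smul_comm, smul_mul_assoc, smul_zero, add_zero, qgen_rules,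
    qgen_idem_assoc]

theorem ext_two₃₂ (x : QuatAlg K) (h0 : 𝖾₃ * x = x) (h1 : x * 𝖾₁ = x) (H0 : (𝗒 * (𝖻 * 𝖽)) *
    (x * (𝖻 * 𝖽)) = 0) : ∃ z, (𝗒 * (𝖻 * 𝖽)) * x = (𝗒 * (𝖻 * 𝖽)) * (z * (𝖻 * 𝗒)) ∧ (𝗇 * 𝖽) * x =
    (𝗇 * 𝖽) * (z * (𝖻 * 𝗒)) := by
  obtain ⟨c₀, c₁, rfl⟩ := exists_expansion_31 K x h0 h1
  simp only [mul_assoc, mul_add, add_mul, mul_smul_comm, smul_mul_assoc, mul_zero, smul_zero,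
    add_zero, qgen_rules, qgen_rules_assoc] at H0
  obtain rfl : c₀ = 0 := by simpa [qcoord_words] using congrArg (qcoord K 23) H0
  refine ⟨0, ?_, ?_⟩ <;>
  simp only [mul_assoc, mul_smul_comm, mul_zero, zero_mul, smul_zero, zero_add, qgen_rules,
    zero_smul]

theorem ext_one₄₁ (x : QuatAlg K) (h0 : 𝖾₃ * x = x) (h1 : x * 𝖾₁ = x) : ∃ z, (𝗇 * (𝖽 * (𝗇 *
    𝖽))) * x = (𝗇 * (𝖽 * (𝗇 * 𝖽))) * (z * 𝗒) := by
  obtain ⟨c₀, c₁, rfl⟩ := exists_expansion_31 K x h0 h1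
  refine ⟨0, ?_⟩
  simp only [mul_assoc, mul_add, mul_smul_comm, mul_zero, zero_mul, smul_zero, add_zero,
    qgen_rules]

theorem ext_two₄₁ (x : QuatAlg K) (h0 : 𝖾₃ * x = x) (h1 : x * 𝖾₁ = x) : ∃ z, (𝗇 * (𝖽 * (𝗇 *
    𝖽))) * x = (𝗇 * (𝖽 * (𝗇 * 𝖽))) * (z * (𝖻 * (𝗒 * (𝖻 * 𝗒)))) := by
  obtain ⟨c₀, c₁, rfl⟩ := exists_expansion_31 K x h0 h1
  refine ⟨0, ?_⟩
  simp only [mul_assoc, mul_add, mul_smul_comm, mul_zero, zero_mul, smul_zero, add_zero,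
    qgen_rules]

theorem ext_one₄₃ (x : QuatAlg K) (h0 : 𝖾₃ * x = x) (h1 : x * 𝖾₁ = x) : ∃ z, (𝗇 * 𝖽) * x = (𝗇
    * 𝖽) * (z * 𝗒) := by
  obtain ⟨c₀, c₁, rfl⟩ := exists_expansion_31 K x h0 h1
  refine ⟨0, ?_⟩
  simp only [mul_assoc, mul_add, mul_smul_comm, mul_zero, zero_mul, smul_zero, add_zero,
    qgen_rules]

theorem ext_two₄₃ (x : QuatAlg K) (h0 : 𝖾₃ * x = x) (h1 : x * 𝖾₁ = x) : ∃ z, (𝗇 * 𝖽) * x = (𝗇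
    * 𝖽) * (z * (𝖻 * (𝗒 * (𝖻 * 𝗒)))) := by
  obtain ⟨c₀, c₁, rfl⟩ := exists_expansion_31 K x h0 h1
  refine ⟨0, ?_⟩
  simp only [mul_assoc, mul_add, mul_smul_comm, mul_zero, zero_mul, smul_zero, add_zero,
    qgen_rules]

theorem ext_one₄₄ (x : QuatAlg K) (h0 : 𝖾₂ * x = x) (h1 : x * 𝖾₁ = x) : ∃ z, (𝗒 * 𝖻 - 𝖽 * (𝗇
    * (𝗒 * (𝖻 * (𝖽 * 𝗇))))) * x = (𝗒 * 𝖻 - 𝖽 * (𝗇 * (𝗒 * (𝖻 * (𝖽 * 𝗇))))) * (z * 𝗒) := by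
  obtain ⟨c₀, c₁, c₂, c₃, rfl⟩ := exists_expansion_21 K x h0 h1
  refine ⟨c₁ • (𝖽 * 𝗇), ?_⟩
  simp only [mul_assoc, mul_add, sub_mul, mul_smul_comm, smul_mul_assoc, mul_zero, smul_zero,
    add_zero, sub_zero, qgen_rules, qgen_rules_assoc]
  module

theorem ext_two₄₄ (x : QuatAlg K) (h0 : 𝖾₂ * x = x) (h1 : x * 𝖾₁ = x) (H0 : (𝗒 * 𝖻 - 𝖽 * (𝗇 *
    (𝗒 * (𝖻 * (𝖽 * 𝗇))))) * (x * 𝖻) = 0) : ∃ z, (𝗒 * 𝖻 - 𝖽 * (𝗇 * (𝗒 * (𝖻 * (𝖽 * 𝗇))))) * x = (𝗒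
    * 𝖻 - 𝖽 * (𝗇 * (𝗒 * (𝖻 * (𝖽 * 𝗇))))) * (z * (𝖻 * (𝗒 * (𝖻 * 𝗒)))) := by
  obtain ⟨c₀, c₁, c₂, c₃, rfl⟩ := exists_expansion_21 K x h0 h1
  simp only [mul_assoc, mul_add, add_mul, sub_mul, mul_smul_comm, smul_mul_assoc, mul_zero,
    smul_zero, add_zero, sub_zero, qgen_rules, qgen_rules_assoc] at H0
  obtain rfl : c₁ = 0 := by simpa [qcoord_words] using congrArg (qcoord K 21) H0
  refine ⟨0, ?_⟩
  simp only [mul_assoc, mul_add, sub_mul, mul_smul_comm, mul_zero, zero_mul, smul_zero, add_zero,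
    sub_zero, qgen_rules, qgen_rules_assoc, zero_smul]
  module

theorem ext_one₄₂ (x : QuatAlg K) (h0 : 𝖾₃ * x = x) (h1 : x * 𝖾₁ = x) : ∃ z, (𝗒 * (𝖻 * 𝖽)) *
    x = (𝗒 * (𝖻 * 𝖽)) * (z * 𝗒) ∧ (𝗇 * 𝖽) * x = (𝗇 * 𝖽) * (z * 𝗒) := by
  obtain ⟨c₀, c₁, rfl⟩ := exists_expansion_31 K x h0 h1
  refine ⟨c₀ • 𝗇, ?_, ?_⟩ <;>
  simp only [mul_assoc, mul_add, mul_smul_comm, smul_mul_assoc, smul_zero, add_zero, qgen_rules]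

theorem ext_two₄₂ (x : QuatAlg K) (h0 : 𝖾₃ * x = x) (h1 : x * 𝖾₁ = x) (H0 : (𝗒 * (𝖻 * 𝖽)) *
    (x * 𝖻) = 0) : ∃ z, (𝗒 * (𝖻 * 𝖽)) * x = (𝗒 * (𝖻 * 𝖽)) * (z * (𝖻 * (𝗒 * (𝖻 * 𝗒)))) ∧ (𝗇 * 𝖽) *
    x = (𝗇 * 𝖽) * (z * (𝖻 * (𝗒 * (𝖻 * 𝗒)))) := by
  obtain ⟨c₀, c₁, rfl⟩ := exists_expansion_31 K x h0 h1
  simp only [mul_assoc, mul_add, add_mul, mul_smul_comm, smul_mul_assoc, mul_zero, smul_zero,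
    add_zero, qgen_rules] at H0
  obtain rfl : c₀ = 0 := by simpa [qcoord_words] using congrArg (qcoord K 21) H0
  refine ⟨0, ?_, ?_⟩ <;>
  simp only [mul_assoc, mul_smul_comm, mul_zero, zero_mul, smul_zero, zero_add, qgen_rules,
    zero_smul]

theorem ext_one₂₁ (x : QuatAlg K) (h0 : 𝖾₃ * x = x) (h1 : x * 𝖾₁ = x) : ∃ z, (𝗇 * (𝖽 * (𝗇 *
    𝖽))) * x = (𝗇 * (𝖽 * (𝗇 * 𝖽))) * (z * (𝗇 * (𝗒 * (𝖻 * (𝖽 * (𝗇 * 𝗒)))))) := by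
  obtain ⟨c₀, c₁, rfl⟩ := exists_expansion_31 K x h0 h1
  refine ⟨0, ?_⟩
  simp only [mul_assoc, mul_add, mul_smul_comm, mul_zero, zero_mul, smul_zero, add_zero,
    qgen_rules]

theorem ext_two₂₁ (x y : QuatAlg K) (h0 : 𝖾₃ * x = x) (h1 : x * 𝖾₁ = x) (h2 : 𝖾₃ * y = y) (h3
    : y * 𝖾₂ = y) : ∃ z, (𝗇 * (𝖽 * (𝗇 * 𝖽))) * x = (𝗇 * (𝖽 * (𝗇 * 𝖽))) * (z * (𝖻 * 𝗒)) ∧ (𝗇 * (𝖽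
    * (𝗇 * 𝖽))) * y = (𝗇 * (𝖽 * (𝗇 * 𝖽))) * (z * (𝖻 * (𝖽 * 𝗇))) := by
  obtain ⟨c₀, c₁, rfl⟩ := exists_expansion_31 K x h0 h1
  obtain ⟨c₂, c₃, c₄, c₅, rfl⟩ := exists_expansion_32 K y h2 h3
  refine ⟨0, ?_, ?_⟩ <;>
  simp only [mul_assoc, mul_add, mul_smul_comm, mul_zero, zero_mul, smul_zero, add_zero,
    qgen_rules, qgen_rules_assoc]

theorem ext_one₂₃ (x : QuatAlg K) (h0 : 𝖾₃ * x = x) (h1 : x * 𝖾₁ = x) : ∃ z, (𝗇 * 𝖽) * x = (𝗇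
    * 𝖽) * (z * (𝗇 * (𝗒 * (𝖻 * (𝖽 * (𝗇 * 𝗒)))))) := by
  obtain ⟨c₀, c₁, rfl⟩ := exists_expansion_31 K x h0 h1
  refine ⟨0, ?_⟩
  simp only [mul_assoc, mul_add, mul_smul_comm, mul_zero, zero_mul, smul_zero, add_zero,
    qgen_rules]

theorem ext_two₂₃ (x y : QuatAlg K) (h0 : 𝖾₃ * x = x) (h1 : x * 𝖾₁ = x) (h2 : 𝖾₃ * y = y) (h3
    : y * 𝖾₂ = y) (H0 : (𝗇 * 𝖽) * (x * 𝖻 + y * (-𝗒 * (𝖻 * (𝖽 * 𝗇)))) = 0) (H1 : (𝗇 * 𝖽) * (y * 𝖽)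
    = 0) : ∃ z, (𝗇 * 𝖽) * x = (𝗇 * 𝖽) * (z * (𝖻 * 𝗒)) ∧ (𝗇 * 𝖽) * y = (𝗇 * 𝖽) * (z * (𝖻 * (𝖽 *
    𝗇))) := by
  obtain ⟨c₀, c₁, rfl⟩ := exists_expansion_31 K x h0 h1
  obtain ⟨c₂, c₃, c₄, c₅, rfl⟩ := exists_expansion_32 K y h2 h3
  simp only [mul_assoc, mul_add, add_mul, mul_smul_comm, smul_mul_assoc, mul_zero, smul_zero,
    add_zero, qgen_rules, qgen_rules_assoc] at H1
  obtain rfl : c₂ = 0 := by simpa [qcoord_words] using congrArg (qcoord K 35) H1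
  refine ⟨0, ?_, ?_⟩ <;>
  simp only [mul_assoc, mul_add, mul_smul_comm, mul_zero, zero_mul, smul_zero, add_zero, zero_add,
    qgen_rules, qgen_rules_assoc, zero_smul]

theorem ext_one₂₄ (x : QuatAlg K) (h0 : 𝖾₂ * x = x) (h1 : x * 𝖾₁ = x) (H0 : (𝗒 * 𝖻 - 𝖽 * (𝗇 *
    (𝗒 * (𝖻 * (𝖽 * 𝗇))))) * (x * (𝖻 * 𝗒)) = 0) (H1 : (𝗒 * 𝖻 - 𝖽 * (𝗇 * (𝗒 * (𝖻 * (𝖽 * 𝗇))))) * (x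
    * (𝖻 * (𝖽 * 𝗇))) = 0) : ∃ z, (𝗒 * 𝖻 - 𝖽 * (𝗇 * (𝗒 * (𝖻 * (𝖽 * 𝗇))))) * x = (𝗒 * 𝖻 - 𝖽 * (𝗇 *
    (𝗒 * (𝖻 * (𝖽 * 𝗇))))) * (z * (𝗇 * (𝗒 * (𝖻 * (𝖽 * (𝗇 * 𝗒)))))) := by
  obtain ⟨c₀, c₁, c₂, c₃, rfl⟩ := exists_expansion_21 K x h0 h1
  simp only [mul_assoc, mul_add, add_mul, sub_mul, mul_smul_comm, smul_mul_assoc, mul_zero,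
    smul_zero, add_zero, zero_add, sub_zero, qgen_rules, qgen_rules_assoc] at H1
  obtain rfl : c₁ = 0 := by simpa [qcoord_words] using congrArg (qcoord K 25) H1
  refine ⟨0, ?_⟩
  simp only [mul_assoc, mul_add, sub_mul, mul_smul_comm, mul_zero, zero_mul, smul_zero, add_zero,
    sub_zero, qgen_rules, qgen_rules_assoc, zero_smul]
  module

theorem ext_two₂₄ (x y : QuatAlg K) (h0 : 𝖾₂ * x = x) (h1 : x * 𝖾₁ = x) (h2 : 𝖾₂ * y = y) (h3
    : y * 𝖾₂ = y) (H0 : (𝗒 * 𝖻 - 𝖽 * (𝗇 * (𝗒 * (𝖻 * (𝖽 * 𝗇))))) * (x * 𝖻 + y * (-𝗒 * (𝖻 * (𝖽 *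
    𝗇)))) = 0) (H1 : (𝗒 * 𝖻 - 𝖽 * (𝗇 * (𝗒 * (𝖻 * (𝖽 * 𝗇))))) * (y * 𝖽) = 0) : ∃ z, (𝗒 * 𝖻 - 𝖽 *
    (𝗇 * (𝗒 * (𝖻 * (𝖽 * 𝗇))))) * x = (𝗒 * 𝖻 - 𝖽 * (𝗇 * (𝗒 * (𝖻 * (𝖽 * 𝗇))))) * (z * (𝖻 * 𝗒)) ∧ (𝗒
    * 𝖻 - 𝖽 * (𝗇 * (𝗒 * (𝖻 * (𝖽 * 𝗇))))) * y = (𝗒 * 𝖻 - 𝖽 * (𝗇 * (𝗒 * (𝖻 * (𝖽 * 𝗇))))) * (z * (𝖻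
    * (𝖽 * 𝗇))) := by
  obtain ⟨c₀, c₁, c₂, c₃, rfl⟩ := exists_expansion_21 K x h0 h1
  obtain ⟨c₄, c₅, c₆, c₇, c₈, c₉, c₁₀, c₁₁, rfl⟩ := exists_expansion_22 K y h2 h3
  simp only [mul_assoc, mul_add, add_mul, sub_mul, qneg_mul, mul_smul_comm, smul_mul_assoc,
    mul_zero, smul_zero, neg_zero, add_zero, zero_add, sub_zero, qgen_rules, qgen_rules_assoc,
    qgen_idem, qgen_idem_assoc] at H0 H1
  obtain rfl : c₁ = 0 := by simpa [qcoord_words] using congrArg (qcoord K 21) H0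
  obtain rfl : c₆ = 0 := by simpa [qcoord_words] using congrArg (qcoord K 25) H0
  obtain rfl : c₄ = 0 := by simpa [qcoord_words] using congrArg (qcoord K 15) H1
  obtain rfl : c₈ = 0 := by simpa [qcoord_words] using congrArg (qcoord K 23) H1
  refine ⟨c₁₀ • (𝖽 * (𝗇 * 𝗒)), ?_, ?_⟩ <;>
  simp only [mul_assoc, mul_add, sub_mul, mul_smul_comm, smul_mul_assoc,
    mul_zero, smul_zero, add_zero, zero_add, sub_zero, qgen_rules, qgen_rules_assoc,
    zero_smul] <;> module

theorem ext_one₂₂ (x : QuatAlg K) (h0 : 𝖾₃ * x = x) (h1 : x * 𝖾₁ = x) (H0 : (𝗒 * (𝖻 * 𝖽)) *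
    (x * (𝖻 * 𝗒)) = 0) (H1 : (𝗒 * (𝖻 * 𝖽)) * (x * (𝖻 * (𝖽 * 𝗇))) = 0) (H2 : (𝗇 * 𝖽) * (x * (𝖻 *
    𝗒)) = 0) (H3 : (𝗇 * 𝖽) * (x * (𝖻 * (𝖽 * 𝗇))) = 0) : ∃ z, (𝗒 * (𝖻 * 𝖽)) * x = (𝗒 * (𝖻 * 𝖽)) *
    (z * (𝗇 * (𝗒 * (𝖻 * (𝖽 * (𝗇 * 𝗒)))))) ∧ (𝗇 * 𝖽) * x = (𝗇 * 𝖽) * (z * (𝗇 * (𝗒 * (𝖻 * (𝖽 * (𝗇 *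
    𝗒)))))) := by
  obtain ⟨c₀, c₁, rfl⟩ := exists_expansion_31 K x h0 h1
  simp only [mul_assoc, add_mul, mul_smul_comm, smul_mul_assoc, smul_zero, add_zero, qgen_rules,
    qgen_rules_assoc] at H1
  obtain rfl : c₀ = 0 := by simpa [qcoord_words] using congrArg (qcoord K 25) H1
  refine ⟨0, ?_, ?_⟩ <;>
  simp only [mul_assoc, mul_smul_comm, mul_zero, zero_mul, smul_zero, zero_add, qgen_rules,
    zero_smul]

theorem ext_two₂₂ (x y : QuatAlg K) (h0 : 𝖾₃ * x = x) (h1 : x * 𝖾₁ = x) (h2 : 𝖾₃ * y = y) (h3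
    : y * 𝖾₂ = y) (H0 : (𝗒 * (𝖻 * 𝖽)) * (x * 𝖻 + y * (-𝗒 * (𝖻 * (𝖽 * 𝗇)))) = 0) (H1 : (𝗒 * (𝖻 *
    𝖽)) * (y * 𝖽) = 0) : ∃ z, (𝗒 * (𝖻 * 𝖽)) * x = (𝗒 * (𝖻 * 𝖽)) * (z * (𝖻 * 𝗒)) ∧ (𝗒 * (𝖻 * 𝖽)) *
    y = (𝗒 * (𝖻 * 𝖽)) * (z * (𝖻 * (𝖽 * 𝗇))) ∧ (𝗇 * 𝖽) * x = (𝗇 * 𝖽) * (z * (𝖻 * 𝗒)) ∧ (𝗇 * 𝖽) * y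
    = (𝗇 * 𝖽) * (z * (𝖻 * (𝖽 * 𝗇))) := by
  obtain ⟨c₀, c₁, rfl⟩ := exists_expansion_31 K x h0 h1
  obtain ⟨c₂, c₃, c₄, c₅, rfl⟩ := exists_expansion_32 K y h2 h3
  simp only [mul_assoc, mul_add, add_mul, qneg_mul, mul_smul_comm, smul_mul_assoc,
    mul_zero, smul_zero, neg_zero, add_zero, zero_add, qgen_rules, qgen_rules_assoc] at H0 H1
  obtain rfl : c₀ = 0 := by simpa [qcoord_words] using congrArg (qcoord K 21) H0
  obtain rfl : c₂ = 0 := by simpa [qcoord_words] using congrArg (qcoord K 25) H0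
  obtain rfl : c₃ = 0 := by simpa [qcoord_words] using congrArg (qcoord K 23) H1
  refine ⟨c₄ • (𝗇 * 𝗒), ?_, ?_, ?_, ?_⟩ <;>
  simp only [mul_assoc, mul_add, mul_smul_comm, smul_mul_assoc, mul_zero, smul_zero, add_zero,
    zero_add, qgen_rules, qgen_rules_assoc, zero_smul]

theorem acyclic_qres₂_coker (S : CyclicRes (QuatAlg K))
    (H₁ : ∀ x, S.e₀ 0 * x = x → x * 𝖾₁ = x → (∀ t, S.G t 0 * (x * (𝖻 * 𝗒)) = 0) →
      (∀ t, S.G t 0 * (x * (𝖻 * (𝖽 * 𝗇))) = 0) →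
      ∃ z, ∀ t, S.G t 0 * x = S.G t 0 * (z * (𝗇 * (𝗒 * (𝖻 * (𝖽 * (𝗇 * 𝗒)))))))
    (H₂ : ∀ x y, S.e₀ 0 * x = x → x * 𝖾₁ = x → S.e₀ 0 * y = y → y * 𝖾₂ = y →
      (∀ t, S.G t 0 * (x * 𝖻 + y * (-𝗒 * (𝖻 * (𝖽 * 𝗇)))) = 0) →
      (∀ t, S.G t 0 * (y * 𝖽) = 0) →
      ∃ z, (∀ t, S.G t 0 * x = S.G t 0 * (z * (𝖻 * 𝗒))) ∧
        ∀ t, S.G t 0 * y = S.G t 0 * (z * (𝖻 * (𝖽 * 𝗇)))) :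
    (qres₂ K).Acyclic S.Coker := by
  constructor
  · refine S.rowExact_coker (qres₂ K).idem₁ (qres₂ K).peirce₁ fun a h h' hz => ?_
    obtain ⟨c, hc⟩ := H₁ (a 0) (h 0) (h' 0)
      (fun t => (congrArg _ (Fin.sum_univ_one _).symm).trans (hz t (0 : Fin 2)))
      (fun t => (congrArg _ (Fin.sum_univ_one _).symm).trans (hz t (1 : Fin 2)))
    exact ⟨fun _ => c, fun t j => by rw [Subsingleton.elim j 0, hc, Fin.sum_univ_one]⟩
  · refine S.rowExact_coker (qres₂ K).idem₂ (qres₂ K).peirce₂ fun (a : Fin 2 → QuatAlg K) h h' hz =>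
      ?_
    obtain ⟨c, hc, hc'⟩ := H₂ (a 0) (a 1) (h 0) (h' 0) (h 1) (h' 1)
      (fun t => (congrArg _ (Fin.sum_univ_two _).symm).trans (hz t 0))
      (fun t => by
        have : a 0 * 0 + a 1 * 𝖽 = a 1 * 𝖽 := by rw [mul_zero, zero_add]
        rw [← this]
        exact (congrArg _ (Fin.sum_univ_two _).symm).trans (hz t 1))
    refine ⟨fun _ => c, fun t => Fin.forall_fin_two.2 ⟨?_, ?_⟩⟩
    · rw [Fin.sum_univ_one]; exact hc t
    · rw [Fin.sum_univ_one]; exact hc' t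

/-- The periodic resolutions of the four nonprojective summands. -/
noncomputable def qres : Fin 4 → CyclicRes (QuatAlg K) :=
  ![qres₁ K, qres₂ K, qres₃ K, qres₄ K]

theorem acyclic_qres_coker : ∀ k l : Fin 4, (qres K k).Acyclic (qres K l).Coker
  | 0, 0 =>
    ⟨(qres₁ K).rowExact_coker_of_one ((qres₁ K).idem₁ 0) ((qres₁ K).peirce₁ 0 0) fun x h h' _ =>
      let ⟨z, hz⟩ := ext_one₁₁ K x h h'
      ⟨z, fun _ => hz⟩,
    (qres₁ K).rowExact_coker_of_one ((qres₁ K).idem₂ 0) ((qres₁ K).peirce₂ 0 0) fun x h h' _ =>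
      let ⟨z, hz⟩ := ext_two₁₁ K x h h'
      ⟨z, fun _ => hz⟩⟩
  | 0, 1 =>
    ⟨(qres₂ K).rowExact_coker_of_one ((qres₁ K).idem₁ 0) ((qres₁ K).peirce₁ 0 0) fun x h h' H =>
      let ⟨z, hz, hz'⟩ := ext_one₁₂ K x h h' (H 0)
      ⟨z, Fin.forall_fin_two.2 ⟨hz, hz'⟩⟩,
    (qres₂ K).rowExact_coker_of_one ((qres₁ K).idem₂ 0) ((qres₁ K).peirce₂ 0 0) fun x h h' H =>
      let ⟨z, hz, hz'⟩ := ext_two₁₂ K x h h' (H 0) (H 1)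
      ⟨z, Fin.forall_fin_two.2 ⟨hz, hz'⟩⟩⟩
  | 0, 2 =>
    ⟨(qres₃ K).rowExact_coker_of_one ((qres₁ K).idem₁ 0) ((qres₁ K).peirce₁ 0 0) fun x h h' _ =>
      let ⟨z, hz⟩ := ext_one₁₃ K x h h'
      ⟨z, fun _ => hz⟩,
    (qres₃ K).rowExact_coker_of_one ((qres₁ K).idem₂ 0) ((qres₁ K).peirce₂ 0 0) fun x h h' H =>
      let ⟨z, hz⟩ := ext_two₁₃ K x h h' (H 0)
      ⟨z, fun _ => hz⟩⟩
  | 0, 3 =>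
    ⟨(qres₄ K).rowExact_coker_of_one ((qres₁ K).idem₁ 0) ((qres₁ K).peirce₁ 0 0) fun x h h' H =>
      let ⟨z, hz⟩ := ext_one₁₄ K x h h' (H 0)
      ⟨z, fun _ => hz⟩,
    (qres₄ K).rowExact_coker_of_one ((qres₁ K).idem₂ 0) ((qres₁ K).peirce₂ 0 0) fun x h h' H =>
      let ⟨z, hz⟩ := ext_two₁₄ K x h h' (H 0)
      ⟨z, fun _ => hz⟩⟩
  | 1, 0 =>
    acyclic_qres₂_coker K (qres₁ K) (fun x h h' _ _ =>
      let ⟨z, hz⟩ := ext_one₂₁ K x h h'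
      ⟨z, fun _ => hz⟩) (fun x y hx hx' hy hy' _ _ =>
      let ⟨z, hz, hw⟩ := ext_two₂₁ K x y hx hx' hy hy'
      ⟨z, fun _ => hz, fun _ => hw⟩)
  | 1, 1 =>
    acyclic_qres₂_coker K (qres₂ K) (fun x h h' H H' =>
      let ⟨z, hz, hz'⟩ := ext_one₂₂ K x h h' (H 0) (H' 0) (H 1) (H' 1)
      ⟨z, Fin.forall_fin_two.2 ⟨hz, hz'⟩⟩) (fun x y hx hx' hy hy' H H' =>
      let ⟨z, hz, hw, hz', hw'⟩ := ext_two₂₂ K x y hx hx' hy hy' (H 0) (H' 0)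
      ⟨z, Fin.forall_fin_two.2 ⟨hz, hz'⟩, Fin.forall_fin_two.2 ⟨hw, hw'⟩⟩)
  | 1, 2 =>
    acyclic_qres₂_coker K (qres₃ K) (fun x h h' _ _ =>
      let ⟨z, hz⟩ := ext_one₂₃ K x h h'
      ⟨z, fun _ => hz⟩) (fun x y hx hx' hy hy' H H' =>
      let ⟨z, hz, hw⟩ := ext_two₂₃ K x y hx hx' hy hy' (H 0) (H' 0)
      ⟨z, fun _ => hz, fun _ => hw⟩)
  | 1, 3 =>
    acyclic_qres₂_coker K (qres₄ K) (fun x h h' H H' =>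
      let ⟨z, hz⟩ := ext_one₂₄ K x h h' (H 0) (H' 0)
      ⟨z, fun _ => hz⟩) (fun x y hx hx' hy hy' H H' =>
      let ⟨z, hz, hw⟩ := ext_two₂₄ K x y hx hx' hy hy' (H 0) (H' 0)
      ⟨z, fun _ => hz, fun _ => hw⟩)
  | 2, 0 =>
    ⟨(qres₁ K).rowExact_coker_of_one ((qres₃ K).idem₁ 0) ((qres₃ K).peirce₁ 0 0) fun x h h' _ =>
      let ⟨z, hz⟩ := ext_one₃₁ K x h h'
      ⟨z, fun _ => hz⟩,
    (qres₁ K).rowExact_coker_of_one ((qres₃ K).idem₂ 0) ((qres₃ K).peirce₂ 0 0) fun x h h' _ =>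
      let ⟨z, hz⟩ := ext_two₃₁ K x h h'
      ⟨z, fun _ => hz⟩⟩
  | 2, 1 =>
    ⟨(qres₂ K).rowExact_coker_of_one ((qres₃ K).idem₁ 0) ((qres₃ K).peirce₁ 0 0) fun x h h' _ =>
      let ⟨z, hz, hz'⟩ := ext_one₃₂ K x h h'
      ⟨z, Fin.forall_fin_two.2 ⟨hz, hz'⟩⟩,
    (qres₂ K).rowExact_coker_of_one ((qres₃ K).idem₂ 0) ((qres₃ K).peirce₂ 0 0) fun x h h' H =>
      let ⟨z, hz, hz'⟩ := ext_two₃₂ K x h h' (H 0)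
      ⟨z, Fin.forall_fin_two.2 ⟨hz, hz'⟩⟩⟩
  | 2, 2 =>
    ⟨(qres₃ K).rowExact_coker_of_one ((qres₃ K).idem₁ 0) ((qres₃ K).peirce₁ 0 0) fun x h h' _ =>
      let ⟨z, hz⟩ := ext_one₃₃ K x h h'
      ⟨z, fun _ => hz⟩,
    (qres₃ K).rowExact_coker_of_one ((qres₃ K).idem₂ 0) ((qres₃ K).peirce₂ 0 0) fun x h h' _ =>
      let ⟨z, hz⟩ := ext_two₃₃ K x h h'
      ⟨z, fun _ => hz⟩⟩
  | 2, 3 =>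
    ⟨(qres₄ K).rowExact_coker_of_one ((qres₃ K).idem₁ 0) ((qres₃ K).peirce₁ 0 0) fun x h h' _ =>
      let ⟨z, hz⟩ := ext_one₃₄ K x h h'
      ⟨z, fun _ => hz⟩,
    (qres₄ K).rowExact_coker_of_one ((qres₃ K).idem₂ 0) ((qres₃ K).peirce₂ 0 0) fun x h h' H =>
      let ⟨z, hz⟩ := ext_two₃₄ K x h h' (H 0)
      ⟨z, fun _ => hz⟩⟩
  | 3, 0 =>
    ⟨(qres₁ K).rowExact_coker_of_one ((qres₄ K).idem₁ 0) ((qres₄ K).peirce₁ 0 0) fun x h h' _ =>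
      let ⟨z, hz⟩ := ext_one₄₁ K x h h'
      ⟨z, fun _ => hz⟩,
    (qres₁ K).rowExact_coker_of_one ((qres₄ K).idem₂ 0) ((qres₄ K).peirce₂ 0 0) fun x h h' _ =>
      let ⟨z, hz⟩ := ext_two₄₁ K x h h'
      ⟨z, fun _ => hz⟩⟩
  | 3, 1 =>
    ⟨(qres₂ K).rowExact_coker_of_one ((qres₄ K).idem₁ 0) ((qres₄ K).peirce₁ 0 0) fun x h h' _ =>
      let ⟨z, hz, hz'⟩ := ext_one₄₂ K x h h'
      ⟨z, Fin.forall_fin_two.2 ⟨hz, hz'⟩⟩,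
    (qres₂ K).rowExact_coker_of_one ((qres₄ K).idem₂ 0) ((qres₄ K).peirce₂ 0 0) fun x h h' H =>
      let ⟨z, hz, hz'⟩ := ext_two₄₂ K x h h' (H 0)
      ⟨z, Fin.forall_fin_two.2 ⟨hz, hz'⟩⟩⟩
  | 3, 2 =>
    ⟨(qres₃ K).rowExact_coker_of_one ((qres₄ K).idem₁ 0) ((qres₄ K).peirce₁ 0 0) fun x h h' _ =>
      let ⟨z, hz⟩ := ext_one₄₃ K x h h'
      ⟨z, fun _ => hz⟩,
    (qres₃ K).rowExact_coker_of_one ((qres₄ K).idem₂ 0) ((qres₄ K).peirce₂ 0 0) fun x h h' _ =>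
      let ⟨z, hz⟩ := ext_two₄₃ K x h h'
      ⟨z, fun _ => hz⟩⟩
  | 3, 3 =>
    ⟨(qres₄ K).rowExact_coker_of_one ((qres₄ K).idem₁ 0) ((qres₄ K).peirce₁ 0 0) fun x h h' _ =>
      let ⟨z, hz⟩ := ext_one₄₄ K x h h'
      ⟨z, fun _ => hz⟩,
    (qres₄ K).rowExact_coker_of_one ((qres₄ K).idem₂ 0) ((qres₄ K).peirce₂ 0 0) fun x h h' H =>
      let ⟨z, hz⟩ := ext_two₄₄ K x h h' (H 0)
      ⟨z, fun _ => hz⟩⟩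

theorem qidem_mul_self (j : Fin 3) : qidem K j * qidem K j = qidem K j := by
  rw [qidem_mul_qidem, if_pos rfl]

/-- The resolutions of the indecomposable summands of the cluster tilting module. -/
noncomputable def qfam : Fin 3 ⊕ Fin 4 → CyclicRes (QuatAlg K) :=
  Sum.elim (fun j => .ofIdem (qidem K j) (qidem_mul_self K j)) (qres K)

theorem acyclic_qfam_coker (k l : Fin 3 ⊕ Fin 4) : (qfam K k).Acyclic (qfam K l).Coker := by
  obtain k | k := k
  · exact acyclic_ofIdem _ _ _
  obtain l | l := l
  · exact (qres K k).acyclic_coker_ofIdem (isSymmetrizing_qform K) _ _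
  · exact acyclic_qres_coker K k l

open scoped RightActions in
theorem exists_split_of_acyclic {X : Type u} [AddCommGroup X] [Module (QuatAlg K)ᵐᵒᵖ X] [Module K X]
    [IsScalarTower K (QuatAlg K)ᵐᵒᵖ X] (hX : ∀ k, (qfam K k).Acyclic X) (hX' : Nontrivial X) :
    ∃ (k : Fin 3 ⊕ Fin 4) (f : (qfam K k).Coker →ₗ[(QuatAlg K)ᵐᵒᵖ] X)
      (g : X →ₗ[(QuatAlg K)ᵐᵒᵖ] (qfam K k).Coker), g ∘ₗ f = LinearMap.id ∧ g ≠ 0 := by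
  by_contra! hns
  have hl := isSymmetrizing_qform K
  have M₁ : (qres₁ K).Acyclic X := hX (.inr 0)
  have M₂ : (qres₂ K).Acyclic X := hX (.inr 1)
  have M₃ : (qres₃ K).Acyclic X := hX (.inr 2)
  have M₄ : (qres₄ K).Acyclic X := hX (.inr 3)
  obtain ⟨x, hx⟩ := exists_ne (0 : X)
  refine hx (eq_zero_of_chase K ?_ ?_ ?_ ?_ ?_ ?_ ?_ ?_ ?_ ?_ ?_ ?_ ?_ ?_ ?_ x)
  · exact RowExact.exists_of_one M₁.1 (by simp only [qgen_idem])
      (by simp only [mul_sub, qgen_idem_assoc])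
  · exact RowExact.exists_of_one M₁.2 (by simp only [qgen_idem])
      (by simp only [qgen_idem])
  · exact RowExact.exists_of_one M₃.1 (by simp only [qgen_idem])
      (by simp only [qgen_idem_assoc])
  · exact RowExact.exists_of_one M₃.2 (by simp only [qgen_idem])
      (by simp only [qgen_idem_assoc])
  · exact RowExact.exists_of_one M₄.1 (by simp only [qgen_idem])
      (by simp only [qgen_idem_assoc])
  · exact RowExact.exists_of_one M₄.2 (by simp only [qgen_idem])
      (by simp only [qgen_idem])
  · intro x hx hx'
    have h : 𝖾₁ * (𝖻 * 𝗒) = 𝖻 * 𝗒 := by simp only [qgen_idem_assoc]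
    have h' : 𝖾₁ * (𝖻 * (𝖽 * 𝗇)) = 𝖻 * (𝖽 * 𝗇) := by simp only [qgen_idem_assoc]
    obtain ⟨z, hz⟩ := M₂.1 (fun _ => x <• 𝖾₁) (fun _ => by simp only [op_smul_op_smul, qgen_idem])
      (Fin.forall_fin_two.2 ⟨by
        rw [Fin.sum_univ_one, op_smul_op_smul]
        exact (congrArg (x <• ·) h).trans hx, by
        rw [Fin.sum_univ_one, op_smul_op_smul]
        exact (congrArg (x <• ·) h').trans hx'⟩)
    exact ⟨z 0, by simpa only [Fin.sum_univ_one] using hz 0⟩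
  · intro v hv hv'
    have h : 𝖾₂ * (-𝗒 * (𝖻 * (𝖽 * 𝗇))) = -(𝗒 * (𝖻 * (𝖽 * 𝗇))) := by
      rw [(qneg_mul K).1, (qneg_mul K).2]
      simp only [qgen_idem_assoc]
    obtain ⟨z, hz⟩ := M₂.2 ![0, v <• 𝖾₂]
      (Fin.forall_fin_two.2 ⟨smul_zero _, by
        change v <• 𝖾₂ <• 𝖾₂ = v <• 𝖾₂
        rw [op_smul_op_smul]
        simp only [qgen_idem]⟩)
      (Fin.forall_fin_two.2 ⟨by
        rw [Fin.sum_univ_two]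
        change (0 : X) <• 𝖻 + v <• 𝖾₂ <• (-𝗒 * (𝖻 * (𝖽 * 𝗇))) = 0
        rw [smul_zero, zero_add, op_smul_op_smul, h, MulOpposite.op_neg, neg_smul, hv, neg_zero],
        by
        rw [Fin.sum_univ_two]
        change (0 : X) <• (0 : QuatAlg K) + v <• 𝖾₂ <• 𝖽 = 0
        rw [smul_zero, zero_add, op_smul_op_smul]
        simpa only [qgen_idem] using hv'⟩)
    exact ⟨z 0, (hz 1).trans (Fin.sum_univ_one _)⟩
  · exact op_smul_eq_zero_of_forall_split (e := 𝖾₁) hl (qidem_mul_self K 0)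
      (by simp only [qgen_idem_assoc]) (by simp only [mul_assoc, qgen_idem])
      (exists_mul_eq_idem1 K) (hns (.inl 0))
  · exact op_smul_eq_zero_of_forall_split (e := 𝖾₂) hl (qidem_mul_self K 1)
      (by simp only [qgen_idem_assoc]) (by simp only [mul_assoc, qgen_idem])
      (exists_mul_eq_idem2 K) (hns (.inl 1))
  · exact op_smul_eq_zero_of_forall_split (e := 𝖾₃) hl (qidem_mul_self K 2)
      (by simp only [qgen_idem_assoc]) (by simp only [mul_assoc, qgen_idem])
      (exists_mul_eq_idem3 K) (hns (.inl 2))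
  · intro x hx
    obtain ⟨z, hz⟩ := (qres₁ K).exists_of_forall_split hl (hns (.inr 0))
      (fun _ => 𝖾₃) (fun _ => by simp only [qgen_idem])
      ((Fin.sum_univ_one _).trans (by simp only [qgen_idem_assoc]))
      (exists_mul_eq_idem3 K) (fun _ => by simp only [qgen_idem]) x hx
    exact ⟨z 0, (hz 0).trans (Fin.sum_univ_one _)⟩
  · intro x hx
    have h : 𝗇 * 𝖽 * 𝖾₃ = 𝗇 * 𝖽 := by simp only [mul_assoc, qgen_idem]
    have h' : 𝖾₃ * (𝗇 * 𝖽) = 𝗇 * 𝖽 := by simp only [qgen_idem_assoc]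
    have hσ : 0 * (𝗒 * (𝖻 * 𝖽)) + 𝗇 * 𝖽 * (𝗇 * 𝖽) = 𝗇 * (𝖽 * (𝗇 * 𝖽)) := by
      rw [zero_mul, zero_add, mul_assoc]
    obtain ⟨z, hz⟩ := (qres₂ K).exists_of_forall_split hl (hns (.inr 1)) ![0, 𝗇 * 𝖽]
      (Fin.forall_fin_two.2 ⟨zero_mul _, h⟩)
      ((Fin.sum_univ_two _).trans hσ) (exists_mul_eq_idem3 K)
      (Fin.forall_fin_two.2 ⟨mul_zero _, h'⟩) x hx
    have h₀ := (hz 0).trans (Fin.sum_univ_two _)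
    have h₁ := (hz 1).trans (Fin.sum_univ_two _)
    change (0 : (QuatAlg K)ᵐᵒᵖ) • x = z 0 <• 𝖻 + z 1 <• (-𝗒 * (𝖻 * (𝖽 * 𝗇))) at h₀
    change x <• (𝗇 * 𝖽) = z 0 <• (0 : QuatAlg K) + z 1 <• 𝖽 at h₁
    rw [zero_smul, (qneg_mul K).1, MulOpposite.op_neg, neg_smul, eq_comm, add_neg_eq_zero] at h₀
    rw [MulOpposite.op_zero, zero_smul, zero_add] at h₁
    exact ⟨z 0, z 1, h₀, h₁.symm⟩
  · intro x hx
    obtain ⟨z, hz⟩ := (qres₃ K).exists_of_forall_split hl (hns (.inr 2))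
      (fun _ => 𝗇 * 𝖽) (fun _ => by simp only [mul_assoc, qgen_idem])
      ((Fin.sum_univ_one _).trans (mul_assoc _ _ _))
      (exists_mul_eq_idem3 K) (fun _ => by simp only [qgen_idem_assoc]) x hx
    exact ⟨z 0, (hz 0).trans (Fin.sum_univ_one _)⟩
  · intro x hx
    obtain ⟨z, hz⟩ := (qres₄ K).exists_of_forall_split hl (hns (.inr 3))
      (fun _ => 𝖽 * (𝗇 * (𝗒 * (𝖻 * (𝖽 * 𝗇))))) (fun _ => by simp only [mul_assoc, qgen_idem])
      ((Fin.sum_univ_one _).trans (by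
        simp only [mul_assoc, mul_sub, qgen_rules, qgen_rules_assoc, mul_zero, sub_zero]))
      (exists_mul_eq_idem2 K) (fun _ => by simp only [qgen_idem_assoc]) x hx
    exact ⟨z 0, (hz 0).trans (Fin.sum_univ_one _)⟩

end Arithmetic

section Summands

open MulOpposite

variable {K : Type u} [Field K]

/-- The map `eA → eA/rA`. -/
noncomputable def CyclicRes.toCyclicQuot (S : CyclicRes (QuatAlg K)) (r : QuatAlg K) :
    idemModule S.e₀ →ₗ[(QuatAlg K)ᵐᵒᵖ] cyclicQuot K (S.e₀ 0) r :=
  ((Submodule.mkQ _ ∘ₗ .proj 0) ∘ₗ (idemModule S.e₀).subtype).codRestrict _ fun v =>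
    ⟨v.1 0, Submodule.mem_span_singleton.2 ⟨op (v.1 0), v.2 0⟩, rfl⟩

theorem CyclicRes.toCyclicQuot_surjective (S : CyclicRes (QuatAlg K)) (r : QuatAlg K) :
    Function.Surjective (S.toCyclicQuot r) := by
  rintro ⟨_, y, hy, rfl⟩
  obtain ⟨a, rfl⟩ := Submodule.mem_span_singleton.1 hy
  refine ⟨⟨fun i => S.e₀ i * a.unop, fun i => by rw [← mul_assoc, S.idem₀]⟩, rfl⟩

theorem CyclicRes.ker_toCyclicQuot (S : CyclicRes (QuatAlg K)) {r : QuatAlg K}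
    (hr : S.D₀ 0 0 = r) : LinearMap.range (idemMap S.peirce₀) = LinearMap.ker (S.toCyclicQuot r) := by
  subst hr
  ext v
  have hv : v ∈ LinearMap.ker (S.toCyclicQuot (S.D₀ 0 0)) ↔ ∃ a : (QuatAlg K)ᵐᵒᵖ, a • S.D₀ 0 0 = v.1 0 := by
    rw [← Submodule.mem_span_singleton, ← Submodule.Quotient.mk_eq_zero, LinearMap.mem_ker,
      Subtype.ext_iff]
    rfl
  rw [hv]
  constructor
  · rintro ⟨w, rfl⟩
    exact ⟨op (w.1 0), (Fin.sum_univ_one fun j => S.D₀ 0 j * w.1 j).symm⟩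
  · rintro ⟨a, ha⟩
    refine ⟨⟨fun i => S.e₁ i * a.unop, fun i => by rw [← mul_assoc, S.idem₁]⟩, Subtype.ext (funext fun i => ?_)⟩
    rw [Subsingleton.elim i 0, ← ha, idemMap_apply, Fin.sum_univ_one, ← mul_assoc, (S.peirce₀ 0 0).2]
    rfl

/-- The module presented by `S` is `eA/rA`. -/
noncomputable def CyclicRes.cokerEquiv (S : CyclicRes (QuatAlg K)) {e r : QuatAlg K}
    (he : S.e₀ 0 = e) (hr : S.D₀ 0 0 = r) : S.Coker ≃ₗ[(QuatAlg K)ᵐᵒᵖ] cyclicQuot K e r :=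
  he ▸ (Submodule.quotEquivOfEq _ _ (S.ker_toCyclicQuot hr)).trans
    ((S.toCyclicQuot r).quotKerEquivOfSurjective (S.toCyclicQuot_surjective r))

/-- The inclusion `eA → A`. -/
noncomputable def ofIdemIncl {A : Type u} [Ring A] (e : A) (he : e * e = e) :
    (CyclicRes.ofIdem e he).Coker →ₗ[Aᵐᵒᵖ] A :=
  .proj 0 ∘ₗ (idemModule _).subtype ∘ₗ (CyclicRes.ofIdem e he).cokerEmb

/-- The projection `A → eA`. -/
noncomputable def ofIdemProj {A : Type u} [Ring A] (e : A) (he : e * e = e) :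
    A →ₗ[Aᵐᵒᵖ] (CyclicRes.ofIdem e he).Coker where
  toFun a := op a • (CyclicRes.ofIdem e he).gen
  map_add' a b := add_smul (op a) (op b) _
  map_smul' c a := by rw [RingHom.id_apply, ← mul_smul]; rfl

theorem ofIdemIncl_ofIdemProj {A : Type u} [Ring A] (e : A) (he : e * e = e) (a : A) :
    ofIdemIncl e he (ofIdemProj e he a) = e * a :=
  (CyclicRes.ofIdem e he).cokerEmb_op_smul_gen a 0

theorem ofIdemProj_comp_ofIdemIncl {A : Type u} [Ring A] (e : A) (he : e * e = e) :
    ofIdemProj e he ∘ₗ ofIdemIncl e he = LinearMap.id := by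
  refine LinearMap.ext fun y => ?_
  obtain ⟨a, ha, rfl⟩ := (CyclicRes.ofIdem e he).exists_op_smul_gen y
  have ha : e * a = a := ha
  change ofIdemProj e he (ofIdemIncl e he (ofIdemProj e he a)) = ofIdemProj e he a
  rw [ofIdemIncl_ofIdemProj, ha]

theorem isNClusterTilting_of_decomposition {P : Type u} [AddCommGroup P]
    [Module (QuatAlg K)ᵐᵒᵖ P] (f : ∀ l, P →ₗ[(QuatAlg K)ᵐᵒᵖ] (qres K l).Coker)
    (g : ∀ l, (qres K l).Coker →ₗ[(QuatAlg K)ᵐᵒᵖ] P) (hfg : ∀ x, ∑ l, g l (f l x) = x)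
    (hgf : ∀ l y, f l (g l y) = y) :
    IsNClusterTilting (QuatAlg K)ᵐᵒᵖ 3 (ModuleCat.of (QuatAlg K)ᵐᵒᵖ (QuatAlg K × P)) := by
  let F : ∀ k, (QuatAlg K × P) →ₗ[(QuatAlg K)ᵐᵒᵖ] (qfam K k).Coker
    | .inl j => ofIdemProj _ (qidem_mul_self K j) ∘ₗ .fst _ _ _
    | .inr l => f l ∘ₗ .snd _ _ _
  let G : ∀ k, (qfam K k).Coker →ₗ[(QuatAlg K)ᵐᵒᵖ] (QuatAlg K × P)
    | .inl j => .inl _ _ _ ∘ₗ ofIdemIncl _ (qidem_mul_self K j)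
    | .inr l => .inr _ _ _ ∘ₗ g l
  refine isNClusterTilting_three_of_cyclicRes (isSymmetrizing_qform K) (qfam K) _ F G
    (LinearMap.ext fun x => ?_) (fun k => ?_) (acyclic_qfam_coker K)
    fun X _ _ _ _ => exists_split_of_acyclic K
  · obtain ⟨a, x⟩ := x
    have hl (j : Fin 3) : G (.inl j) (F (.inl j) (a, x)) = (qidem K j * a, 0) :=
      congrArg (·, (0 : P)) (ofIdemIncl_ofIdemProj _ (qidem_mul_self K j) a)
    have hr (l : Fin 4) : G (.inr l) (F (.inr l) (a, x)) = (0, g l (f l x)) := rfl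
    have hu : ∑ j, qidem K j * a = a := by
      rw [← Finset.sum_mul, Fin.sum_univ_three]
      exact (congrArg (· * a) (qgen_unit K)).trans (one_mul a)
    rw [LinearMap.sum_apply, Fintype.sum_sum_type]
    refine (congrArg₂ (· + ·) (Finset.sum_congr rfl fun j _ => hl j)
      (Finset.sum_congr rfl fun l _ => hr l)).trans (Prod.ext ?_ ?_)
    · simpa [Prod.fst_sum] using hu
    · simpa [Prod.snd_sum] using hfg x
  · obtain j | l := k
    · exact ofIdemProj_comp_ofIdemIncl _ (qidem_mul_self K j)
    · exact LinearMap.ext (hgf l)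

theorem isNClusterTilting_of_equiv {Y₀ Y₁ Y₂ Y₃ : Type u} [AddCommGroup Y₀] [AddCommGroup Y₁]
    [AddCommGroup Y₂] [AddCommGroup Y₃] [Module (QuatAlg K)ᵐᵒᵖ Y₀] [Module (QuatAlg K)ᵐᵒᵖ Y₁]
    [Module (QuatAlg K)ᵐᵒᵖ Y₂] [Module (QuatAlg K)ᵐᵒᵖ Y₃]
    (E₀ : (qres K 0).Coker ≃ₗ[(QuatAlg K)ᵐᵒᵖ] Y₀) (E₁ : (qres K 1).Coker ≃ₗ[(QuatAlg K)ᵐᵒᵖ] Y₁)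
    (E₂ : (qres K 2).Coker ≃ₗ[(QuatAlg K)ᵐᵒᵖ] Y₂) (E₃ : (qres K 3).Coker ≃ₗ[(QuatAlg K)ᵐᵒᵖ] Y₃) :
    IsNClusterTilting (QuatAlg K)ᵐᵒᵖ 3
      (ModuleCat.of (QuatAlg K)ᵐᵒᵖ (QuatAlg K × Y₀ × Y₁ × Y₂ × Y₃)) := by
  let f : ∀ l, (Y₀ × Y₁ × Y₂ × Y₃) →ₗ[(QuatAlg K)ᵐᵒᵖ] (qres K l).Coker
    | 0 => E₀.symm ∘ₗ .fst _ _ _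
    | 1 => E₁.symm ∘ₗ .fst _ _ _ ∘ₗ .snd _ _ _
    | 2 => E₂.symm ∘ₗ .fst _ _ _ ∘ₗ .snd _ _ _ ∘ₗ .snd _ _ _
    | 3 => E₃.symm ∘ₗ .snd _ _ _ ∘ₗ .snd _ _ _ ∘ₗ .snd _ _ _
  let g : ∀ l, (qres K l).Coker →ₗ[(QuatAlg K)ᵐᵒᵖ] (Y₀ × Y₁ × Y₂ × Y₃)
    | 0 => .inl _ _ _ ∘ₗ E₀
    | 1 => .inr _ _ _ ∘ₗ .inl _ _ _ ∘ₗ E₁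
    | 2 => .inr _ _ _ ∘ₗ .inr _ _ _ ∘ₗ .inl _ _ _ ∘ₗ E₂
    | 3 => .inr _ _ _ ∘ₗ .inr _ _ _ ∘ₗ .inr _ _ _ ∘ₗ E₃
  refine isNClusterTilting_of_decomposition f g (fun x => ?_) fun l y => ?_
  · simp [f, g, Fin.sum_univ_four]
  · fin_cases l <;> simp [f, g]

end Summands

open QGen in
/-- Over any field `K` of characteristic two, the module
`M = A ⊕ M₁ ⊕ M₂ ⊕ M₃ ⊕ M₄` over the algebra `A = Q(3A)₂²` of quaternion type, where
`M₁ = e₃A/nA`, `M₂ = e₃A/nybdnyA`, `M₃ = e₃A/nyA` and `M₄ = e₂A/yA`, is a `3`-cluster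
tilting right `A`-module. -/
theorem quatAlg_has_threeClusterTilting (K : Type u) [Field K] [CharP K 2] :
    IsNClusterTilting (QuatAlg K)ᵐᵒᵖ 3
      (ModuleCat.of (QuatAlg K)ᵐᵒᵖ
        (QuatAlg K ×
          ↥(cyclicQuot K (qgen K v3) (qgen K an)) ×
          ↥(cyclicQuot K (qgen K v3)
            (qgen K an * qgen K ay * qgen K ab * qgen K ad * qgen K an * qgen K ay)) ×
          ↥(cyclicQuot K (qgen K v3) (qgen K an * qgen K ay)) ×
          ↥(cyclicQuot K (qgen K v2) (qgen K ay)))) := by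
  exact isNClusterTilting_of_equiv ((qres₁ K).cokerEquiv rfl rfl)
    ((qres₂ K).cokerEquiv rfl (by simp only [mul_assoc])) ((qres₃ K).cokerEquiv rfl rfl)
    ((qres₄ K).cokerEquiv rfl rfl)
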